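/- (QES-entropy accumulation with leakage) Let ρ be a state generated by a sequence of GEATTL channels {M_j}_{j=1}^n with M_j = 𝒩_j∘𝓛_j. For each j and each value c̄_1^{j−1}ĉ_1^{j−1} of the previous classical scores, let f_{|c̄_1^{j−1}ĉ_1^{j−1}} be a QES on C̄_jĈ_j, and define the QES f_full on C̄_1^nĈ_1^n by f_full(c̄_1^n ĉ_1^n) = Σ_{j=1}^n f_{|c̄_1^{j−1}ĉ_1^{j−1}}(c̄_j ĉ_j). Take any α ∈ (1,2) and let α̂ = 1/(2−α). Then H^{f_full}_{2−1/α}(S_1^n C̄_1^n | Ĉ_1^n E_n)_ρ ≥ Σ_{j=1}^n ( min over c̄_1^{j−1}ĉ_1^{j−1} of κ_{c̄_1^{j−1}ĉ_1^{j−1}} − ξ_j ), where κ_{c̄_1^{j−1}ĉ_1^{j−1}} = inf over ν ∈ Σ_j^𝒩 of H^{f_{|c̄_1^{j−1}ĉ_1^{j−1}}}_{α̂}(S_j C̄_j | Ĉ_j E_j Ẽ)_ν and ξ_j = sup over ν ∈ Σ_j^𝓛 of I_α↓(Z̃;L_j)_ν; here Σ_j^𝒩 is the set of states 𝒩_j(ω)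 for normalized ω on R̂_{j−1}, L_j, E_{j−1}, Ẽ (with Ẽ large enough to purify R̂_{j−1}L_jE_{j−1}) and Σ_j^𝓛 is the set of states 𝓛_j(ω'') for normalized ω'' on R_{j−1}, Z̃ (with Z̃ large enough to purify R̂_{j−1}). Consequently, defining the normalized QES f̂_full(c̄_1^n ĉ_1^n) = Σ_j [f_{|c̄_1^{j−1}ĉ_1^{j−1}}(c̄_j ĉ_j) + κ_{c̄_1^{j−1}ĉ_1^{j−1}} − ξ_j], one has H^{f̂_full}_{2−1/α}(S_1^n C̄_1^n | Ĉ_1^n E_n)_ρ ≥ 0. -/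

import Mathlib

open scoped Kronecker
open Matrix
open scoped ComplexOrder

noncomputable section
namespace QITLeak

variable {A B : Type*}

/-- Real matrix power via spectral decomposition (Moore–Penrose pseudoinverse powers,
since `(0:ℝ) ^ (p:ℝ) = 0` for `p ≠ 0`). Junk value `0` on non-Hermitian input. -/
noncomputable def mpow [Fintype A] [DecidableEq A] (ρ : Matrix A A ℂ) (p : ℝ) :
    Matrix A A ℂ :=
  if hρ : ρ.IsHermitian then
    (hρ.eigenvectorUnitary : Matrix A A ℂ) *
      Matrix.diagonal (fun i => ((hρ.eigenvalues i ^ p : ℝ) : ℂ)) *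
      (star (hρ.eigenvectorUnitary : Matrix A A ℂ))
  else 0

/-- A normalized state (density matrix). -/
def IsState [Fintype A] (ρ : Matrix A A ℂ) : Prop := ρ.PosSemidef ∧ ρ.trace = 1

/-- A subnormalized state. -/
def IsSubState [Fintype A] (ρ : Matrix A A ℂ) : Prop := ρ.PosSemidef ∧ (ρ.trace).re ≤ 1

/-- Partial trace over the second tensor factor. -/
def ptB [Fintype B] (ρ : Matrix (A × B) (A × B) ℂ) : Matrix A A ℂ :=
  Matrix.of fun a a' => ∑ b, ρ (a, b) (a', b)

/-- Partial trace over the first tensor factor. -/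
def ptA [Fintype A] (ρ : Matrix (A × B) (A × B) ℂ) : Matrix B B ℂ :=
  Matrix.of fun b b' => ∑ a, ρ (a, b) (a, b')

/-- Partial trace over the factor `B`, along a decomposition `X ≃ A × B` of the registers. -/
def traceOut {X A B : Type*} [Fintype B] (e : X ≃ A × B) (ρ : Matrix X X ℂ) :
    Matrix A A ℂ :=
  Matrix.of fun a a' => ∑ b, ρ (e.symm (a, b)) (e.symm (a', b))

/-- Support inclusion `supp ρ ⊆ supp σ` (for PSD matrices: kernel inclusion). -/
def suppSubset [Fintype A] (ρ σ : Matrix A A ℂ) : Prop :=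
  ∀ v : A → ℂ, σ *ᵥ v = 0 → ρ *ᵥ v = 0

/-- The real-valued core formula of the sandwiched Rényi divergence (base 2). -/
def DR (α : ℝ) [Fintype A] [DecidableEq A] (ρ σ : Matrix A A ℂ) : ℝ :=
  (α - 1)⁻¹ * Real.logb 2
    (((mpow (mpow σ ((1 - α) / (2 * α)) * ρ * mpow σ ((1 - α) / (2 * α))) α).trace.re)
      / (ρ.trace).re)

open scoped Classical in
/-- The sandwiched Rényi divergence `D_α(ρ‖σ)`, with value `⊤` outside the
support/orthogonality conditions. -/
def D (α : ℝ) [Fintype A] [DecidableEq A] (ρ σ : Matrix A A ℂ) : EReal :=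
  if (α < 1 ∧ ¬ (ρ * σ = 0 ∧ σ * ρ = 0)) ∨ suppSubset ρ σ then ((DR α ρ σ : ℝ) : EReal)
  else ⊤

/-- The max-divergence `D_∞(ρ‖σ)`: log of the least `μ ≥ 0` with `ρ ≤ μσ` (`⊤` if none). -/
def Dmax [Fintype A] (ρ σ : Matrix A A ℂ) : EReal :=
  sInf {x : EReal | ∃ μ : ℝ, 0 ≤ μ ∧ (μ • σ - ρ).PosSemidef ∧ x = ((Real.logb 2 μ : ℝ) : EReal)}

section Ent
variable [Fintype A] [DecidableEq A] [Fintype B] [DecidableEq B]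

/-- `H_α↑(A|B)_ρ` for `ρ` on `A × B`. -/
def HUp (α : ℝ) (ρ : Matrix (A × B) (A × B) ℂ) : EReal :=
  - sInf {x : EReal | ∃ σ : Matrix B B ℂ, IsState σ ∧ x = D α ρ ((1 : Matrix A A ℂ) ⊗ₖ σ)}

/-- `H_α(A|B)_ρ` for `ρ` on `A × B`. -/
def Hdn (α : ℝ) (ρ : Matrix (A × B) (A × B) ℂ) : EReal :=
  - D α ρ ((1 : Matrix A A ℂ) ⊗ₖ ptA ρ)

/-- `I_α↓(A;B)_ρ` for `ρ` on `A × B`. -/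
def Idown (α : ℝ) (ρ : Matrix (A × B) (A × B) ℂ) : EReal :=
  sInf {x : EReal | ∃ σ : Matrix B B ℂ, IsState σ ∧ x = D α ρ ((ptB ρ) ⊗ₖ σ)}

/-- `I_α(A:B)_ρ` for `ρ` on `A × B`. -/
def Imut (α : ℝ) (ρ : Matrix (A × B) (A × B) ℂ) : EReal :=
  D α ρ ((ptB ρ) ⊗ₖ (ptA ρ))

/-- `I_α↓↓(A:B)_ρ` for `ρ` on `A × B`. -/
def Idd (α : ℝ) (ρ : Matrix (A × B) (A × B) ℂ) : EReal :=
  sInf {x : EReal | ∃ (ω : Matrix A A ℂ) (σ : Matrix B B ℂ),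
    IsState ω ∧ IsState σ ∧ x = D α ρ (ω ⊗ₖ σ)}

/-- `H_min↑(A|B)_ρ = H_∞↑(A|B)_ρ`. -/
def HminUp (ρ : Matrix (A × B) (A × B) ℂ) : EReal :=
  - sInf {x : EReal | ∃ σ : Matrix B B ℂ, IsState σ ∧ x = Dmax ρ ((1 : Matrix A A ℂ) ⊗ₖ σ)}

/-- `I_∞↓(A;B)_ρ`. -/
def ImaxD (ρ : Matrix (A × B) (A × B) ℂ) : EReal :=
  sInf {x : EReal | ∃ σ : Matrix B B ℂ, IsState σ ∧ x = Dmax ρ ((ptB ρ) ⊗ₖ σ)}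

/-- `I_∞(A:B)_ρ` (unoptimized max-information). -/
def ImaxND (ρ : Matrix (A × B) (A × B) ℂ) : EReal :=
  Dmax ρ ((ptB ρ) ⊗ₖ (ptA ρ))

/-- `I_∞↓↓(A:B)_ρ`. -/
def IddMax (ρ : Matrix (A × B) (A × B) ℂ) : EReal :=
  sInf {x : EReal | ∃ (ω : Matrix A A ℂ) (σ : Matrix B B ℂ),
    IsState ω ∧ IsState σ ∧ x = Dmax ρ (ω ⊗ₖ σ)}

end Ent

/-- Trace norm. -/
def traceNorm [Fintype A] [DecidableEq A] (M : Matrix A A ℂ) : ℝ :=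
  (mpow (Mᴴ * M) (1 / 2 : ℝ)).trace.re

/-- Generalized fidelity of subnormalized states. -/
def gFid [Fintype A] [DecidableEq A] (ρ σ : Matrix A A ℂ) : ℝ :=
  traceNorm (mpow ρ (1 / 2 : ℝ) * mpow σ (1 / 2 : ℝ)) +
    Real.sqrt ((1 - ρ.trace.re) * (1 - σ.trace.re))

/-- Purified distance. -/
def pDist [Fintype A] [DecidableEq A] (ρ σ : Matrix A A ℂ) : ℝ :=
  Real.sqrt (1 - gFid ρ σ ^ 2)

section Smooth
variable [Fintype A] [DecidableEq A] [Fintype B] [DecidableEq B]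

/-- Smoothed min-entropy `H_min↑,ε(A|B)_ρ`. -/
def HminUpEps (ε : ℝ) (ρ : Matrix (A × B) (A × B) ℂ) : EReal :=
  sSup {x : EReal | ∃ ρ' : Matrix (A × B) (A × B) ℂ,
    IsSubState ρ' ∧ pDist ρ' ρ ≤ ε ∧ x = HminUp ρ'}

/-- Smoothed max-information `I_max↓,ε(A;B)_ρ`. -/
def ImaxDEps (ε : ℝ) (ρ : Matrix (A × B) (A × B) ℂ) : EReal :=
  sInf {x : EReal | ∃ ρ' : Matrix (A × B) (A × B) ℂ,
    IsSubState ρ' ∧ pDist ρ' ρ ≤ ε ∧ x = ImaxD ρ'}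

/-- Smoothed (unoptimized) max-information `I_max^ε(A:B)_ρ`. -/
def ImaxNDEps (ε : ℝ) (ρ : Matrix (A × B) (A × B) ℂ) : EReal :=
  sInf {x : EReal | ∃ ρ' : Matrix (A × B) (A × B) ℂ,
    IsSubState ρ' ∧ pDist ρ' ρ ≤ ε ∧ x = ImaxND ρ'}

/-- Smoothed max-information `I_max↓↓,ε(A:B)_ρ`. -/
def IddMaxEps (ε : ℝ) (ρ : Matrix (A × B) (A × B) ℂ) : EReal :=
  sInf {x : EReal | ∃ ρ' : Matrix (A × B) (A × B) ℂ,
    IsSubState ρ' ∧ pDist ρ' ρ ≤ ε ∧ x = IddMax ρ'}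

/-- Smoothed Rényi conditional entropy `H_α↑,ε(A|B)_ρ`. -/
def HUpEps (α ε : ℝ) (ρ : Matrix (A × B) (A × B) ℂ) : EReal :=
  sSup {x : EReal | ∃ ρ' : Matrix (A × B) (A × B) ℂ,
    IsSubState ρ' ∧ pDist ρ' ρ ≤ ε ∧ x = HUp α ρ'}

end Smooth

/-- Extension `id_R ⊗ Φ` of a linear map on matrices, with a spectator register on the left. -/
def lext {R A B : Type*} (Φ : Matrix A A ℂ →ₗ[ℂ] Matrix B B ℂ) :
    Matrix (R × A) (R × A) ℂ →ₗ[ℂ] Matrix (R × B) (R × B) ℂ where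
  toFun ρ := Matrix.of fun p q => Φ (Matrix.of fun a a' => ρ (p.1, a) (q.1, a')) p.2 q.2
  map_add' x y := by
    ext p q
    show Φ ((Matrix.of fun a a' => x (p.1, a) (q.1, a'))
        + (Matrix.of fun a a' => y (p.1, a) (q.1, a'))) p.2 q.2 = _
    rw [map_add]; rfl
  map_smul' c x := by
    ext p q
    show Φ (c • (Matrix.of fun a a' => x (p.1, a) (q.1, a'))) p.2 q.2 = _
    rw [_root_.map_smul]; rfl

/-- Extension `Φ ⊗ id_R` of a linear map on matrices, with a spectator register on the right. -/
def rext {A B R : Type*} (Φ : Matrix A A ℂ →ₗ[ℂ] Matrix B B ℂ) :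
    Matrix (A × R) (A × R) ℂ →ₗ[ℂ] Matrix (B × R) (B × R) ℂ where
  toFun ρ := Matrix.of fun p q => Φ (Matrix.of fun a a' => ρ (a, p.2) (a', q.2)) p.1 q.1
  map_add' x y := by
    ext p q
    show Φ ((Matrix.of fun a a' => x (a, p.2) (a', q.2))
        + (Matrix.of fun a a' => y (a, p.2) (a', q.2))) p.1 q.1 = _
    rw [map_add]; rfl
  map_smul' c x := by
    ext p q
    show Φ (c • (Matrix.of fun a a' => x (a, p.2) (a', q.2))) p.1 q.1 = _
    rw [_root_.map_smul]; rfl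

/-- Completely positive trace-preserving map (quantum channel). -/
structure IsCPTP {A B : Type*} [Fintype A] [Fintype B]
    (Φ : Matrix A A ℂ →ₗ[ℂ] Matrix B B ℂ) : Prop where
  cp : ∀ (n : ℕ) (ρ : Matrix (Fin n × A) (Fin n × A) ℂ), ρ.PosSemidef →
    ((lext Φ) ρ).PosSemidef
  tp : ∀ ρ : Matrix A A ℂ, (Φ ρ).trace = ρ.trace

/-- The rank-one (pure) state associated to a vector. -/
def pureState {A : Type*} (ψ : A → ℂ) : Matrix A A ℂ := Matrix.vecMulVec ψ (star ψ)


/-! ## Statement 17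
QES-entropy accumulation with leakage (Theorem `GREATleakage`).
Indexing convention: round `j = 0, …, n−1` corresponds to round `j+1` of the paper, so
`𝓛 j : R_j → R̂_j L_{j+1}` and `𝒩 j : R̂_j L_{j+1} E_j → S_{j+1} R_{j+1} E_{j+1} C̄_{j+1} Ĉ_{j+1}`.
The purifying register `Ẽ` for `R̂_{j} L_{j+1} E_{j}` is taken to be (a copy of) that register,
and the purifying register `Z̃` for `R_j` is a copy of `R_j`. -/

/-- snoc equivalence for prefix tuples over an `ℕ`-indexed family. -/
def snocEquiv (T : ℕ → Type) (i : ℕ) :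
    ((∀ j : Fin i, T j) × T i) ≃ (∀ j : Fin (i + 1), T j) where
  toFun p := Fin.snoc (α := fun j : Fin (i + 1) => T j) p.1 p.2
  invFun q := (fun j => q j.castSucc, q (Fin.last i))
  left_inv p := by
    obtain ⟨f, x⟩ := p
    refine Prod.ext ?_ ?_
    · funext j; simp
    · simp
  right_inv q := by
    funext j
    refine Fin.lastCases ?_ ?_ j
    · simp
    · intro k; simp

/-- Pinching channel on the middle classical register of `(X × C) × Y`. -/
def pinchC {X C Y : Type} [DecidableEq C]
    (M : Matrix ((X × C) × Y) ((X × C) × Y) ℂ) : Matrix ((X × C) × Y) ((X × C) × Y) ℂ :=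
  Matrix.of fun p q => if p.1.2 = q.1.2 then M p q else 0

/-- The subnormalized partial state `ρ_{Q'∧ĉ}` on `Q'` of a state on `(Q × Q') × (C̄ × Ĉ)`
that is classical on `C̄ × Ĉ`. -/
noncomputable def QprimeBlock {Q Q' Cb Ch : Type*} [Fintype Q] [Fintype Cb]
    (ρ : Matrix ((Q × Q') × (Cb × Ch)) ((Q × Q') × (Cb × Ch)) ℂ) (ch : Ch) :
    Matrix Q' Q' ℂ :=
  Matrix.of fun q' q'' => ∑ cb : Cb, ∑ q : Q, ρ ((q, q'), (cb, ch)) ((q, q''), (cb, ch))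

/-- The QES-entropy `H^f_α(Q C̄ | Ĉ Q')_ρ` of order `α`, for a state arranged on
`(Q × Q') × (C̄ × Ĉ)` that is classical on `C̄ × Ĉ` (the third expression of
Def. "QES"): `(1/(1−α)) log Σ_{c̄ĉ} 2^{−(1−α)f(c̄ĉ)}
Tr[((ρ_{Q'∧ĉ})^{(1−α)/(2α)} ρ_{QQ'∧c̄ĉ} (ρ_{Q'∧ĉ})^{(1−α)/(2α)})^α]`. -/
noncomputable def QESent {Q Q' Cb Ch : Type*} [Fintype Q] [DecidableEq Q]
    [Fintype Q'] [DecidableEq Q'] [Fintype Cb] [DecidableEq Cb] [Fintype Ch] [DecidableEq Ch]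
    (α : ℝ) (f : Cb → Ch → ℝ)
    (ρ : Matrix ((Q × Q') × (Cb × Ch)) ((Q × Q') × (Cb × Ch)) ℂ) : ℝ :=
  (1 - α)⁻¹ * Real.logb 2 (∑ c : Cb × Ch,
    (2 : ℝ) ^ (-(1 - α) * f c.1 c.2) *
    ((mpow
      (((1 : Matrix Q Q ℂ) ⊗ₖ mpow (QprimeBlock ρ c.2) ((1 - α) / (2 * α))) *
        (Matrix.of fun x y => ρ (x, c) (y, c)) *
        ((1 : Matrix Q Q ℂ) ⊗ₖ mpow (QprimeBlock ρ c.2) ((1 - α) / (2 * α)))) α).trace.re))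

section GEATTL

variable (R E S Rh Lk Cb Ch : ℕ → Type)

/-- Accumulated classical/secret registers after `j` rounds. -/
abbrev Acc (j : ℕ) : Type :=
  (∀ i : Fin j, S i) × ((∀ i : Fin j, Cb i) × (∀ i : Fin j, Ch i))

/-- Initial arrangement: adjoin the empty accumulated registers. -/
def eInit : (R 0 × E 0) ≃ (Acc S Cb Ch 0 × (R 0 × E 0)) where
  toFun x := (((fun i => i.elim0), ((fun i => i.elim0), (fun i => i.elim0))), x)
  invFun y := y.2
  left_inv _ := rfl
  right_inv y := by
    refine Prod.ext (Prod.ext ?_ (Prod.ext ?_ ?_)) rfl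
    · funext i; exact i.elim0
    · funext i; exact i.elim0
    · funext i; exact i.elim0

/-- Shuffle before appending the round-`j` outputs to the accumulated registers. -/
def eAccShuffle (j : ℕ) (Y : Type) :
    (Acc S Cb Ch j × ((S j × (Cb j × Ch j)) × Y)) ≃
      (((((∀ i : Fin j, S i) × S j)) ×
        (((∀ i : Fin j, Cb i) × Cb j) × ((∀ i : Fin j, Ch i) × Ch j))) × Y) where
  toFun x := (((x.1.1, x.2.1.1), ((x.1.2.1, x.2.1.2.1), (x.1.2.2, x.2.1.2.2))), x.2.2)
  invFun y := ((y.1.1.1, (y.1.2.1.1, y.1.2.2.1)), ((y.1.1.2, (y.1.2.1.2, y.1.2.2.2)), y.2))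
  left_inv _ := rfl
  right_inv _ := rfl

/-- Arrangement step after each round. -/
def eAccStep (j : ℕ) (Y : Type) :
    (Acc S Cb Ch j × ((S j × (Cb j × Ch j)) × Y)) ≃ (Acc S Cb Ch (j + 1) × Y) :=
  (eAccShuffle S Cb Ch j Y).trans
    (((snocEquiv S j).prodCongr ((snocEquiv Cb j).prodCongr (snocEquiv Ch j))).prodCongr
      (Equiv.refl Y))

variable [∀ i, Fintype (R i)] [∀ i, DecidableEq (R i)]
  [∀ i, Fintype (E i)] [∀ i, DecidableEq (E i)]
  [∀ i, Fintype (S i)] [∀ i, DecidableEq (S i)]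
  [∀ i, Fintype (Cb i)] [∀ i, DecidableEq (Cb i)]
  [∀ i, Fintype (Ch i)] [∀ i, DecidableEq (Ch i)]

/-- The state generated by a sequence of (GEATTL) channels
`M j : R_j E_j → S_{j+1} C̄_{j+1} Ĉ_{j+1} R_{j+1} E_{j+1}` from initial state `ω0`. -/
noncomputable def geattlState
    (M : (j : ℕ) → Matrix (R j × E j) (R j × E j) ℂ →ₗ[ℂ]
      Matrix ((S j × (Cb j × Ch j)) × (R (j + 1) × E (j + 1)))
        ((S j × (Cb j × Ch j)) × (R (j + 1) × E (j + 1))) ℂ)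
    (ω0 : Matrix (R 0 × E 0) (R 0 × E 0) ℂ) :
    (j : ℕ) → Matrix (Acc S Cb Ch j × (R j × E j)) (Acc S Cb Ch j × (R j × E j)) ℂ
  | 0 => (Matrix.reindex (eInit R E S Cb Ch) (eInit R E S Cb Ch)) ω0
  | (j + 1) =>
    (Matrix.reindex (eAccStep S Cb Ch j (R (j + 1) × E (j + 1)))
        (eAccStep S Cb Ch j (R (j + 1) × E (j + 1))))
      ((lext (M j)) (geattlState M ω0 j))

end GEATTL

/-- `(S_j × (C̄_j × Ĉ_j)) × (R_{j+1} × E_{j+1}) ≃ ((E_{j+1} × Ĉ_j) × ((S_j × C̄_j) × R_{j+1}))`,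
used to state the non-signalling condition. -/
def eNSout (Sj Cbj Chj Rj Ej : Type) :
    (Sj × (Cbj × Chj)) × (Rj × Ej) ≃ (Ej × Chj) × ((Sj × Cbj) × Rj) where
  toFun x := ((x.2.2, x.1.2.2), ((x.1.1, x.1.2.1), x.2.1))
  invFun y := ((y.2.1.1, (y.2.1.2, y.1.2)), (y.2.2, y.1.1))
  left_inv _ := rfl
  right_inv _ := rfl

/-- `(R̂_j × L_j) × E_j ≃ (L_j × E_j) × R̂_j`. -/
def eNSin (Rhj Lj Ej : Type) : (Rhj × Lj) × Ej ≃ (Lj × Ej) × Rhj where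
  toFun x := ((x.1.2, x.2), x.1.1)
  invFun y := ((y.2, y.1.1), y.1.2)
  left_inv _ := rfl
  right_inv _ := rfl

/-- `Ẽ × ((S_j × (C̄_j × Ĉ_j)) × (R_{j+1} × E_{j+1})) ≃
((S_j × (E_{j+1} × Ẽ)) × (C̄_j × Ĉ_j)) × R_{j+1}` — the arrangement for the single-round
QES-entropies (tracing out `R_{j+1}`). -/
def eKappa (T Sj Cbj Chj Rj Ej : Type) :
    T × ((Sj × (Cbj × Chj)) × (Rj × Ej)) ≃ ((Sj × (Ej × T)) × (Cbj × Chj)) × Rj where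
  toFun x := (((x.2.1.1, (x.2.2.2, x.1)), x.2.1.2), x.2.2.1)
  invFun y := (y.1.1.2.2, ((y.1.1.1, y.1.2), (y.2, y.1.1.2.1)))
  left_inv _ := rfl
  right_inv _ := rfl

/-- `Z̃ × (R̂_j × L_j) ≃ (Z̃ × L_j) × R̂_j` — the arrangement for the leakage
mutual-information terms (tracing out `R̂_j`). -/
def eXi (Z Rhj Lj : Type) : Z × (Rhj × Lj) ≃ (Z × Lj) × Rhj where
  toFun x := ((x.1, x.2.2), x.2.1)
  invFun y := (y.1.1, (y.2, y.1.2))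
  left_inv _ := rfl
  right_inv _ := rfl

/-- Final arrangement `Acc n × (R n × E n) ≃ (((S_1^n × E_n) × (C̄_1^n × Ĉ_1^n)) × R n)`. -/
def eFinal (R E S Cb Ch : ℕ → Type) (n : ℕ) :
    (Acc S Cb Ch n × (R n × E n)) ≃
      ((((∀ i : Fin n, S i) × E n) × ((∀ i : Fin n, Cb i) × (∀ i : Fin n, Ch i))) × R n) where
  toFun x := (((x.1.1, x.2.2), x.1.2), x.2.1)
  invFun y := ((y.1.1.1, y.1.2), (y.2, y.1.1.2))
  left_inv _ := rfl
  right_inv _ := rfl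

section Functional

variable {m n o ι : Type*} [Fintype m] [DecidableEq m] [Fintype n] [DecidableEq n]
  [Fintype o] [DecidableEq o]

/-- Functional calculus `f(P)` of a Hermitian matrix for a complex-valued function of the
eigenvalues. -/
def fn (P : Matrix m m ℂ) (f : ℝ → ℂ) : Matrix m m ℂ :=
  if h : P.IsHermitian then
    (h.eigenvectorUnitary : Matrix m m ℂ) * diagonal (fun i => f (h.eigenvalues i)) *
      (h.eigenvectorUnitary : Matrix m m ℂ)ᴴ
  else 0

lemma fn_of_isHermitian {P : Matrix m m ℂ} (h : P.IsHermitian) (f : ℝ → ℂ) :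
    fn P f = (h.eigenvectorUnitary : Matrix m m ℂ) * diagonal (fun i => f (h.eigenvalues i)) *
      (h.eigenvectorUnitary : Matrix m m ℂ)ᴴ := by
  simp [fn, h]

lemma eigenvectorUnitary_conjTranspose_mul {P : Matrix m m ℂ} (h : P.IsHermitian) :
    (h.eigenvectorUnitary : Matrix m m ℂ)ᴴ * (h.eigenvectorUnitary : Matrix m m ℂ) = 1 :=
  Unitary.coe_star_mul_self h.eigenvectorUnitary

lemma eigenvectorUnitary_mul_conjTranspose {P : Matrix m m ℂ} (h : P.IsHermitian) :
    (h.eigenvectorUnitary : Matrix m m ℂ) * (h.eigenvectorUnitary : Matrix m m ℂ)ᴴ = 1 :=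
  Unitary.coe_mul_star_self h.eigenvectorUnitary

lemma eq_eigenvector_diagonal {P : Matrix m m ℂ} (h : P.IsHermitian) :
    P = (h.eigenvectorUnitary : Matrix m m ℂ) *
      diagonal (fun i => ((h.eigenvalues i : ℝ) : ℂ)) *
      (h.eigenvectorUnitary : Matrix m m ℂ)ᴴ := by
  conv_lhs => rw [h.spectral_theorem]
  rfl

lemma diagonal_intertwine {U : Matrix m o ℂ} {V : Matrix n ι ℂ} [Fintype ι] [DecidableEq ι]
    {X : Matrix m n ℂ} {a : o → ℝ} {b : ι → ℝ}
    (hU : Uᴴ * U = 1) (hU' : U * Uᴴ = 1) (hV : Vᴴ * V = 1) (hV' : V * Vᴴ = 1)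
    (h : (U * diagonal (fun i => (a i : ℂ)) * Uᴴ) * X =
      X * (V * diagonal (fun i => (b i : ℂ)) * Vᴴ)) (f : ℝ → ℂ) :
    (U * diagonal (fun i => f (a i)) * Uᴴ) * X =
      X * (V * diagonal (fun i => f (b i)) * Vᴴ) := by
  have h1 : diagonal (fun i => (a i : ℂ)) * (Uᴴ * X * V) =
      (Uᴴ * X * V) * diagonal (fun i => (b i : ℂ)) := by
    calc diagonal (fun i => (a i : ℂ)) * (Uᴴ * X * V)
        = (Uᴴ * U) * diagonal (fun i => (a i : ℂ)) * (Uᴴ * X * V) := by rw [hU, Matrix.one_mul]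
      _ = Uᴴ * ((U * diagonal (fun i => (a i : ℂ)) * Uᴴ) * X) * V := by
          simp only [Matrix.mul_assoc]
      _ = Uᴴ * (X * (V * diagonal (fun i => (b i : ℂ)) * Vᴴ)) * V := by rw [h]
      _ = (Uᴴ * X * V) * diagonal (fun i => (b i : ℂ)) * (Vᴴ * V) := by
          simp only [Matrix.mul_assoc]
      _ = _ := by rw [hV, Matrix.mul_one]
  have h2 : diagonal (fun i => f (a i)) * (Uᴴ * X * V) =
      (Uᴴ * X * V) * diagonal (fun i => f (b i)) := by
    ext i j
    have := congrFun (congrFun h1 i) j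
    rw [Matrix.diagonal_mul, Matrix.mul_diagonal] at this ⊢
    by_cases hab : a i = b j
    · rw [hab, mul_comm]
    · have hY : (Uᴴ * X * V) i j = 0 := by
        have h3 : ((a i : ℂ) - b j) * (Uᴴ * X * V) i j = 0 := by linear_combination this
        rcases mul_eq_zero.1 h3 with h4 | h4
        · exact absurd (by exact_mod_cast sub_eq_zero.1 h4) hab
        · exact h4
      rw [hY]; simp
  calc (U * diagonal (fun i => f (a i)) * Uᴴ) * X
      = U * (diagonal (fun i => f (a i)) * (Uᴴ * X * V)) * Vᴴ := by
        simp only [Matrix.mul_assoc]; rw [hV', Matrix.mul_one]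
    _ = (U * Uᴴ) * X * (V * diagonal (fun i => f (b i)) * Vᴴ) := by
        rw [h2]; simp only [Matrix.mul_assoc]
    _ = _ := by rw [hU', Matrix.one_mul]

lemma fn_intertwine {P : Matrix m m ℂ} {Q : Matrix n n ℂ} (hP : P.IsHermitian)
    (hQ : Q.IsHermitian) {X : Matrix m n ℂ} (h : P * X = X * Q) (f : ℝ → ℂ) :
    fn P f * X = X * fn Q f := by
  rw [fn_of_isHermitian hP, fn_of_isHermitian hQ]
  apply diagonal_intertwine (eigenvectorUnitary_conjTranspose_mul hP)
    (eigenvectorUnitary_mul_conjTranspose hP) (eigenvectorUnitary_conjTranspose_mul hQ)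
    (eigenvectorUnitary_mul_conjTranspose hQ)
  rw [← eq_eigenvector_diagonal hP, ← eq_eigenvector_diagonal hQ, h]

lemma fn_eq_of_diagonalization {P : Matrix m m ℂ} {U : Matrix m n ℂ} {a : n → ℝ}
    (hU : Uᴴ * U = 1) (hU' : U * Uᴴ = 1)
    (h : P = U * diagonal (fun i => (a i : ℂ)) * Uᴴ) (f : ℝ → ℂ) :
    fn P f = U * diagonal (fun i => f (a i)) * Uᴴ := by
  have hP : P.IsHermitian := by
    rw [h, Matrix.IsHermitian]
    simp only [conjTranspose_mul, conjTranspose_conjTranspose, diagonal_conjTranspose,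
      Matrix.mul_assoc]
    congr 3
    ext i; simp
  have := diagonal_intertwine (X := (1 : Matrix m m ℂ)) (a := hP.eigenvalues) (b := a)
    (eigenvectorUnitary_conjTranspose_mul hP) (eigenvectorUnitary_mul_conjTranspose hP) hU hU'
    (by rw [← eq_eigenvector_diagonal hP, ← h, Matrix.mul_one, Matrix.one_mul]) f
  rw [fn_of_isHermitian hP]
  simpa using this

lemma fn_mul (P : Matrix m m ℂ) (f g : ℝ → ℂ) : fn P f * fn P g = fn P (fun x => f x * g x) := by
  by_cases h : P.IsHermitian
  · simp only [fn_of_isHermitian h]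
    rw [← diagonal_mul_diagonal]
    calc _ = (h.eigenvectorUnitary : Matrix m m ℂ) * diagonal (fun i => f (h.eigenvalues i)) *
          ((h.eigenvectorUnitary : Matrix m m ℂ)ᴴ * (h.eigenvectorUnitary : Matrix m m ℂ)) *
          diagonal (fun i => g (h.eigenvalues i)) *
          (h.eigenvectorUnitary : Matrix m m ℂ)ᴴ := by simp only [Matrix.mul_assoc]
      _ = _ := by
        rw [eigenvectorUnitary_conjTranspose_mul, Matrix.mul_one]
        simp only [Matrix.mul_assoc]
  · simp [fn, h]

lemma fn_conjTranspose (P : Matrix m m ℂ) (f : ℝ → ℂ) :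
    (fn P f)ᴴ = fn P (fun x => star (f x)) := by
  by_cases h : P.IsHermitian
  · simp only [fn_of_isHermitian h, conjTranspose_mul, conjTranspose_conjTranspose,
      diagonal_conjTranspose, Matrix.mul_assoc]
    rfl
  · simp [fn, h]

lemma fn_posSemidef (P : Matrix m m ℂ) {f : ℝ → ℂ} (hf : ∀ x, 0 ≤ f x) :
    (fn P f).PosSemidef := by
  by_cases h : P.IsHermitian
  · rw [fn_of_isHermitian h]
    exact (PosSemidef.diagonal (fun i => hf _)).mul_mul_conjTranspose_same _
  · simp [fn, h, PosSemidef.zero]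

lemma fn_congr {P : Matrix m m ℂ} {f g : ℝ → ℂ}
    (h : ∀ hP : P.IsHermitian, ∀ i, f (hP.eigenvalues i) = g (hP.eigenvalues i)) :
    fn P f = fn P g := by
  by_cases hP : P.IsHermitian
  · rw [fn_of_isHermitian hP, fn_of_isHermitian hP]
    simp only [h hP]
  · simp [fn, hP]

lemma fn_id {P : Matrix m m ℂ} (hP : P.IsHermitian) : fn P (fun x => (x : ℂ)) = P := by
  rw [fn_of_isHermitian hP, ← eq_eigenvector_diagonal hP]

lemma fn_const {P : Matrix m m ℂ} (hP : P.IsHermitian) (c : ℂ) :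
    fn P (fun _ => c) = c • (1 : Matrix m m ℂ) := by
  rw [fn_of_isHermitian hP]
  have : diagonal (fun _ : m => c) = c • (1 : Matrix m m ℂ) := by
    ext i j; simp [Matrix.diagonal_apply, Matrix.one_apply]
  rw [this, Matrix.mul_smul, Matrix.mul_one, Matrix.smul_mul, eigenvectorUnitary_mul_conjTranspose]

lemma fn_fn {P : Matrix m m ℂ} (hP : P.IsHermitian) (g : ℝ → ℝ) (f : ℝ → ℂ) :
    fn (fn P (fun x => (g x : ℂ))) f = fn P (fun x => f (g x)) := by
  have h := fn_of_isHermitian hP (fun x => (g x : ℂ))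
  rw [fn_of_isHermitian hP (fun x => f (g x))]
  generalize fn P (fun x => (g x : ℂ)) = Q at h ⊢
  exact fn_eq_of_diagonalization (a := fun i => g (hP.eigenvalues i))
    (eigenvectorUnitary_conjTranspose_mul hP)
    (eigenvectorUnitary_mul_conjTranspose hP) h f

lemma fn_smul {P : Matrix m m ℂ} (hP : P.IsHermitian) (c : ℝ) (f : ℝ → ℂ) :
    fn ((c : ℂ) • P) f = fn P (fun x => f (c * x)) := by
  rw [fn_of_isHermitian hP (fun x => f (c * x))]
  refine fn_eq_of_diagonalization (a := fun i => c * hP.eigenvalues i)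
    (eigenvectorUnitary_conjTranspose_mul hP)
    (eigenvectorUnitary_mul_conjTranspose hP) ?_ f
  conv_lhs => rw [eq_eigenvector_diagonal hP]
  rw [← Matrix.smul_mul, ← Matrix.mul_smul]
  congr 2
  ext i j
  simp [Matrix.diagonal_apply]

lemma fn_trace {P : Matrix m m ℂ} (hP : P.IsHermitian) (f : ℝ → ℂ) :
    (fn P f).trace = ∑ i, f (hP.eigenvalues i) := by
  rw [fn_of_isHermitian hP, Matrix.trace_mul_comm, ← Matrix.mul_assoc,
    eigenvectorUnitary_conjTranspose_mul, Matrix.one_mul, Matrix.trace_diagonal]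

lemma fn_one_kronecker {P : Matrix m m ℂ} (hP : P.IsHermitian) (f : ℝ → ℂ) :
    fn ((1 : Matrix n n ℂ) ⊗ₖ P) f = (1 : Matrix n n ℂ) ⊗ₖ fn P f := by
  have key : ∀ d : m → ℂ, (1 : Matrix n n ℂ) ⊗ₖ ((hP.eigenvectorUnitary : Matrix m m ℂ) *
      diagonal d * (hP.eigenvectorUnitary : Matrix m m ℂ)ᴴ) =
      ((1 : Matrix n n ℂ) ⊗ₖ (hP.eigenvectorUnitary : Matrix m m ℂ)) *
        diagonal (fun x : n × m => d x.2) *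
        ((1 : Matrix n n ℂ) ⊗ₖ (hP.eigenvectorUnitary : Matrix m m ℂ))ᴴ := by
    intro d
    have : diagonal (fun x : n × m => d x.2) = (1 : Matrix n n ℂ) ⊗ₖ diagonal d := by
      rw [← Matrix.diagonal_one, diagonal_kronecker_diagonal]; simp
    rw [this, conjTranspose_kronecker, ← mul_kronecker_mul, ← mul_kronecker_mul]
    simp
  rw [fn_of_isHermitian hP, key]
  refine fn_eq_of_diagonalization (a := fun x : n × m => hP.eigenvalues x.2) ?_ ?_ ?_ f
  · rw [conjTranspose_kronecker, ← mul_kronecker_mul, eigenvectorUnitary_conjTranspose_mul]; simp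
  · rw [conjTranspose_kronecker, ← mul_kronecker_mul, eigenvectorUnitary_mul_conjTranspose]; simp
  · exact (congrArg _ (eq_eigenvector_diagonal hP)).trans (key _)

lemma fn_kronecker {P : Matrix m m ℂ} {Q : Matrix n n ℂ} (hP : P.IsHermitian)
    (hQ : Q.IsHermitian) {f : ℝ → ℂ}
    (hf : ∀ i j, f (hP.eigenvalues i * hQ.eigenvalues j) =
      f (hP.eigenvalues i) * f (hQ.eigenvalues j)) :
    fn (P ⊗ₖ Q) f = fn P f ⊗ₖ fn Q f := by
  have key : ∀ (d : m → ℂ) (e : n → ℂ), ((hP.eigenvectorUnitary : Matrix m m ℂ) *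
      diagonal d * (hP.eigenvectorUnitary : Matrix m m ℂ)ᴴ) ⊗ₖ
      ((hQ.eigenvectorUnitary : Matrix n n ℂ) *
      diagonal e * (hQ.eigenvectorUnitary : Matrix n n ℂ)ᴴ) =
      ((hP.eigenvectorUnitary : Matrix m m ℂ) ⊗ₖ (hQ.eigenvectorUnitary : Matrix n n ℂ)) *
        diagonal (fun x : m × n => d x.1 * e x.2) *
        ((hP.eigenvectorUnitary : Matrix m m ℂ) ⊗ₖ (hQ.eigenvectorUnitary : Matrix n n ℂ))ᴴ := by
    intro d e
    rw [← diagonal_kronecker_diagonal, conjTranspose_kronecker, ← mul_kronecker_mul,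
      ← mul_kronecker_mul]
  rw [fn_of_isHermitian hP, fn_of_isHermitian hQ, key]
  rw [fn_eq_of_diagonalization (a := fun x : m × n => hP.eigenvalues x.1 * hQ.eigenvalues x.2)
    (U := (hP.eigenvectorUnitary : Matrix m m ℂ) ⊗ₖ (hQ.eigenvectorUnitary : Matrix n n ℂ)) ?_ ?_
    ?_ f]
  · simp only [hf]
  · rw [conjTranspose_kronecker, ← mul_kronecker_mul, eigenvectorUnitary_conjTranspose_mul,
      eigenvectorUnitary_conjTranspose_mul]; simp
  · rw [conjTranspose_kronecker, ← mul_kronecker_mul, eigenvectorUnitary_mul_conjTranspose,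
      eigenvectorUnitary_mul_conjTranspose]; simp
  · conv_lhs => rw [eq_eigenvector_diagonal hP, eq_eigenvector_diagonal hQ, key]
    simp only [Complex.ofReal_mul]

end Functional

lemma trace_re_nonneg {m : Type*} [Fintype m] {P : Matrix m m ℂ} (hP : P.PosSemidef) :
    0 ≤ P.trace.re :=
  (Complex.le_def.1 hP.trace_nonneg).1

lemma trace_eq_re {m : Type*} [Fintype m] {P : Matrix m m ℂ} (hP : P.PosSemidef) :
    P.trace = ((P.trace.re : ℝ) : ℂ) := by
  apply Complex.ext
  · simp
  · simpa using (Complex.le_def.1 hP.trace_nonneg).2.symm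

lemma sum_rpow_le_rpow_sum {ι : Type*} (s : Finset ι) {a : ι → ℝ} (ha : ∀ i ∈ s, 0 ≤ a i)
    {p : ℝ} (hp : 1 ≤ p) : ∑ i ∈ s, a i ^ p ≤ (∑ i ∈ s, a i) ^ p := by
  have hS : 0 ≤ ∑ i ∈ s, a i := Finset.sum_nonneg ha
  have key : ∀ x : ℝ, 0 ≤ x → x ^ p = x * x ^ (p - 1) := by
    intro x hx
    rcases hx.eq_or_lt with h | h
    · rw [← h, Real.zero_rpow (by linarith), zero_mul]
    · rw [Real.rpow_sub_one h.ne']; field_simp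
  rw [key _ hS, Finset.sum_mul]
  refine Finset.sum_le_sum fun i hi => ?_
  rw [key _ (ha i hi)]
  exact mul_le_mul_of_nonneg_left (Real.rpow_le_rpow (ha i hi)
    (Finset.single_le_sum ha hi) (by linarith)) (ha i hi)

section Power

variable {m n o ι : Type*} [Fintype m] [DecidableEq m] [Fintype n] [DecidableEq n]
  [Fintype o] [DecidableEq o]

/-- Complex power of a nonnegative real, with the pseudo-inverse convention `0 ^ z = 0`. -/
def pe (x : ℝ) (z : ℂ) : ℂ := if x = 0 then 0 else Complex.exp (z * (Real.log x : ℂ))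

lemma pe_zero_left (z : ℂ) : pe 0 z = 0 := by simp [pe]

lemma pe_mul_pe (x : ℝ) (z w : ℂ) : pe x z * pe x w = pe x (z + w) := by
  by_cases h : x = 0
  · simp [pe, h]
  · simp only [pe, h, if_false]; rw [← Complex.exp_add]; ring_nf

lemma star_pe (x : ℝ) (z : ℂ) : star (pe x z) = pe x (star z) := by
  by_cases h : x = 0
  · simp [pe, h]
  · simp only [pe, h, if_false]
    rw [Complex.star_def, ← Complex.exp_conj, map_mul, Complex.conj_ofReal]

lemma pe_ofReal {x : ℝ} (hx : 0 ≤ x) {p : ℝ} (hp : p ≠ 0) : pe x (p : ℂ) = ((x ^ p : ℝ) : ℂ) := by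
  by_cases h : x = 0
  · simp [pe, h, Real.zero_rpow hp]
  · have hx' : 0 < x := lt_of_le_of_ne hx (Ne.symm h)
    simp only [pe, h, if_false]
    rw [Real.rpow_def_of_pos hx', mul_comm]; push_cast; rfl

lemma pe_ofReal_pos {x : ℝ} (hx : 0 < x) (p : ℝ) : pe x (p : ℂ) = ((x ^ p : ℝ) : ℂ) := by
  simp only [pe, hx.ne', if_false]
  rw [Real.rpow_def_of_pos hx, mul_comm]; push_cast; rfl

/-- The real-valued version of `pe` at real exponents. -/
def pr (x p : ℝ) : ℝ := if x = 0 then 0 else Real.exp (p * Real.log x)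

lemma pe_eq_pr (x p : ℝ) : pe x (p : ℂ) = ((pr x p : ℝ) : ℂ) := by
  by_cases h : x = 0
  · simp [pe, pr, h]
  · simp [pe, pr, h]

lemma pr_nonneg (x p : ℝ) : 0 ≤ pr x p := by
  unfold pr; split_ifs
  · exact le_rfl
  · exact (Real.exp_pos _).le

lemma pe_pr (x p : ℝ) (z : ℂ) : pe (pr x p) z = pe x (p * z) := by
  by_cases h : x = 0
  · simp [pr, pe, h]
  · simp only [pr, pe, h, if_false, (Real.exp_pos _).ne', Real.log_exp]
    push_cast; ring_nf

lemma pe_mul_left {x y : ℝ} (z : ℂ) : pe (x * y) z = pe x z * pe y z := by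
  by_cases hx : x = 0
  · simp [pe, hx]
  by_cases hy : y = 0
  · simp [pe, hy]
  · simp only [pe, hx, hy, if_false, mul_eq_zero, or_self, Real.log_mul hx hy]
    rw [← Complex.exp_add]; push_cast; ring_nf

/-- Complex power of a positive semidefinite matrix (pseudo-inverse convention). -/
def pw (P : Matrix m m ℂ) (z : ℂ) : Matrix m m ℂ := fn P (fun x => pe x z)

lemma pw_mul (P : Matrix m m ℂ) (z w : ℂ) : pw P z * pw P w = pw P (z + w) := by
  simp [pw, fn_mul, pe_mul_pe]

lemma pw_mul_assoc (P : Matrix m m ℂ) (z w : ℂ) (X : Matrix m ι ℂ) :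
    pw P z * (pw P w * X) = pw P (z + w) * X := by
  rw [← Matrix.mul_assoc, pw_mul]

lemma mul_pw_assoc (P : Matrix m m ℂ) (z w : ℂ) (X : Matrix ι m ℂ) :
    X * pw P z * pw P w = X * pw P (z + w) := by
  rw [Matrix.mul_assoc, pw_mul]

lemma pw_conjTranspose (P : Matrix m m ℂ) (z : ℂ) : (pw P z)ᴴ = pw P (star z) := by
  simp only [pw, fn_conjTranspose, star_pe]

lemma pw_conjTranspose_ofReal (P : Matrix m m ℂ) (p : ℝ) :
    (pw P (p : ℂ))ᴴ = pw P (p : ℂ) := by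
  rw [pw_conjTranspose]; congr 1; exact Complex.conj_ofReal p

lemma pw_isHermitian (P : Matrix m m ℂ) (p : ℝ) : (pw P (p : ℂ)).IsHermitian :=
  pw_conjTranspose_ofReal P p

lemma pw_posSemidef (P : Matrix m m ℂ) (p : ℝ) : (pw P (p : ℂ)).PosSemidef := by
  apply fn_posSemidef
  intro x
  rw [pe_eq_pr]
  exact_mod_cast pr_nonneg x p

lemma pw_one {P : Matrix m m ℂ} (hP : P.PosSemidef) : pw P 1 = P := by
  conv_rhs => rw [← fn_id hP.1]
  apply fn_congr
  intro h i
  have := pe_ofReal (hP.eigenvalues_nonneg i) (p := 1) one_ne_zero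
  simpa using this

lemma mul_pw_zero {P : Matrix m m ℂ} (hP : P.PosSemidef) : P * pw P 0 = P := by
  nth_rewrite 1 [← pw_one hP]
  rw [pw_mul, add_zero, pw_one hP]

lemma pw_pw {P : Matrix m m ℂ} (hP : P.IsHermitian) (p : ℝ) (z : ℂ) :
    pw (pw P (p : ℂ)) z = pw P (p * z) := by
  have : pw P (p : ℂ) = fn P (fun x => ((pr x p : ℝ) : ℂ)) := by simp only [pw, pe_eq_pr]
  rw [this, pw, fn_fn hP (fun x => pr x p)]
  simp only [pe_pr, pw]

lemma pw_smul {P : Matrix m m ℂ} (hP : P.IsHermitian) (c : ℝ) (z : ℂ) :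
    pw ((c : ℂ) • P) z = pe c z • pw P z := by
  by_cases h : P.IsHermitian
  · rw [pw, fn_smul hP]
    simp only [pe_mul_left]
    rw [← fn_mul, fn_const hP, Matrix.smul_mul, Matrix.one_mul]; rfl
  · exact absurd hP h

lemma pw_intertwine {P : Matrix m m ℂ} {Q : Matrix n n ℂ} (hP : P.IsHermitian)
    (hQ : Q.IsHermitian) {X : Matrix m n ℂ} (h : P * X = X * Q) (z : ℂ) :
    pw P z * X = X * pw Q z := fn_intertwine hP hQ h _

lemma pw_one_kronecker {P : Matrix m m ℂ} (hP : P.IsHermitian) (z : ℂ) :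
    pw ((1 : Matrix n n ℂ) ⊗ₖ P) z = (1 : Matrix n n ℂ) ⊗ₖ pw P z := fn_one_kronecker hP _

lemma pw_kronecker {P : Matrix m m ℂ} {Q : Matrix n n ℂ} (hP : P.IsHermitian)
    (hQ : Q.IsHermitian) (z : ℂ) : pw (P ⊗ₖ Q) z = pw P z ⊗ₖ pw Q z :=
  fn_kronecker hP hQ fun _ _ => pe_mul_left z

lemma pw_zero_of_posDef {P : Matrix m m ℂ} (hP : P.PosDef) : pw P 0 = 1 := by
  have h1 : (1 : Matrix m m ℂ) = (1 : ℂ) • (1 : Matrix m m ℂ) := by simp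
  rw [h1, ← fn_const hP.1]
  apply fn_congr
  intro h i
  simp [pe, (hP.eigenvalues_pos i).ne']

lemma pw_one_left (z : ℂ) : pw (1 : Matrix m m ℂ) z = 1 := by
  have := fn_eq_of_diagonalization (P := (1 : Matrix m m ℂ)) (U := (1 : Matrix m m ℂ))
    (a := fun _ => 1) (by simp) (by simp) (by simp) (fun x => pe x z)
  rw [pw, this]; simp [pe]

lemma mpow_eq_pw {P : Matrix m m ℂ} (hP : P.PosSemidef) {p : ℝ} (hp : p ≠ 0) :
    mpow P p = pw P (p : ℂ) := by
  unfold mpow pw fn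
  rw [dif_pos hP.1, dif_pos hP.1]
  simp only [pe_ofReal (hP.eigenvalues_nonneg _) hp]
  rfl

/-- A matrix that is a contraction together with its adjoint. -/
def Contr (C : Matrix m n ℂ) : Prop := (1 - Cᴴ * C).PosSemidef ∧ (1 - C * Cᴴ).PosSemidef

lemma Contr.one : Contr (1 : Matrix m m ℂ) := by
  simp [Contr, PosSemidef.zero]

lemma Contr.conjTranspose {C : Matrix m n ℂ} (h : Contr C) : Contr Cᴴ := by
  simpa [Contr] using h.symm

lemma Contr.mul {C : Matrix m n ℂ} {C' : Matrix n o ℂ} (h : Contr C) (h' : Contr C') :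
    Contr (C * C') := by
  constructor
  · have h1 := h.1.conjTranspose_mul_mul_same C'
    have h2 := h1.add h'.1
    convert h2 using 1
    simp only [conjTranspose_mul, Matrix.mul_sub, Matrix.sub_mul, Matrix.mul_one, Matrix.mul_assoc]
    abel
  · have h1 := h'.2.mul_mul_conjTranspose_same C
    have h2 := h1.add h.2
    convert h2 using 1
    simp only [conjTranspose_mul, Matrix.mul_sub, Matrix.sub_mul, Matrix.mul_one, Matrix.mul_assoc]
    abel

lemma one_sub_pw_zero_posSemidef {P : Matrix m m ℂ} (hP : P.IsHermitian) :
    (1 - pw P 0).PosSemidef := by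
  have h1 : (1 - pw P 0) = fn P (fun x => if x = 0 then 1 else 0) := by
    have h2 : fn P (fun x => if x = 0 then 1 else 0) + pw P 0 = 1 := by
      have h3 : (1 : Matrix m m ℂ) = (1 : ℂ) • (1 : Matrix m m ℂ) := by simp
      rw [h3, ← fn_const hP]
      simp only [pw, fn_of_isHermitian hP]
      rw [← Matrix.add_mul, ← Matrix.mul_add, diagonal_add]
      congr 3
      ext i
      by_cases h : hP.eigenvalues i = 0 <;> simp [pe, h]
    rw [← h2]; abel
  rw [h1]
  apply fn_posSemidef
  intro x; split_ifs <;> simp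

lemma contr_pw_imaginary {P : Matrix m m ℂ} (hP : P.IsHermitian) {z : ℂ} (hz : z.re = 0) :
    Contr (pw P z) := by
  have h : star z + z = 0 := by
    apply Complex.ext <;> simp [hz]
  constructor
  · rw [pw_conjTranspose, pw_mul, h]; exact one_sub_pw_zero_posSemidef hP
  · rw [pw_conjTranspose, pw_mul, add_comm, h]; exact one_sub_pw_zero_posSemidef hP

/-- The trace functional `Tr X ^ α`. -/
def trp (α : ℝ) (X : Matrix m m ℂ) : ℝ := (pw X (α : ℂ)).trace.re

lemma trp_nonneg (α : ℝ) (X : Matrix m m ℂ) : 0 ≤ trp α X :=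
  trace_re_nonneg (pw_posSemidef X α)

lemma mpow_trace_re {P : Matrix m m ℂ} (hP : P.PosSemidef) {p : ℝ} (hp : p ≠ 0) :
    (mpow P p).trace.re = trp p P := by rw [mpow_eq_pw hP hp]; rfl

lemma trp_eq_sum {P : Matrix m m ℂ} (hP : P.PosSemidef) {p : ℝ} (hp : p ≠ 0) :
    trp p P = ∑ i, hP.1.eigenvalues i ^ p := by
  unfold trp pw
  rw [fn_trace hP.1, Complex.re_sum]
  refine Finset.sum_congr rfl fun i _ => ?_
  rw [pe_ofReal (hP.eigenvalues_nonneg i) hp, Complex.ofReal_re]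

lemma trace_re_eq_sum {P : Matrix m m ℂ} (hP : P.PosSemidef) :
    P.trace.re = ∑ i, hP.1.eigenvalues i := by
  rw [hP.1.trace_eq_sum_eigenvalues]; simp

lemma trp_le_trace_rpow {P : Matrix m m ℂ} (hP : P.PosSemidef) {p : ℝ} (hp : 1 ≤ p) :
    trp p P ≤ P.trace.re ^ p := by
  rw [trp_eq_sum hP (by linarith), trace_re_eq_sum hP]
  exact sum_rpow_le_rpow_sum _ (fun i _ => hP.eigenvalues_nonneg i) hp

lemma trp_smul {P : Matrix m m ℂ} (hP : P.PosSemidef) {c : ℝ} (hc : 0 ≤ c) {p : ℝ} (hp : p ≠ 0) :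
    trp p ((c : ℂ) • P) = c ^ p * trp p P := by
  unfold trp
  rw [pw_smul hP.1, pe_ofReal hc hp, Matrix.trace_smul, smul_eq_mul, Complex.re_ofReal_mul]

lemma trp_mul_conjTranspose (B : Matrix m n ℂ) (p : ℝ) :
    trp p (B * Bᴴ) = trp p (Bᴴ * B) := by
  have h1 := posSemidef_self_mul_conjTranspose B
  have h2 := posSemidef_conjTranspose_mul_self B
  unfold trp
  congr 1
  have e : (p : ℂ) = 1 + ((p : ℂ) - 1) := by ring
  have e' : (p : ℂ) = ((p : ℂ) - 1) + 1 := by ring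
  rw [e, ← pw_mul, pw_one h1, ← pw_mul, pw_one h2]
  rw [Matrix.trace_mul_comm, ← Matrix.mul_assoc, pw_intertwine h1.1 h2.1 (Matrix.mul_assoc B Bᴴ B),
    Matrix.trace_mul_comm, ← Matrix.mul_assoc]

end Power

section HilbertSchmidt

variable {m n o ι κ : Type*} [Fintype m] [Fintype n] [Fintype o]

/-- Squared Hilbert–Schmidt norm. -/
def hs (X : Matrix m n ℂ) : ℝ := (Xᴴ * X).trace.re

lemma hs_eq_sum (X : Matrix m n ℂ) : hs X = ∑ i, ∑ j, ‖X i j‖ ^ 2 := by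
  unfold hs
  rw [Matrix.trace, Complex.re_sum, Finset.sum_comm]
  refine Finset.sum_congr rfl fun j _ => ?_
  rw [Matrix.diag_apply, Matrix.mul_apply, Complex.re_sum]
  refine Finset.sum_congr rfl fun i _ => ?_
  rw [conjTranspose_apply, Complex.star_def, ← Complex.normSq_eq_conj_mul_self,
    Complex.ofReal_re, Complex.normSq_eq_norm_sq]

lemma hs_nonneg (X : Matrix m n ℂ) : 0 ≤ hs X := by
  rw [hs_eq_sum]; positivity

lemma hs_conjTranspose (X : Matrix m n ℂ) : hs Xᴴ = hs X := by
  rw [hs_eq_sum, hs_eq_sum, Finset.sum_comm]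
  simp [conjTranspose_apply]

lemma hs_eq_trace (X : Matrix m n ℂ) : hs X = (X * Xᴴ).trace.re := by
  rw [← hs_conjTranspose, hs, conjTranspose_conjTranspose]

lemma trace_self_mul_eq_hs (X : Matrix m n ℂ) : (Xᴴ * X).trace = ((hs X : ℝ) : ℂ) :=
  trace_eq_re (posSemidef_conjTranspose_mul_self X)

lemma hs_smul (c : ℂ) (X : Matrix m n ℂ) : hs (c • X) = ‖c‖ ^ 2 * hs X := by
  simp only [hs_eq_sum, Finset.mul_sum, Matrix.smul_apply, smul_eq_mul, norm_mul, mul_pow]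

lemma hs_eq_zero {X : Matrix m n ℂ} (h : hs X = 0) : X = 0 := by
  rw [hs_eq_sum, Finset.sum_eq_zero_iff_of_nonneg (fun _ _ => by positivity)] at h
  ext i j
  have h1 := h i (Finset.mem_univ _)
  rw [Finset.sum_eq_zero_iff_of_nonneg (fun _ _ => by positivity)] at h1
  simpa using h1 j (Finset.mem_univ _)

lemma hs_mul_left_le [DecidableEq m] [DecidableEq o] {C : Matrix o m ℂ} (hC : Contr C)
    (X : Matrix m n ℂ) : hs (C * X) ≤ hs X := by
  have h := trace_re_nonneg (hC.1.conjTranspose_mul_mul_same X)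
  have e : Xᴴ * (1 - Cᴴ * C) * X = Xᴴ * X - (C * X)ᴴ * (C * X) := by
    simp only [conjTranspose_mul, Matrix.mul_sub, Matrix.sub_mul, Matrix.mul_one, Matrix.mul_assoc]
  rw [e, Matrix.trace_sub, Complex.sub_re] at h
  unfold hs; linarith

lemma hs_mul_right_le [DecidableEq n] [DecidableEq o] {C : Matrix n o ℂ} (hC : Contr C)
    (X : Matrix m n ℂ) : hs (X * C) ≤ hs X := by
  rw [← hs_conjTranspose, conjTranspose_mul, ← hs_conjTranspose X]
  exact hs_mul_left_le hC.conjTranspose _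

lemma sum_hs_mul_le (s : Finset κ) {T : Matrix m m ℂ} {X : κ → Matrix m n ℂ}
    (h : (T - ∑ k ∈ s, X k * (X k)ᴴ).PosSemidef) (A : Matrix o m ℂ) :
    ∑ k ∈ s, hs (A * X k) ≤ (A * T * Aᴴ).trace.re := by
  have h1 := trace_re_nonneg (h.mul_mul_conjTranspose_same A)
  have e : A * (T - ∑ k ∈ s, X k * (X k)ᴴ) * Aᴴ =
      A * T * Aᴴ - ∑ k ∈ s, (A * X k) * (A * X k)ᴴ := by
    simp only [conjTranspose_mul, Matrix.mul_sub, Matrix.sub_mul, Matrix.mul_assoc,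
      Matrix.mul_sum, Matrix.sum_mul]
  rw [e, Matrix.trace_sub, Complex.sub_re, Matrix.trace_sum, Complex.re_sum] at h1
  simp only [hs_eq_trace]
  linarith

lemma sum_hs_mul_eq (s : Finset κ) {T : Matrix m m ℂ} {X : κ → Matrix m n ℂ}
    (h : T = ∑ k ∈ s, X k * (X k)ᴴ) (A : Matrix o m ℂ) :
    ∑ k ∈ s, hs (A * X k) = (A * T * Aᴴ).trace.re := by
  simp only [hs_eq_trace, h, conjTranspose_mul, Matrix.mul_assoc,
      Matrix.mul_sum, Matrix.sum_mul, Matrix.trace_sum, Complex.re_sum]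

lemma trace_conjTranspose_mul_eq_sum (X Y : Matrix m n ℂ) :
    (Xᴴ * Y).trace = ∑ i, ∑ j, star (X i j) * Y i j := by
  rw [Matrix.trace, Finset.sum_comm]
  simp [Matrix.mul_apply, conjTranspose_apply]

/-- Cauchy–Schwarz for families of matrices. -/
lemma norm_sum_trace_le [Fintype κ] (X Y : κ → Matrix m n ℂ) :
    ‖∑ k, ((X k)ᴴ * Y k).trace‖ ≤ √(∑ k, hs (X k)) * √(∑ k, hs (Y k)) := by
  have h1 : ∀ Z : κ → Matrix m n ℂ, ∑ k, hs (Z k) =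
      ∑ x : κ × m × n, ‖Z x.1 x.2.1 x.2.2‖ ^ 2 := by
    intro Z
    simp only [hs_eq_sum, Fintype.sum_prod_type]
  have h2 : ∑ k, ((X k)ᴴ * Y k).trace =
      ∑ x : κ × m × n, star (X x.1 x.2.1 x.2.2) * Y x.1 x.2.1 x.2.2 := by
    simp only [trace_conjTranspose_mul_eq_sum, Fintype.sum_prod_type]
  rw [h1, h1, h2]
  refine (norm_sum_le _ _).trans ?_
  simp only [norm_mul, norm_star]
  exact Real.sum_mul_le_sqrt_mul_sqrt _ _ _

lemma sum_rpow_mul_rpow_le (s : Finset ι) {a b : ι → ℝ} (ha : ∀ i, 0 ≤ a i) (hb : ∀ i, 0 ≤ b i)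
    {q : ℝ} (hq0 : 0 < q) (hq1 : q < 1) :
    ∑ i ∈ s, a i ^ (1 - q) * b i ^ q ≤ (∑ i ∈ s, a i) ^ (1 - q) * (∑ i ∈ s, b i) ^ q := by
  have hpq : (1 / (1 - q)).HolderConjugate (1 / q) := by
    rw [Real.holderConjugate_iff]
    constructor
    · rw [lt_div_iff₀] <;> linarith
    · field_simp; ring
  have h := Real.inner_le_Lp_mul_Lq s (fun i => a i ^ (1 - q)) (fun i => b i ^ q) hpq
  have h1 : ∀ i, |a i ^ (1 - q)| ^ (1 / (1 - q)) = a i := by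
    intro i
    rw [abs_of_nonneg (Real.rpow_nonneg (ha i) _), ← Real.rpow_mul (ha i),
      mul_one_div_cancel (by linarith), Real.rpow_one]
  have h2 : ∀ i, |b i ^ q| ^ (1 / q) = b i := by
    intro i
    rw [abs_of_nonneg (Real.rpow_nonneg (hb i) _), ← Real.rpow_mul (hb i),
      mul_one_div_cancel (by linarith), Real.rpow_one]
  simpa only [h1, h2, one_div_one_div] using h

lemma contr_row_le [DecidableEq m] [DecidableEq n] {C : Matrix m n ℂ} (hC : Contr C) (i : m) :
    ∑ j, ‖C i j‖ ^ 2 ≤ 1 := by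
  have h := (Complex.le_def.1 (hC.2.diag_nonneg (i := i))).1
  rw [Matrix.sub_apply, Matrix.one_apply_eq, Matrix.mul_apply] at h
  simp only [conjTranspose_apply, Complex.star_def, Complex.mul_conj, Complex.sub_re,
    Complex.re_sum, Complex.ofReal_re, Complex.normSq_eq_norm_sq, Complex.zero_re,
    Complex.one_re] at h
  linarith

lemma contr_col_le [DecidableEq m] [DecidableEq n] {C : Matrix m n ℂ} (hC : Contr C) (j : n) :
    ∑ i, ‖C i j‖ ^ 2 ≤ 1 := by
  simpa [conjTranspose_apply] using contr_row_le hC.conjTranspose j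

lemma contr_unitary [DecidableEq m] {U : Matrix m m ℂ} (h : Uᴴ * U = 1) (h' : U * Uᴴ = 1) :
    Contr U := by
  simp [Contr, h, h', PosSemidef.zero]

/-- A Hölder inequality for products of powers with contractions in between. -/
lemma sum_hs_pw_contr_pw_le [Fintype κ] [DecidableEq m] [DecidableEq n] {Y : κ → Matrix m m ℂ}
    {ν : κ → Matrix n n ℂ} {C : κ → Matrix m n ℂ} (hY : ∀ k, (Y k).PosSemidef)
    (hν : ∀ k, (ν k).PosSemidef) (hC : ∀ k, Contr (C k)) {q : ℝ} (hq0 : 0 < q) (hq1 : q < 1) :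
    ∑ k, hs (pw (Y k) (((1 - q) / 2 : ℝ) : ℂ) * C k * pw (ν k) ((q / 2 : ℝ) : ℂ)) ≤
      (∑ k, (Y k).trace.re) ^ (1 - q) * (∑ k, (ν k).trace.re) ^ q := by
  set U : κ → Matrix m m ℂ := fun k => (hY k).1.eigenvectorUnitary with hU
  set V : κ → Matrix n n ℂ := fun k => (hν k).1.eigenvectorUnitary with hV
  set y : κ → m → ℝ := fun k => (hY k).1.eigenvalues with hy
  set v : κ → n → ℝ := fun k => (hν k).1.eigenvalues with hv
  have hy0 : ∀ k i, 0 ≤ y k i := fun k => (hY k).eigenvalues_nonneg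
  have hv0 : ∀ k i, 0 ≤ v k i := fun k => (hν k).eigenvalues_nonneg
  have hUU : ∀ k, (U k)ᴴ * U k = 1 := fun k => eigenvectorUnitary_conjTranspose_mul (hY k).1
  have hUU' : ∀ k, U k * (U k)ᴴ = 1 := fun k => eigenvectorUnitary_mul_conjTranspose (hY k).1
  have hVV : ∀ k, (V k)ᴴ * V k = 1 := fun k => eigenvectorUnitary_conjTranspose_mul (hν k).1
  have hVV' : ∀ k, V k * (V k)ᴴ = 1 := fun k => eigenvectorUnitary_mul_conjTranspose (hν k).1
  set Dk : κ → Matrix m n ℂ := fun k => (U k)ᴴ * C k * V k with hDk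
  have hD : ∀ k, Contr (Dk k) := fun k =>
    ((contr_unitary (hUU k) (hUU' k)).conjTranspose.mul (hC k)).mul
      (contr_unitary (hVV k) (hVV' k))
  have key : ∀ k, hs (pw (Y k) (((1 - q) / 2 : ℝ) : ℂ) * C k * pw (ν k) ((q / 2 : ℝ) : ℂ)) =
      ∑ i, ∑ j, (y k i * ‖Dk k i j‖ ^ 2) ^ (1 - q) * (v k j * ‖Dk k i j‖ ^ 2) ^ q := by
    intro k
    have e1 : pw (Y k) (((1 - q) / 2 : ℝ) : ℂ) * C k * pw (ν k) ((q / 2 : ℝ) : ℂ) =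
        U k * (diagonal (fun i => pe (y k i) (((1 - q) / 2 : ℝ) : ℂ)) * Dk k *
          diagonal (fun i => pe (v k i) ((q / 2 : ℝ) : ℂ))) * (V k)ᴴ := by
      rw [pw, pw, fn_of_isHermitian (hY k).1, fn_of_isHermitian (hν k).1]
      simp only [hDk, hU, hV, hy, hv, Matrix.mul_assoc]
    rw [e1]
    have e2 : ∀ Z : Matrix m n ℂ, hs (U k * Z * (V k)ᴴ) = hs Z := by
      intro Z
      rw [hs_eq_trace]
      simp only [conjTranspose_mul, conjTranspose_conjTranspose, Matrix.mul_assoc]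
      rw [Matrix.trace_mul_comm]
      simp only [Matrix.mul_assoc, hUU, Matrix.mul_one]
      rw [← Matrix.mul_assoc (V k)ᴴ, hVV, Matrix.one_mul, hs_eq_trace]
    rw [e2, hs_eq_sum]
    refine Finset.sum_congr rfl fun i _ => Finset.sum_congr rfl fun j _ => ?_
    rw [Matrix.mul_diagonal, Matrix.diagonal_mul, pe_ofReal (hy0 k i) (by linarith),
      pe_ofReal (hv0 k j) (by linarith), norm_mul, norm_mul, Complex.norm_real, Complex.norm_real,
      Real.norm_of_nonneg (Real.rpow_nonneg (hy0 k i) _),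
      Real.norm_of_nonneg (Real.rpow_nonneg (hv0 k j) _), mul_pow, mul_pow,
      Real.mul_rpow (hy0 k i) (by positivity), Real.mul_rpow (hv0 k j) (by positivity),
      ← Real.rpow_mul_natCast (hy0 k i), ← Real.rpow_mul_natCast (hv0 k j)]
    have e3 : (‖Dk k i j‖ ^ 2) ^ (1 - q) * (‖Dk k i j‖ ^ 2) ^ q = ‖Dk k i j‖ ^ 2 := by
      rcases (sq_nonneg ‖Dk k i j‖).eq_or_lt with h | h
      · rw [← h, Real.zero_rpow hq0.ne', mul_zero]
      · rw [← Real.rpow_add h]; simp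
    have e4 : (1 - q) / 2 * ((2 : ℕ) : ℝ) = 1 - q := by push_cast; ring
    have e5 : q / 2 * ((2 : ℕ) : ℝ) = q := by push_cast; ring
    rw [e4, e5]
    linear_combination (-(y k i ^ (1 - q) * v k j ^ q)) * e3
  have h := sum_rpow_mul_rpow_le (Finset.univ : Finset (κ × m × n))
    (a := fun x => y x.1 x.2.1 * ‖Dk x.1 x.2.1 x.2.2‖ ^ 2)
    (b := fun x => v x.1 x.2.2 * ‖Dk x.1 x.2.1 x.2.2‖ ^ 2)
    (fun x => mul_nonneg (hy0 _ _) (by positivity))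
    (fun x => mul_nonneg (hv0 _ _) (by positivity)) hq0 hq1
  simp only [Fintype.sum_prod_type] at h
  simp only [key]
  refine h.trans ?_
  have ha : ∑ k, ∑ i, ∑ j, y k i * ‖Dk k i j‖ ^ 2 ≤ ∑ k, (Y k).trace.re := by
    refine Finset.sum_le_sum fun k _ => ?_
    rw [trace_re_eq_sum (hY k)]
    refine Finset.sum_le_sum fun i _ => ?_
    rw [← Finset.mul_sum]
    exact mul_le_of_le_one_right (hy0 k i) (contr_row_le (hD k) i)
  have hb : ∑ k, ∑ i, ∑ j, v k j * ‖Dk k i j‖ ^ 2 ≤ ∑ k, (ν k).trace.re := by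
    refine Finset.sum_le_sum fun k _ => ?_
    rw [trace_re_eq_sum (hν k), Finset.sum_comm]
    refine Finset.sum_le_sum fun j _ => ?_
    rw [← Finset.mul_sum]
    exact mul_le_of_le_one_right (hv0 k j) (contr_col_le (hD k) j)
  have ha0 : 0 ≤ ∑ k, ∑ i, ∑ j, y k i * ‖Dk k i j‖ ^ 2 :=
    Finset.sum_nonneg fun k _ => Finset.sum_nonneg fun i _ => Finset.sum_nonneg fun j _ =>
      mul_nonneg (hy0 _ _) (by positivity)
  have hb0 : 0 ≤ ∑ k, ∑ i, ∑ j, v k j * ‖Dk k i j‖ ^ 2 :=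
    Finset.sum_nonneg fun k _ => Finset.sum_nonneg fun i _ => Finset.sum_nonneg fun j _ =>
      mul_nonneg (hv0 _ _) (by positivity)
  exact mul_le_mul (Real.rpow_le_rpow ha0 ha (by linarith)) (Real.rpow_le_rpow hb0 hb hq0.le)
    (Real.rpow_nonneg hb0 _) (Real.rpow_nonneg (ha0.trans ha) _)

end HilbertSchmidt

section Analytic

variable {m n o p : Type*} [Fintype m] [DecidableEq m] [Fintype n] [DecidableEq n]
  [Fintype o] [Fintype p]

/-- Entire functions bounded on the strip `0 ≤ Re z ≤ 1`. -/
def StripFun (φ : ℂ → ℂ) : Prop :=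
  Differentiable ℂ φ ∧ ∃ C, ∀ z : ℂ, 0 ≤ z.re → z.re ≤ 1 → ‖φ z‖ ≤ C

lemma StripFun.const (c : ℂ) : StripFun (fun _ => c) :=
  ⟨differentiable_const c, ‖c‖, fun _ _ _ => le_rfl⟩

lemma StripFun.mul {φ ψ : ℂ → ℂ} (hφ : StripFun φ) (hψ : StripFun ψ) :
    StripFun (fun z => φ z * ψ z) := by
  obtain ⟨h1, C1, hC1⟩ := hφ
  obtain ⟨h2, C2, hC2⟩ := hψ
  refine ⟨h1.mul h2, C1 * C2, fun z hz hz' => ?_⟩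
  rw [norm_mul]
  exact mul_le_mul (hC1 z hz hz') (hC2 z hz hz') (norm_nonneg _)
    ((norm_nonneg _).trans (hC1 z hz hz'))

lemma StripFun.sum {ι : Type*} (s : Finset ι) {φ : ι → ℂ → ℂ} (h : ∀ i, StripFun (φ i)) :
    StripFun (fun z => ∑ i ∈ s, φ i z) := by
  choose h1 C hC using h
  refine ⟨Differentiable.fun_sum fun i _ => h1 i, ∑ i ∈ s, C i, fun z hz hz' => ?_⟩
  exact (norm_sum_le _ _).trans (Finset.sum_le_sum fun i _ => hC i z hz hz')

lemma StripFun.pe (x a b : ℝ) : StripFun (fun z => pe x (a + b * z)) := by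
  by_cases hx : x = 0
  · simp only [hx, pe_zero_left]; exact StripFun.const 0
  · simp only [QITLeak.pe, hx, if_false]
    refine ⟨by fun_prop, Real.exp (|a * Real.log x| + |b * Real.log x|), fun z hz hz' => ?_⟩
    rw [Complex.norm_exp]
    apply Real.exp_le_exp.2
    have e : ((a + b * z) * (Real.log x : ℂ)).re = a * Real.log x + b * Real.log x * z.re := by
      simp; ring
    rw [e]
    have h1 := le_abs_self (a * Real.log x)
    have h2 : b * Real.log x * z.re ≤ |b * Real.log x| * 1 :=
      (mul_le_mul_of_nonneg_right (le_abs_self _) hz).trans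
        (mul_le_mul_of_nonneg_left hz' (abs_nonneg _))
    linarith

lemma StripFun.norm_le_interp {φ : ℂ → ℂ} (hφ : StripFun φ) {a b θ : ℝ} (h0 : 0 ≤ θ) (h1 : θ ≤ 1)
    (ha : ∀ z : ℂ, z.re = 0 → ‖φ z‖ ≤ a) (hb : ∀ z : ℂ, z.re = 1 → ‖φ z‖ ≤ b) :
    ‖φ θ‖ ≤ a ^ (1 - θ) * b ^ θ := by
  obtain ⟨hd, C, hC⟩ := hφ
  have := Complex.HadamardThreeLines.norm_le_interp_of_mem_verticalClosedStrip₀₁' φ (z := (θ : ℂ))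
    (a := a) (b := b) (by simp [Complex.HadamardThreeLines.verticalClosedStrip, h0, h1])
    hd.diffContOnCl ⟨C, by
      rintro _ ⟨z, hz, rfl⟩
      exact hC z hz.1 hz.2⟩ (fun z hz => ha z hz) (fun z hz => hb z hz)
  simpa using this

/-- Matrix-valued strip functions. -/
def StripMat (F : ℂ → Matrix m n ℂ) : Prop := ∀ i j, StripFun (fun z => F z i j)

omit [Fintype m] [DecidableEq m] [Fintype n] [DecidableEq n] in
lemma StripMat.const (X : Matrix m n ℂ) : StripMat (fun _ => X) := fun i j => StripFun.const (X i j)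

omit [Fintype m] [DecidableEq m] [DecidableEq n] [Fintype o] in
lemma StripMat.mul {F : ℂ → Matrix m n ℂ} {G : ℂ → Matrix n o ℂ} (hF : StripMat F)
    (hG : StripMat G) : StripMat (fun z => F z * G z) := by
  intro i j
  simp only [Matrix.mul_apply]
  exact StripFun.sum _ fun k => (hF i k).mul (hG k j)

omit [Fintype m] [DecidableEq m] [Fintype n] [DecidableEq n] in
lemma StripMat.smul {φ : ℂ → ℂ} {F : ℂ → Matrix m n ℂ} (hφ : StripFun φ) (hF : StripMat F) :
    StripMat (fun z => φ z • F z) := fun i j => hφ.mul (hF i j)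

omit [DecidableEq m] in
lemma StripMat.trace {F : ℂ → Matrix m m ℂ} (hF : StripMat F) :
    StripFun (fun z => (F z).trace) := StripFun.sum _ fun i => hF i i

omit [Fintype o] [Fintype p] in
lemma StripMat.map {F : ℂ → Matrix m n ℂ} (hF : StripMat F)
    (L : Matrix m n ℂ →ₗ[ℂ] Matrix o p ℂ) : StripMat (fun z => L (F z)) := by
  intro i j
  have e : ∀ z, L (F z) i j = ∑ k, ∑ l, F z k l * L (Matrix.single k l 1) i j := by
    intro z
    conv_lhs => rw [Matrix.matrix_eq_sum_single (F z)]
    simp only [map_sum, Matrix.sum_apply]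
    refine Finset.sum_congr rfl fun k _ => Finset.sum_congr rfl fun l _ => ?_
    have : Matrix.single k l (F z k l) = F z k l • Matrix.single k l (1 : ℂ) := by
      simp [Matrix.smul_single]
    rw [this, _root_.map_smul, Matrix.smul_apply, smul_eq_mul]
  simp only [e]
  exact StripFun.sum _ fun k => StripFun.sum _ fun l => (hF k l).mul (StripFun.const _)

lemma StripMat.pw (P : Matrix m m ℂ) (a b : ℝ) : StripMat (fun z => pw P (a + b * z)) := by
  by_cases hP : P.IsHermitian
  · simp only [QITLeak.pw, fn_of_isHermitian hP]
    refine ((StripMat.const _).mul ?_).mul (StripMat.const _)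
    intro i j
    by_cases h : i = j
    · subst h
      simp only [Matrix.diagonal_apply_eq]
      exact StripFun.pe _ a b
    · simp only [Matrix.diagonal_apply_ne _ h]
      exact StripFun.const 0
  · simp only [QITLeak.pw, fn, hP, dif_neg, not_false_iff]
    exact StripMat.const 0

lemma StripMat.pw_of_eq (P : Matrix m m ℂ) {e : ℂ → ℂ} (a b : ℝ) (he : ∀ z, e z = a + b * z) :
    StripMat (fun z => QITLeak.pw P (e z)) := by
  simp only [he]; exact StripMat.pw P a b

end Analytic

section Interpolation

variable {κ γ a b a' b' : Type*} [Fintype κ] [Fintype γ] [DecidableEq γ]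
  [Fintype a] [DecidableEq a] [Fintype b] [DecidableEq b]
  [Fintype a'] [DecidableEq a'] [Fintype b'] [DecidableEq b']

lemma norm_pe_pos {x : ℝ} (hx : 0 < x) (z : ℂ) : ‖pe x z‖ = x ^ z.re := by
  simp only [pe, hx.ne', if_false]
  rw [Complex.norm_exp, Real.rpow_def_of_pos hx]
  simp [mul_comm]

lemma pw_split (P : Matrix a a ℂ) {z u v : ℂ} (h : z = u + v) : pw P z = pw P u * pw P v := by
  rw [pw_mul, h]

lemma mul_mul_conjTranspose_eq {P : Matrix a a ℂ} (hP : P.PosSemidef) (Z : Matrix b a ℂ) :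
    Z * P * Zᴴ = (Z * pw P ((1 / 2 : ℝ) : ℂ)) * (Z * pw P ((1 / 2 : ℝ) : ℂ))ᴴ := by
  rw [conjTranspose_mul, pw_conjTranspose_ofReal]
  nth_rewrite 1 [← pw_one hP]
  rw [pw_split P (z := 1) (u := ((1 / 2 : ℝ) : ℂ)) (v := ((1 / 2 : ℝ) : ℂ))
    (by push_cast; norm_num)]
  simp only [Matrix.mul_assoc]

lemma conjTranspose_mul_mul_eq {P : Matrix a a ℂ} (hP : P.PosSemidef) (Z : Matrix a b ℂ) :
    Zᴴ * P * Z = (pw P ((1 / 2 : ℝ) : ℂ) * Z)ᴴ * (pw P ((1 / 2 : ℝ) : ℂ) * Z) := by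
  have := mul_mul_conjTranspose_eq hP Zᴴ
  rw [conjTranspose_conjTranspose] at this
  rw [this]
  simp only [conjTranspose_mul, conjTranspose_conjTranspose, pw_conjTranspose_ofReal]

/-- The interpolated matrices of `interpolation_bound`. -/
def interpFam (π : κ → γ) (Γ : κ → Matrix a b ℂ →ₗ[ℂ] Matrix a' b' ℂ) (t ω : Matrix a a ℂ)
    (m0 : Matrix a b ℂ) (T : γ → Matrix a' a' ℂ) (H : κ → Matrix b' b' ℂ) (w : κ → ℝ) (q : ℝ)
    (k : κ) (z : ℂ) : Matrix a' b' ℂ :=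
  pe (w k) (q * z / 2) • (pw (T (π k)) (-(1 - z) / 2) *
    Γ k (pw t ((1 - z) / 2) * pw ω (-(1 - z) / 2) * m0) * pw (H k) (q * z / 2))

omit [Fintype κ] [Fintype γ] [DecidableEq γ] in
lemma interpFam_stripMat (π : κ → γ) (Γ : κ → Matrix a b ℂ →ₗ[ℂ] Matrix a' b' ℂ)
    (t ω : Matrix a a ℂ) (m0 : Matrix a b ℂ) (T : γ → Matrix a' a' ℂ) (H : κ → Matrix b' b' ℂ)
    (w : κ → ℝ) (q : ℝ) (k : κ) : StripMat (interpFam π Γ t ω m0 T H w q k) := by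
  have e : ∀ z : ℂ, (q * z / 2 : ℂ) = ((0 : ℝ) : ℂ) + ((q / 2 : ℝ) : ℂ) * z := by
    intro z; push_cast; ring
  have e1 : ∀ z : ℂ, ((1 - z) / 2 : ℂ) = ((1 / 2 : ℝ) : ℂ) + ((-1 / 2 : ℝ) : ℂ) * z := by
    intro z; push_cast; ring
  have e2 : ∀ z : ℂ, (-(1 - z) / 2 : ℂ) = ((-1 / 2 : ℝ) : ℂ) + ((1 / 2 : ℝ) : ℂ) * z := by
    intro z; push_cast; ring
  unfold interpFam
  refine StripMat.smul ?_ (((StripMat.pw_of_eq _ _ _ e2).mul (StripMat.map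
    (((StripMat.pw_of_eq _ _ _ e1).mul (StripMat.pw_of_eq _ _ _ e2)).mul (StripMat.const _))
    (Γ k))).mul (StripMat.pw_of_eq _ _ _ e))
  simp only [e]; exact StripFun.pe _ _ _

/-- Edge bound at `Re z = 0` for the interpolated family. -/
lemma interp_left_edge (π : κ → γ) (Γ : κ → Matrix a b ℂ →ₗ[ℂ] Matrix a' b' ℂ)
    {t ω : Matrix a a ℂ} {m0 : Matrix a b ℂ} {T : γ → Matrix a' a' ℂ} {H : κ → Matrix b' b' ℂ}
    {w : κ → ℝ} {q : ℝ} (ht : t.PosSemidef) (hω : ω = m0 * m0ᴴ)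
    (hT : ∀ c, (T c).PosSemidef) (hH : ∀ k, (H k).PosSemidef) (hw : ∀ k, 0 < w k)
    (h0 : ∀ m : Matrix a b ℂ, (t - m * mᴴ).PosSemidef → ∀ c,
      (T c - ∑ k with π k = c, Γ k m * (Γ k m)ᴴ).PosSemidef)
    {Y : γ → Matrix a' a' ℂ} (hY : ∀ c, (Y c).PosSemidef) {z : ℂ} (hz : z.re = 0)
    {e : ℂ} (he : e.re = 1 / 2) :
    ∑ k, hs (pw (Y (π k)) e * interpFam π Γ t ω m0 T H w q k z) ≤ ∑ c, (Y c).trace.re := by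
  set m1 := pw t ((1 - z) / 2) * pw ω (-(1 - z) / 2) * m0 with hm1
  have hωp : ω.PosSemidef := hω ▸ posSemidef_self_mul_conjTranspose m0
  have hm : (t - m1 * m1ᴴ).PosSemidef := by
    have e1 : m1 * m1ᴴ = pw t ((1 - z) / 2) * pw ω 0 * (pw t ((1 - z) / 2))ᴴ := by
      rw [hm1]
      simp only [conjTranspose_mul]
      have : pw t ((1 - z) / 2) * pw ω (-(1 - z) / 2) * m0 *
          (m0ᴴ * ((pw ω (-(1 - z) / 2))ᴴ * (pw t ((1 - z) / 2))ᴴ)) =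
          pw t ((1 - z) / 2) * (pw ω (-(1 - z) / 2) * ω * (pw ω (-(1 - z) / 2))ᴴ) *
            (pw t ((1 - z) / 2))ᴴ := by
        rw [hω]; simp only [Matrix.mul_assoc]
      rw [this]
      congr 2
      nth_rewrite 2 [← pw_one hωp]
      rw [pw_conjTranspose, pw_mul, pw_mul]
      congr 1
      apply Complex.ext <;> simp [hz] <;> ring
    have e2 : t = pw t ((1 - z) / 2) * (pw t ((1 - z) / 2))ᴴ := by
      rw [pw_conjTranspose, pw_mul]
      nth_rewrite 1 [← pw_one ht]
      congr 1
      apply Complex.ext <;> simp [hz] <;> ring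
    have e3 : t - m1 * m1ᴴ =
        pw t ((1 - z) / 2) * (1 - pw ω 0) * (pw t ((1 - z) / 2))ᴴ := by
      rw [e1]
      nth_rewrite 1 [e2]
      simp only [Matrix.mul_sub, Matrix.sub_mul, Matrix.mul_one]
    rw [e3]
    exact (one_sub_pw_zero_posSemidef hωp.1).mul_mul_conjTranspose_same _
  have hk : ∀ k, hs (pw (Y (π k)) e * interpFam π Γ t ω m0 T H w q k z) ≤
      hs (pw (Y (π k)) e * pw (T (π k)) (-(1 - z) / 2) * Γ k m1) := by
    intro k
    unfold interpFam
    rw [Matrix.mul_smul, hs_smul, norm_pe_pos (hw k)]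
    have : (q * z / 2 : ℂ).re = 0 := by simp [hz]
    rw [this, Real.rpow_zero, one_pow, one_mul, ← Matrix.mul_assoc, ← Matrix.mul_assoc]
    exact hs_mul_right_le (contr_pw_imaginary (hH k).1 this) _
  refine (Finset.sum_le_sum fun k _ => hk k).trans ?_
  rw [← Finset.sum_fiberwise Finset.univ π]
  refine Finset.sum_le_sum fun c _ => ?_
  have h1 : ∑ k with π k = c, hs (pw (Y (π k)) e * pw (T (π k)) (-(1 - z) / 2) * Γ k m1) =
      ∑ k with π k = c, hs (pw (Y c) e * pw (T c) (-(1 - z) / 2) * Γ k m1) := by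
    refine Finset.sum_congr rfl fun k hk => ?_
    rw [(Finset.mem_filter.1 hk).2]
  rw [h1]
  refine (sum_hs_mul_le _ (h0 m1 hm c) _).trans ?_
  set Z := pw (Y c) e * pw (T c) (-(1 - z) / 2)
  have e4 := mul_mul_conjTranspose_eq (hT c) Z
  rw [e4, ← hs_eq_trace, Matrix.mul_assoc, pw_mul]
  refine (hs_mul_right_le (contr_pw_imaginary (hT c).1 ?_) _).trans ?_
  · simp [hz]; norm_num
  · rw [hs_eq_trace, pw_conjTranspose, pw_mul]
    have : e + star e = 1 := by apply Complex.ext <;> simp [he]; norm_num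
    rw [this, pw_one (hY c)]

/-- Edge bound at `Re z = 1` for the interpolated family. -/
lemma interp_right_edge (π : κ → γ) (Γ : κ → Matrix a b ℂ →ₗ[ℂ] Matrix a' b' ℂ)
    {t ω : Matrix a a ℂ} {m0 : Matrix a b ℂ} {T : γ → Matrix a' a' ℂ} {H : κ → Matrix b' b' ℂ}
    {w : κ → ℝ} {q bb Λ : ℝ} (hq0 : 0 < q) (hq1 : q < 1)
    (hT : ∀ c, (T c).PosSemidef) (hH : ∀ k, (H k).PosSemidef) (hw : ∀ k, 0 < w k)
    (h : κ → Matrix a' b' ℂ)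
    {Y : γ → Matrix a' a' ℂ} (hY : ∀ c, Y c = ∑ k with π k = c, h k * (h k)ᴴ) {z : ℂ}
    (hz : z.re = 1) {e : ℂ} (he : e.re = -(q / 2))
    {C ν : γ → Matrix a' a' ℂ} {G : κ → Matrix a' b' ℂ} (hC : ∀ c, Contr (C c))
    (hν : ∀ c, (ν c).PosSemidef) (hνb : ∑ c, (ν c).trace.re ≤ bb)
    (hΓ : ∀ k, Γ k (pw t ((1 - z) / 2) * pw ω (-(1 - z) / 2) * m0) =
      C (π k) * pw (ν (π k)) ((q / 2 : ℝ) : ℂ) * G k)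
    (hΛ : ∑ k, w k ^ q * hs (G k * pw (H k) ((q / 2 : ℝ) : ℂ)) ≤ Λ) :
    ‖∑ k, ((h k)ᴴ * (pw (Y (π k)) e * interpFam π Γ t ω m0 T H w q k z)).trace‖ ≤
      √((∑ k, hs (h k)) ^ (1 - q) * bb ^ q) * √Λ := by
  have hYp : ∀ c, (Y c).PosSemidef := by
    intro c; rw [hY]
    exact posSemidef_sum _ fun k _ => posSemidef_self_mul_conjTranspose _
  set Z : γ → Matrix a' a' ℂ := fun c => pw (Y c) e * pw (T c) (-(1 - z) / 2) * C c *
    pw (ν c) ((q / 2 : ℝ) : ℂ) with hZ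
  set X1 : κ → Matrix a' b' ℂ := fun k => (Z (π k))ᴴ * h k with hX1
  set X2 : κ → Matrix a' b' ℂ := fun k => pe (w k) (q * z / 2) • (G k * pw (H k) (q * z / 2))
    with hX2
  have e1 : ∑ k, ((h k)ᴴ * (pw (Y (π k)) e * interpFam π Γ t ω m0 T H w q k z)).trace =
      ∑ k, ((X1 k)ᴴ * X2 k).trace := by
    refine Finset.sum_congr rfl fun k _ => ?_
    unfold interpFam
    rw [hΓ]
    simp only [hX1, hX2, hZ, conjTranspose_mul, conjTranspose_conjTranspose, Matrix.mul_smul,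
      Matrix.mul_assoc]
  rw [e1]
  refine (norm_sum_trace_le X1 X2).trans ?_
  have hX1le : ∑ k, hs (X1 k) ≤ (∑ k, hs (h k)) ^ (1 - q) * bb ^ q := by
    have e2 : ∑ k, hs (X1 k) = ∑ c, hs (pw (Y c) (((1 - q) / 2 : ℝ) : ℂ) *
        (pw (Y c) (e + ((q / 2 : ℝ) : ℂ)) * pw (T c) (-(1 - z) / 2) * C c) *
          pw (ν c) ((q / 2 : ℝ) : ℂ)) := by
      rw [← Finset.sum_fiberwise Finset.univ π]
      refine Finset.sum_congr rfl fun c _ => ?_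
      have e3 : ∑ k with π k = c, hs (X1 k) = ∑ k with π k = c, hs ((Z c)ᴴ * h k) := by
        refine Finset.sum_congr rfl fun k hk => ?_
        simp only [hX1]
        rw [(Finset.mem_filter.1 hk).2]
      rw [e3, sum_hs_mul_eq _ (hY c), conjTranspose_conjTranspose]
      have e4 : pw (Y c) (((1 - q) / 2 : ℝ) : ℂ) *
        (pw (Y c) (e + ((q / 2 : ℝ) : ℂ)) * pw (T c) (-(1 - z) / 2) * C c) *
          pw (ν c) ((q / 2 : ℝ) : ℂ) = pw (Y c) ((1 / 2 : ℝ) : ℂ) * Z c := by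
        simp only [hZ, Matrix.mul_assoc]
        rw [pw_mul_assoc, pw_mul_assoc]
        congr 2; push_cast; ring
      rw [e4, hs, conjTranspose_mul_mul_eq (hYp c)]
    rw [e2]
    refine (sum_hs_pw_contr_pw_le hYp hν (fun c => ?_) hq0 hq1).trans ?_
    · refine (Contr.mul (contr_pw_imaginary (hYp c).1 ?_)
        (contr_pw_imaginary (hT c).1 ?_)).mul (hC c)
      · simp [he]
      · simp [hz]
    · have e5 : ∑ c, (Y c).trace.re = ∑ k, hs (h k) := by
        rw [← Finset.sum_fiberwise Finset.univ π]
        refine Finset.sum_congr rfl fun c _ => ?_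
        rw [hY, Matrix.trace_sum, Complex.re_sum]
        simp only [hs_eq_trace]
      rw [e5]
      exact mul_le_mul_of_nonneg_left (Real.rpow_le_rpow
        (Finset.sum_nonneg fun c _ => trace_re_nonneg (hν c)) hνb hq0.le)
        (Real.rpow_nonneg (Finset.sum_nonneg fun k _ => hs_nonneg _) _)
  have hX2le : ∑ k, hs (X2 k) ≤ Λ := by
    refine le_trans (Finset.sum_le_sum fun k _ => ?_) hΛ
    simp only [hX2]
    rw [hs_smul, norm_pe_pos (hw k)]
    have e6 : (q * z / 2 : ℂ) = ((q / 2 : ℝ) : ℂ) + q * (z - 1) / 2 := by push_cast; ring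
    have e7 : (q * z / 2 : ℂ).re = q / 2 := by simp [hz]
    rw [e7, ← Real.rpow_mul_natCast (hw k).le, e6, ← pw_mul, ← Matrix.mul_assoc]
    have e8 : q / 2 * ((2 : ℕ) : ℝ) = q := by push_cast; ring
    rw [e8]
    refine mul_le_mul_of_nonneg_left (hs_mul_right_le (contr_pw_imaginary (hH k).1 ?_) _)
      (Real.rpow_nonneg (hw k).le _)
    simp [hz]
  exact mul_le_mul (Real.sqrt_le_sqrt hX1le) (Real.sqrt_le_sqrt hX2le) (Real.sqrt_nonneg _)
    (Real.sqrt_nonneg _)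

lemma le_of_le_interp {N B θ q : ℝ} (hN : 0 ≤ N) (hB : 0 ≤ B) (hq : 0 < q) (hθ : θ * (1 + q) = 1)
    (h : N ≤ N ^ (1 - θ) * √(N ^ (1 - q) * B) ^ θ) : N ≤ B ^ θ := by
  rcases hN.eq_or_lt with h0 | h0
  · rw [← h0]; positivity
  have h1 : √(N ^ (1 - q) * B) ^ θ = N ^ ((1 - q) * (θ / 2)) * B ^ (θ / 2) := by
    rw [Real.sqrt_eq_rpow, ← Real.rpow_mul (by positivity), Real.mul_rpow (by positivity) hB,
      ← Real.rpow_mul hN]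
    congr 2 <;> ring
  rw [h1, ← mul_assoc, ← Real.rpow_add h0] at h
  have e : 1 - θ + (1 - q) * (θ / 2) = 1 / 2 := by nlinarith
  rw [e] at h
  have h2 : N ^ (1 / 2 : ℝ) ≤ B ^ (θ / 2) := by
    have h3 : N = N ^ (1 / 2 : ℝ) * N ^ (1 / 2 : ℝ) := by
      rw [← Real.rpow_add h0]; norm_num
    have h4 : 0 < N ^ (1 / 2 : ℝ) := by positivity
    nth_rewrite 1 [h3] at h
    exact le_of_mul_le_mul_left h h4
  have h5 := Real.rpow_le_rpow (by positivity) h2 (show (0 : ℝ) ≤ 2 by norm_num)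
  rw [← Real.rpow_mul hN, ← Real.rpow_mul hB] at h5
  simpa using h5

/-- The core interpolation estimate. -/
theorem interpolation_bound (π : κ → γ) (Γ : κ → Matrix a b ℂ →ₗ[ℂ] Matrix a' b' ℂ)
    {t ω : Matrix a a ℂ} {m0 : Matrix a b ℂ} {T : γ → Matrix a' a' ℂ} {H : κ → Matrix b' b' ℂ}
    {w : κ → ℝ} {q bb Λ θ : ℝ} (hq0 : 0 < q) (hq1 : q < 1) (hθ : θ * (1 + q) = 1)
    (ht : t.PosSemidef) (hω : ω = m0 * m0ᴴ)
    (hT : ∀ c, (T c).PosSemidef) (hH : ∀ k, (H k).PosSemidef) (hw : ∀ k, 0 < w k)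
    (h0 : ∀ m : Matrix a b ℂ, (t - m * mᴴ).PosSemidef → ∀ c,
      (T c - ∑ k with π k = c, Γ k m * (Γ k m)ᴴ).PosSemidef)
    (h1 : ∀ z : ℂ, z.re = 1 → ∃ (C ν : γ → Matrix a' a' ℂ) (G : κ → Matrix a' b' ℂ),
      (∀ c, Contr (C c)) ∧ (∀ c, (ν c).PosSemidef) ∧ ∑ c, (ν c).trace.re ≤ bb ∧
      (∀ k, Γ k (pw t ((1 - z) / 2) * pw ω (-(1 - z) / 2) * m0) =
        C (π k) * pw (ν (π k)) ((q / 2 : ℝ) : ℂ) * G k) ∧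
      ∑ k, w k ^ q * hs (G k * pw (H k) ((q / 2 : ℝ) : ℂ)) ≤ Λ) :
    ∑ k, w k ^ (q * θ) * hs (pw (T (π k)) ((-(1 - θ) / 2 : ℝ) : ℂ) *
      Γ k (pw t (((1 - θ) / 2 : ℝ) : ℂ) * pw ω ((-(1 - θ) / 2 : ℝ) : ℂ) * m0) *
        pw (H k) ((q * θ / 2 : ℝ) : ℂ)) ≤ (bb ^ q * Λ) ^ θ := by
  have hθ0 : 0 < θ := by by_contra h'; nlinarith
  have hθ1 : θ ≤ 1 := by nlinarith
  set h : κ → Matrix a' b' ℂ := fun k => interpFam π Γ t ω m0 T H w q k θ with hh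
  have hNeq : ∑ k, w k ^ (q * θ) * hs (pw (T (π k)) ((-(1 - θ) / 2 : ℝ) : ℂ) *
      Γ k (pw t (((1 - θ) / 2 : ℝ) : ℂ) * pw ω ((-(1 - θ) / 2 : ℝ) : ℂ) * m0) *
        pw (H k) ((q * θ / 2 : ℝ) : ℂ)) = ∑ k, hs (h k) := by
    refine Finset.sum_congr rfl fun k _ => ?_
    simp only [hh, interpFam]
    rw [hs_smul, norm_pe_pos (hw k), ← Real.rpow_mul_natCast (hw k).le]
    have e1 : (q * θ / 2 : ℂ).re * ((2 : ℕ) : ℝ) = q * θ := by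
      rw [← Complex.ofReal_mul, ← Complex.ofReal_ofNat, ← Complex.ofReal_div, Complex.ofReal_re]
      push_cast; ring
    rw [e1]
    push_cast; rfl
  rw [hNeq]
  set N := ∑ k, hs (h k) with hN
  have hN0 : 0 ≤ N := Finset.sum_nonneg fun k _ => hs_nonneg _
  obtain ⟨C1, ν1, G1, -, hν1, hνb1, -, hΛ1⟩ := h1 1 (by simp)
  have hbb : 0 ≤ bb := (Finset.sum_nonneg fun c _ => trace_re_nonneg (hν1 c)).trans hνb1
  have hΛ0 : 0 ≤ Λ := le_trans (Finset.sum_nonneg fun k _ =>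
    mul_nonneg (Real.rpow_nonneg (hw k).le _) (hs_nonneg _)) hΛ1
  set Y : γ → Matrix a' a' ℂ := fun c => ∑ k with π k = c, h k * (h k)ᴴ with hY
  have hYp : ∀ c, (Y c).PosSemidef := fun c =>
    posSemidef_sum _ fun k _ => posSemidef_self_mul_conjTranspose _
  have hYN : ∑ c, (Y c).trace.re = N := by
    rw [hN, ← Finset.sum_fiberwise Finset.univ π]
    refine Finset.sum_congr rfl fun c _ => ?_
    simp only [hY]
    rw [Matrix.trace_sum, Complex.re_sum]
    simp only [hs_eq_trace]
  set φ : ℂ → ℂ := fun z => ∑ k, ((h k)ᴴ * (pw (Y (π k)) ((1 - z) / 2 - q * z / 2) *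
    interpFam π Γ t ω m0 T H w q k z)).trace with hφ
  have hφs : StripFun φ := by
    refine StripFun.sum _ fun k => StripMat.trace ((StripMat.const _).mul
      (StripMat.mul (StripMat.pw_of_eq _ (1 / 2) (-1 / 2 - q / 2) fun z => ?_)
        (interpFam_stripMat π Γ t ω m0 T H w q k)))
    push_cast; ring
  have hφθ : φ θ = (N : ℂ) := by
    have e1 : ((1 - θ) / 2 - q * θ / 2 : ℂ) = 0 := by
      have : (θ * (1 + q) : ℂ) = 1 := by exact_mod_cast hθ
      linear_combination (-1 / 2) * this
    simp only [hφ, e1]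
    have e2 : ∑ k, ((h k)ᴴ * (pw (Y (π k)) 0 * h k)).trace = ∑ c, (Y c).trace := by
      rw [← Finset.sum_fiberwise Finset.univ π]
      refine Finset.sum_congr rfl fun c _ => ?_
      rw [← mul_pw_zero (hYp c), Matrix.trace_mul_comm]
      simp only [hY, Matrix.mul_sum, Matrix.trace_sum]
      refine Finset.sum_congr rfl fun k hk => ?_
      rw [(Finset.mem_filter.1 hk).2, Matrix.trace_mul_comm, Matrix.mul_assoc]
    rw [← hYN, Complex.ofReal_sum]
    refine e2.trans (Finset.sum_congr rfl fun c _ => trace_eq_re (hYp c))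
  have hleft : ∀ z : ℂ, z.re = 0 → ‖φ z‖ ≤ N := by
    intro z hz
    refine (norm_sum_trace_le h _).trans ?_
    have e1 := interp_left_edge (q := q) π Γ ht hω hT hH hw h0 hYp hz
      (e := (1 - z) / 2 - q * z / 2) (by simp [hz])
    rw [hYN] at e1
    calc _ ≤ √N * √N := mul_le_mul_of_nonneg_left (Real.sqrt_le_sqrt e1) (Real.sqrt_nonneg _)
      _ = N := Real.mul_self_sqrt hN0
  have hright : ∀ z : ℂ, z.re = 1 → ‖φ z‖ ≤ √(N ^ (1 - q) * (bb ^ q * Λ)) := by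
    intro z hz
    obtain ⟨C, ν, G, hC, hν, hνb, hΓ, hΛ⟩ := h1 z hz
    refine (interp_right_edge π Γ hq0 hq1 hT hH hw h (fun c => rfl) hz (by simp [hz]) hC hν hνb hΓ
      hΛ).trans (le_of_eq ?_)
    rw [← mul_assoc, Real.sqrt_mul (x := N ^ (1 - q) * bb ^ q) (by positivity)]
  have := hφs.norm_le_interp hθ0.le hθ1 hleft hright
  rw [hφθ, Complex.norm_real, Real.norm_of_nonneg hN0] at this
  exact le_of_le_interp hN0 (by positivity) hq0 hθ this

end Interpolation

section DataProcessing

variable {κ γ x x' : Type*} [Fintype κ] [Fintype γ] [DecidableEq γ]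
  [Fintype x] [DecidableEq x] [Fintype x'] [DecidableEq x']

lemma hs_pw_of_re {P : Matrix x x ℂ} (hP : P.PosSemidef) {e : ℂ} (he : e.re = 1 / 2) :
    hs (pw P e) = P.trace.re := by
  rw [hs_eq_trace, pw_conjTranspose, pw_mul]
  have : e + star e = 1 := by apply Complex.ext <;> simp [he]; norm_num
  rw [this, pw_one hP]

lemma norm_sum_trace_mul_le {a b : Type*} [Fintype a] [Fintype b] (X : κ → Matrix a b ℂ)
    (Y : κ → Matrix b a ℂ) {u v : ℝ} (hX : ∑ k, hs (X k) ≤ u) (hY : ∑ k, hs (Y k) ≤ v) :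
    ‖∑ k, (X k * Y k).trace‖ ≤ √u * √v := by
  have := norm_sum_trace_le (fun k => (X k)ᴴ) Y
  simp only [conjTranspose_conjTranspose, hs_conjTranspose] at this
  exact this.trans (mul_le_mul (Real.sqrt_le_sqrt hX) (Real.sqrt_le_sqrt hY) (Real.sqrt_nonneg _)
    (Real.sqrt_nonneg _))

lemma sum_fiber_mul (π : κ → γ) (Y : γ → Matrix x' x' ℂ) (W : κ → Matrix x' x' ℂ) :
    ∑ k, (Y (π k) * W k).trace = ∑ c, (Y c * ∑ k with π k = c, W k).trace := by
  rw [← Finset.sum_fiberwise Finset.univ π]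
  refine Finset.sum_congr rfl fun c _ => ?_
  rw [Matrix.mul_sum, Matrix.trace_sum]
  refine Finset.sum_congr rfl fun k hk => ?_
  rw [(Finset.mem_filter.1 hk).2]

/-- A data-processing inequality for the sandwiched quantity of order `α > 1`, for a completely
positive trace-nonincreasing map given by Kraus operators sorted into classical outcomes. -/
theorem sum_trp_data_processing (π : κ → γ) {K : κ → Matrix x' x ℂ} {σ X : Matrix x x ℂ}
    {σ' : γ → Matrix x' x' ℂ} {α p : ℝ} (hα : 1 < α) (hp : p = (α - 1) / α)
    (hK : (1 - ∑ k, (K k)ᴴ * K k).PosSemidef) (hσ : σ.PosSemidef)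
    (hσ' : ∀ c, (σ' c).PosSemidef)
    (hle : ∀ c, (σ' c - ∑ k with π k = c, K k * σ * (K k)ᴴ).PosSemidef) (hX : X.PosSemidef) :
    ∑ c, trp α (∑ k with π k = c, pw (σ' c) ((-p / 2 : ℝ) : ℂ) * K k * pw σ ((p / 2 : ℝ) : ℂ) * X *
      pw σ ((p / 2 : ℝ) : ℂ) * (K k)ᴴ * pw (σ' c) ((-p / 2 : ℝ) : ℂ)) ≤ trp α X := by
  have hα0 : 0 < α := by linarith
  have hp0 : 0 < p := by rw [hp]; exact div_pos (by linarith) hα0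
  have hp1 : p < 1 := by rw [hp, div_lt_one hα0]; linarith
  have hαp : α * (1 - p) = 1 := by rw [hp]; field_simp; ring
  have hαp' : (α * p : ℝ) = α - 1 := by linarith
  set ω := pw X (α : ℂ) with hω
  have hωp : ω.PosSemidef := pw_posSemidef _ _
  have hXω : pw ω ((1 - p : ℝ) : ℂ) = X := by
    rw [hω, pw_pw hX.1, ← Complex.ofReal_mul, hαp, Complex.ofReal_one, pw_one hX]
  set W : κ → Matrix x' x' ℂ := fun k => pw (σ' (π k)) ((-p / 2 : ℝ) : ℂ) * K k *
    pw σ ((p / 2 : ℝ) : ℂ) * X * pw σ ((p / 2 : ℝ) : ℂ) * (K k)ᴴ *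
      pw (σ' (π k)) ((-p / 2 : ℝ) : ℂ) with hW
  set Z : γ → Matrix x' x' ℂ := fun c => ∑ k with π k = c, W k
  have hZeq : ∀ c, (∑ k with π k = c, pw (σ' c) ((-p / 2 : ℝ) : ℂ) * K k * pw σ ((p / 2 : ℝ) : ℂ) *
      X * pw σ ((p / 2 : ℝ) : ℂ) * (K k)ᴴ * pw (σ' c) ((-p / 2 : ℝ) : ℂ)) = Z c := by
    intro c
    refine Finset.sum_congr rfl fun k hk => ?_
    simp only [hW, (Finset.mem_filter.1 hk).2]
  simp only [hZeq]
  have hZp : ∀ c, (Z c).PosSemidef := by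
    intro c
    refine posSemidef_sum _ fun k _ => ?_
    have := hX.mul_mul_conjTranspose_same (pw (σ' (π k)) ((-p / 2 : ℝ) : ℂ) * K k *
      pw σ ((p / 2 : ℝ) : ℂ))
    simpa only [hW, conjTranspose_mul, pw_conjTranspose_ofReal, Matrix.mul_assoc] using this
  set Y : γ → Matrix x' x' ℂ := fun c => pw (Z c) (α : ℂ) with hY
  have hYp : ∀ c, (Y c).PosSemidef := fun c => pw_posSemidef _ _
  set N := ∑ c, trp α (Z c) with hN
  have hNY : N = ∑ c, (Y c).trace.re := rfl
  have hN0 : 0 ≤ N := Finset.sum_nonneg fun c _ => trp_nonneg _ _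
  set φ : ℂ → ℂ := fun z => ∑ k, (pw (Y (π k)) z * (pw (σ' (π k)) (-z / 2) * K k *
    pw σ (z / 2) * pw ω (1 - z) * pw σ (z / 2) * (K k)ᴴ * pw (σ' (π k)) (-z / 2))).trace
  have hφs : StripFun φ := by
    have eh : ∀ z : ℂ, z / 2 = ((0 : ℝ) : ℂ) + ((1 / 2 : ℝ) : ℂ) * z := by
      intro z; push_cast; ring
    have eh' : ∀ z : ℂ, -z / 2 = ((0 : ℝ) : ℂ) + ((-1 / 2 : ℝ) : ℂ) * z := by
      intro z; push_cast; ring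
    have e0 : ∀ z : ℂ, z = ((0 : ℝ) : ℂ) + ((1 : ℝ) : ℂ) * z := by
      intro z; push_cast; ring
    have e1 : ∀ z : ℂ, 1 - z = ((1 : ℝ) : ℂ) + ((-1 : ℝ) : ℂ) * z := by
      intro z; push_cast; ring
    exact StripFun.sum _ fun k => StripMat.trace ((StripMat.pw_of_eq _ _ _ e0).mul
      (((((((StripMat.pw_of_eq _ _ _ eh').mul (StripMat.const _)).mul
      (StripMat.pw_of_eq _ _ _ eh)).mul (StripMat.pw_of_eq _ _ _ e1)).mul
      (StripMat.pw_of_eq _ _ _ eh)).mul (StripMat.const _)).mul (StripMat.pw_of_eq _ _ _ eh')))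
  have hφp : φ p = (N : ℂ) := by
    have e1 : φ p = ∑ k, (pw (Y (π k)) p * W k).trace := by
      refine Finset.sum_congr rfl fun k _ => ?_
      rw [hW]
      have e2 : ((1 - p : ℝ) : ℂ) = 1 - (p : ℂ) := by push_cast; ring
      have e3 : ((-p / 2 : ℝ) : ℂ) = -(p : ℂ) / 2 := by push_cast; ring
      have e4 : ((p / 2 : ℝ) : ℂ) = (p : ℂ) / 2 := by push_cast; ring
      rw [e2] at hXω
      simp only [e3, e4, hXω]
    rw [e1, sum_fiber_mul π (fun c => pw (Y c) p), hN, Complex.ofReal_sum]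
    refine Finset.sum_congr rfl fun c _ => ?_
    change (pw (Y c) p * Z c).trace = _
    have e5 : pw (Y c) p * Z c = pw (Z c) α := by
      have e6 : pw (Z c) (α * p) * pw (Z c) 1 = pw (Z c) α := by
        rw [pw_mul]
        congr 1
        rw [← Complex.ofReal_mul, hαp']; push_cast; ring
      rw [pw_one (hZp c)] at e6
      rw [hY, pw_pw (hZp c).1, e6]
    rw [e5]
    exact trace_eq_re (hYp c)
  have hleft0 : ∀ (C₁ : κ → Matrix x' x' ℂ) (C₂ : Matrix x x ℂ) (e : ℂ), (∀ k, Contr (C₁ k)) →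
      Contr C₂ → e.re = 1 / 2 → ∑ k, hs (C₁ k * K k * C₂ * pw ω e) ≤ trp α X := by
    intro C₁ C₂ e hC₁ hC₂ he
    have e1 : ∀ k, hs (C₁ k * K k * C₂ * pw ω e) ≤ hs ((C₂ * pw ω e)ᴴ * (K k)ᴴ) := by
      intro k
      rw [← conjTranspose_mul, hs_conjTranspose]
      simp only [Matrix.mul_assoc]
      exact hs_mul_left_le (hC₁ k) _
    refine (Finset.sum_le_sum fun k _ => e1 k).trans ?_
    refine (sum_hs_mul_le Finset.univ (T := 1) (by simpa using hK) _).trans ?_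
    rw [Matrix.mul_one, ← hs_eq_trace, hs_conjTranspose]
    refine (hs_mul_left_le hC₂ _).trans ?_
    rw [hs_pw_of_re hωp he]
    exact le_rfl
  have hleft : ∀ z : ℂ, z.re = 0 → ‖φ z‖ ≤ trp α X := by
    intro z hz
    have e1 : φ z = ∑ k, ((pw (Y (π k)) z * pw (σ' (π k)) (-z / 2) * K k *
        pw σ (z / 2) * pw ω ((1 - z) / 2)) * (pw (σ' (π k)) (star (-z / 2)) * K k *
          pw σ (star (z / 2)) * pw ω (star ((1 - z) / 2)))ᴴ).trace := by
      refine Finset.sum_congr rfl fun k _ => ?_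
      simp only [conjTranspose_mul, pw_conjTranspose, star_star]
      rw [pw_split ω (z := 1 - z) (u := (1 - z) / 2) (v := (1 - z) / 2) (by ring)]
      simp only [Matrix.mul_assoc]
    rw [e1]
    refine (norm_sum_trace_mul_le _ _ (hleft0 _ _ _ (fun k => ?_) ?_ ?_)
      (v := trp α X) ?_).trans (le_of_eq (Real.mul_self_sqrt (trp_nonneg _ _)))
    · exact (contr_pw_imaginary (hYp _).1 hz).mul (contr_pw_imaginary (hσ' _).1 (by simp [hz]))
    · exact contr_pw_imaginary hσ.1 (by simp [hz])
    · simp [hz]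
    · simp only [hs_conjTranspose]
      refine hleft0 _ _ _ (fun k => contr_pw_imaginary (hσ' _).1 (by simp [hz]))
        (contr_pw_imaginary hσ.1 (by simp [hz])) (by simp [hz])
  have hright0 : ∀ (e u v : ℂ) (C₂ : Matrix x x ℂ), Contr C₂ → e.re = 1 / 2 → u.re = -1 / 2 →
      v.re = 1 / 2 → ∑ k, hs (pw (Y (π k)) e * pw (σ' (π k)) u * K k * pw σ v * C₂) ≤ N := by
    intro e u v C₂ hC₂ he hu hv
    have e1 : ∀ k, hs (pw (Y (π k)) e * pw (σ' (π k)) u * K k * pw σ v * C₂) ≤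
        hs (pw (Y (π k)) e * pw (σ' (π k)) u * (K k * pw σ v)) := by
      intro k
      rw [← Matrix.mul_assoc]
      exact hs_mul_right_le hC₂ _
    refine (Finset.sum_le_sum fun k _ => e1 k).trans ?_
    rw [hNY, ← Finset.sum_fiberwise Finset.univ π]
    refine Finset.sum_le_sum fun c _ => ?_
    have e2 : ∑ k with π k = c, hs (pw (Y (π k)) e * pw (σ' (π k)) u * (K k * pw σ v)) =
        ∑ k with π k = c, hs (pw (Y c) e * pw (σ' c) u * (K k * pw σ v)) := by
      refine Finset.sum_congr rfl fun k hk => ?_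
      rw [(Finset.mem_filter.1 hk).2]
    rw [e2]
    have hv1 : v + star v = 1 := by apply Complex.ext <;> simp [hv]; norm_num
    refine (sum_hs_mul_le _ (T := σ' c) ?_ _).trans ?_
    · have e3 : ∀ k, K k * pw σ v * (K k * pw σ v)ᴴ = K k * σ * (K k)ᴴ := by
        intro k
        rw [conjTranspose_mul, pw_conjTranspose, Matrix.mul_assoc, pw_mul_assoc, hv1, pw_one hσ,
          Matrix.mul_assoc]
      simp only [e3]
      exact hle c
    · rw [mul_mul_conjTranspose_eq (hσ' c), ← hs_eq_trace, Matrix.mul_assoc, pw_mul]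
      refine (hs_mul_right_le (contr_pw_imaginary (hσ' c).1 ?_) _).trans ?_
      · simp [hu]; norm_num
      · rw [hs_pw_of_re (hYp c) he]
  have hright : ∀ z : ℂ, z.re = 1 → ‖φ z‖ ≤ N := by
    intro z hz
    have e1 : φ z = ∑ k, ((pw (Y (π k)) (z / 2) * pw (σ' (π k)) (-z / 2) * K k *
        pw σ (z / 2) * (1 : Matrix x x ℂ)) * (pw (Y (π k)) (star (z / 2)) * pw (σ' (π k)) (star (-z / 2)) * K k *
          pw σ (star (z / 2)) * pw ω (star (1 - z)))ᴴ).trace := by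
      refine Finset.sum_congr rfl fun k _ => ?_
      simp only [conjTranspose_mul, pw_conjTranspose, star_star]
      rw [pw_split (Y (π k)) (z := z) (u := z / 2) (v := z / 2) (by ring), Matrix.mul_assoc,
        Matrix.trace_mul_comm]
      simp only [Matrix.mul_assoc, Matrix.mul_one]
    rw [e1]
    refine (norm_sum_trace_mul_le _ _ (hright0 _ _ _ _ Contr.one ?_ ?_ ?_)
      (v := N) ?_).trans (le_of_eq (Real.mul_self_sqrt hN0))
    · simp [hz]
    · simp [hz]
    · simp [hz]
    · simp only [hs_conjTranspose]
      exact hright0 _ _ _ _ (contr_pw_imaginary hωp.1 (by simp [hz])) (by simp [hz])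
        (by simp [hz]) (by simp [hz])
  have := hφs.norm_le_interp hp0.le hp1.le hleft hright
  rw [hφp, Complex.norm_real, Real.norm_of_nonneg hN0] at this
  rcases hN0.eq_or_lt with h0 | h0
  · rw [← h0]; exact trp_nonneg _ _
  · have e1 : N = N ^ (1 - p) * N ^ p := by rw [← Real.rpow_add h0]; norm_num
    nth_rewrite 1 [e1] at this
    have := le_of_mul_le_mul_right this (Real.rpow_pos_of_pos h0 p)
    exact (Real.rpow_le_rpow_iff hN0 (trp_nonneg _ _) (by linarith)).1 this

end DataProcessing

section WeightedHolder

variable {κ a b : Type*} [Fintype κ] [Fintype a] [DecidableEq a] [Fintype b] [DecidableEq b]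

lemma hs_mul_pw_self (B : Matrix a b ℂ) (r : ℝ) :
    hs (B * pw (Bᴴ * B) (r : ℂ)) = trp (2 * r + 1) (B * Bᴴ) := by
  have h := posSemidef_conjTranspose_mul_self B
  rw [trp_mul_conjTranspose, hs, conjTranspose_mul, pw_conjTranspose_ofReal]
  have e : pw (Bᴴ * B) (r : ℂ) * Bᴴ * (B * pw (Bᴴ * B) (r : ℂ)) =
      pw (Bᴴ * B) (r : ℂ) * (Bᴴ * B) * pw (Bᴴ * B) (r : ℂ) := by simp only [Matrix.mul_assoc]
  have e2 : pw (Bᴴ * B) (r : ℂ) * pw (Bᴴ * B) 1 * pw (Bᴴ * B) (r : ℂ) =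
      pw (Bᴴ * B) ((2 * r + 1 : ℝ) : ℂ) := by
    rw [pw_mul, pw_mul]; congr 1; push_cast; ring
  rw [pw_one h] at e2
  rw [e, e2, trp]


/-- Hölder's inequality for `∑ w ^ q ‖G H ^ (q / 2)‖²`. -/
lemma sum_weight_hs_mul_pw_le {G : κ → Matrix a b ℂ} {H : κ → Matrix b b ℂ} {w : κ → ℝ} {q : ℝ}
    (hq0 : 0 < q) (hq1 : q < 1) (hH : ∀ k, (H k).PosSemidef) (hw : ∀ k, 0 < w k) :
    ∑ k, w k ^ q * hs (G k * pw (H k) ((q / 2 : ℝ) : ℂ)) ≤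
      (∑ k, w k ^ (q / (1 - q)) * trp (1 / (1 - q)) (G k * (G k)ᴴ)) ^ (1 - q) *
        (∑ k, (H k).trace.re) ^ q := by
  have hq2 : 0 < 1 - q := by linarith
  set P : κ → Matrix b b ℂ := fun k => ((w k ^ q : ℝ) : ℂ) • ((G k)ᴴ * G k) with hP
  have hPp : ∀ k, (P k).PosSemidef := fun k =>
    (posSemidef_conjTranspose_mul_self (G k)).smul
      (by exact_mod_cast Real.rpow_nonneg (hw k).le q)
  set Y : κ → Matrix b b ℂ := fun k => pw (P k) ((1 / (1 - q) : ℝ) : ℂ) with hY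
  have h := sum_hs_pw_contr_pw_le (Y := Y) (ν := H) (C := fun _ => 1)
    (fun k => pw_posSemidef _ _) hH (fun _ => Contr.one) hq0 hq1
  refine le_of_eq_of_le (Finset.sum_congr rfl fun k _ => ?_) (h.trans (le_of_eq ?_))
  · rw [hs, hs, Matrix.mul_one, hY, pw_pw (hPp k).1]
    have e1 : ((1 / (1 - q) : ℝ) : ℂ) * (((1 - q) / 2 : ℝ) : ℂ) = ((1 / 2 : ℝ) : ℂ) := by
      rw [← Complex.ofReal_mul]; congr 1; field_simp
    rw [e1, ← conjTranspose_mul_mul_eq (hPp k), hP]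
    simp only [conjTranspose_mul, Matrix.mul_smul, Matrix.smul_mul, Matrix.trace_smul,
      Matrix.mul_assoc]
    rw [smul_eq_mul, Complex.re_ofReal_mul]
  · congr 2
    refine Finset.sum_congr rfl fun k _ => ?_
    change trp (1 / (1 - q)) (P k) = _
    rw [hP, trp_smul (posSemidef_conjTranspose_mul_self _) (Real.rpow_nonneg (hw k).le _)
      (by positivity), ← Real.rpow_mul (hw k).le, trp_mul_conjTranspose, mul_one_div]

lemma sum_weight_hs_optimal {B : κ → Matrix a b ℂ} {w : κ → ℝ} {α p : ℝ} (hα : 1 < α)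
    (hp : p = (α - 1) / α) (hw : ∀ k, 0 < w k) :
    ∑ k, w k ^ p * hs (B k * pw (((w k ^ (α - 1) : ℝ) : ℂ) •
      pw ((B k)ᴴ * B k) (α : ℂ)) ((p / 2 : ℝ) : ℂ)) =
      ∑ k, w k ^ (α - 1) * trp α (B k * (B k)ᴴ) := by
  refine Finset.sum_congr rfl fun k _ => ?_
  have hc : 0 < w k ^ (α - 1) := Real.rpow_pos_of_pos (hw k) _
  rw [pw_smul (pw_isHermitian _ α), pw_pw (posSemidef_conjTranspose_mul_self _).1,
    pe_ofReal_pos hc, Matrix.mul_smul, hs_smul, ← Complex.ofReal_mul, hs_mul_pw_self,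
    Complex.norm_real, Real.norm_of_nonneg (Real.rpow_nonneg hc.le _), ← Real.rpow_mul_natCast hc.le,
    ← Real.rpow_mul (hw k).le, ← mul_assoc, ← Real.rpow_add (hw k)]
  congr 2
  · rw [hp]; push_cast; field_simp; ring
  · rw [hp]; field_simp; ring

lemma trp_weight (B : Matrix a b ℂ) {α c : ℝ} :
    (((c : ℂ) • pw (Bᴴ * B) (α : ℂ)).trace).re = c * trp α (B * Bᴴ) := by
  rw [trp_mul_conjTranspose, Matrix.trace_smul, smul_eq_mul, Complex.re_ofReal_mul, trp]

end WeightedHolder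

section Stack

variable {ς a b c : Type*}

/-- Vertical stack of a family of matrices. -/
def stk (F : ς → Matrix a b ℂ) : Matrix (ς × a) b ℂ := of fun i j => F i.1 i.2 j

lemma stk_mul [Fintype b] (F : ς → Matrix a b ℂ) (V : Matrix b c ℂ) :
    stk F * V = stk fun s => F s * V := rfl

lemma hs_stk [Fintype ς] [Fintype a] [Fintype b] (F : ς → Matrix a b ℂ) :
    hs (stk F) = ∑ s, hs (F s) := by
  simp only [hs_eq_sum, Fintype.sum_prod_type, stk, of_apply]

lemma one_kronecker_mul_stk [Fintype ς] [DecidableEq ς] [Fintype a] (P : Matrix c a ℂ)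
    (F : ς → Matrix a b ℂ) :
    ((1 : Matrix ς ς ℂ) ⊗ₖ P) * stk F = stk fun s => P * F s := by
  ext ⟨s, i⟩ j
  simp [Matrix.mul_apply, stk, Fintype.sum_prod_type, Matrix.one_apply, ite_mul]

end Stack

section AbstractChain

variable {κ γ ς a b a' b' : Type*} [Fintype κ] [Fintype ς] [DecidableEq ς] [Fintype γ] [DecidableEq γ]
  [Fintype a] [DecidableEq a] [Fintype b] [DecidableEq b]
  [Fintype a'] [DecidableEq a'] [Fintype b'] [DecidableEq b']

lemma trp_eq_zero {P : Matrix a a ℂ} (hP : P.PosSemidef) {r : ℝ} (hr : r ≠ 0) (h : trp r P = 0) :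
    P = 0 := by
  have h0 : pw P (r : ℂ) = 0 := (pw_posSemidef P r).trace_eq_zero_iff.1 (by
    rw [trace_eq_re (pw_posSemidef P r)]; exact_mod_cast h)
  have h1 : pw (pw P (r : ℂ)) ((r⁻¹ : ℝ) : ℂ) = P := by
    rw [pw_pw hP.1, ← Complex.ofReal_mul, mul_inv_cancel₀ hr, Complex.ofReal_one, pw_one hP]
  have h2 : pw (0 : Matrix a a ℂ) ((r⁻¹ : ℝ) : ℂ) = 0 := by
    have := pw_smul (P := (0 : Matrix a a ℂ)) (isHermitian_zero) 0 ((r⁻¹ : ℝ) : ℂ)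
    rw [pe_zero_left] at this
    simpa using this
  rw [← h1, h0, h2]

lemma pw_mul_of_mul_conjTranspose {P : Matrix a a ℂ} (hP : P.PosSemidef) {m : Matrix a b ℂ}
    (h : P = m * mᴴ) : pw P 0 * m = m := by
  have h1 : (1 - pw P 0) * (m * mᴴ) = 0 := by
    have e : pw P 0 * pw P 1 = pw P 1 := by rw [pw_mul, zero_add]
    rw [pw_one hP] at e
    rw [← h, Matrix.sub_mul, Matrix.one_mul, e, sub_self]
  have h2 : (1 - pw P 0) * m = 0 := by
    rw [← hs_eq_zero (X := (1 - pw P 0) * m)]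
    rw [hs_eq_trace, conjTranspose_mul, ← Matrix.mul_assoc, Matrix.mul_assoc (1 - pw P 0), h1]
    simp
  rw [Matrix.sub_mul, Matrix.one_mul, sub_eq_zero] at h2
  exact h2.symm

lemma pw_mul_pw_neg {P : Matrix a a ℂ} (hP : P.PosDef) (z : ℂ) : pw P z * pw P (-z) = 1 := by
  rw [pw_mul, add_neg_cancel, pw_zero_of_posDef hP]

/-- The chain-rule estimate for an abstract family of maps. -/
theorem chain_bound (π : κ → γ) (Γ : κ × ς → Matrix a b ℂ →ₗ[ℂ] Matrix a' b' ℂ)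
    {t : Matrix a a ℂ} {T : γ → Matrix a' a' ℂ} {w : κ → ℝ} {α p L : ℝ} (hα : 1 < α) (hα2 : α < 2)
    (hp : p = (α - 1) / α) (hL : 0 ≤ L) (ht : t.PosDef) (hT : ∀ c, (T c).PosSemidef)
    (hw : ∀ k, 0 < w k)
    (h0 : ∀ m : Matrix a b ℂ, (t - m * mᴴ).PosSemidef → ∀ c,
      (T c - ∑ k with π k.1 = c, Γ k m * (Γ k m)ᴴ).PosSemidef)
    (h1 : ∀ m : Matrix a b ℂ, hs m = 1 → ∃ (ν : γ → Matrix a' a' ℂ) (G : κ × ς → Matrix a' b' ℂ),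
      (∀ c, (ν c).PosSemidef) ∧ ∑ c, (ν c).trace.re ≤ 1 ∧
      (∀ k, Γ k m = pw (ν (π k.1)) (((α - 1) / 2 : ℝ) : ℂ) * G k) ∧
      ∑ k, w k ^ (1 / (2 - α) - 1) * trp (1 / (2 - α))
        ((stk fun s => G (k, s)) * (stk fun s => G (k, s))ᴴ) ≤ L ^ (1 / (2 - α)))
    (m : Matrix a b ℂ) :
    ∑ k, w k ^ (α - 1) * trp α
      ((stk fun s => pw (T (π k)) ((-p / 2 : ℝ) : ℂ) * Γ (k, s) m) *
      (stk fun s => pw (T (π k)) ((-p / 2 : ℝ) : ℂ) * Γ (k, s) m)ᴴ) ≤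
      L * trp α ((pw t ((-p / 2 : ℝ) : ℂ) * m) * (pw t ((-p / 2 : ℝ) : ℂ) * m)ᴴ) := by
  have hα0 : 0 < α := by linarith
  set M := pw t ((-p / 2 : ℝ) : ℂ) * m with hM
  set X := M * Mᴴ with hX
  have hXp : X.PosSemidef := posSemidef_self_mul_conjTranspose M
  set Q := trp α X
  set B : κ → Matrix (ς × a') b' ℂ := fun k => stk fun s =>
    pw (T (π k)) ((-p / 2 : ℝ) : ℂ) * Γ (k, s) m with hB
  set s := ∑ k, w k ^ (α - 1) * trp α (B k * (B k)ᴴ) with hs'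
  have hs0 : 0 ≤ s := Finset.sum_nonneg fun k _ =>
    mul_nonneg (Real.rpow_nonneg (hw k).le _) (trp_nonneg _ _)
  have hmM : m = pw t ((p / 2 : ℝ) : ℂ) * M := by
    rw [hM, ← Matrix.mul_assoc]
    have : ((-p / 2 : ℝ) : ℂ) = -((p / 2 : ℝ) : ℂ) := by push_cast; ring
    rw [this, pw_mul_pw_neg ht, Matrix.one_mul]
  rcases (trp_nonneg α X).eq_or_lt with hQ0 | hQ0
  · have hX0 : X = 0 := trp_eq_zero hXp hα0.ne' hQ0.symm
    have hM0 : M = 0 := hs_eq_zero (by rw [hs_eq_trace, ← hX, hX0]; simp)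
    have hm0 : m = 0 := by rw [hmM, hM0, Matrix.mul_zero]
    have : s = 0 := by
      refine Finset.sum_eq_zero fun k _ => ?_
      have hBk : B k = 0 := by
        ext i j
        simp [hB, hm0, stk]
      rw [hBk, Matrix.zero_mul]
      have e := trp_smul (P := (0 : Matrix (ς × a') (ς × a') ℂ)) PosSemidef.zero (le_refl (0:ℝ)) hα0.ne'
      rw [Real.zero_rpow hα0.ne', smul_zero, zero_mul] at e
      rw [e, mul_zero]
    rw [this]
    exact mul_nonneg hL hQ0.le
  set θ := 1 / α with hθ
  have hθp : 1 - θ = p := by rw [hθ, hp]; field_simp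
  set m0 : Matrix a b ℂ := ((Q ^ (-1 / 2 : ℝ) : ℝ) : ℂ) • (pw X (((α - 1) / 2 : ℝ) : ℂ) * M)
    with hm0
  set ω : Matrix a a ℂ := ((Q⁻¹ : ℝ) : ℂ) • pw X (α : ℂ) with hω
  have hωm : ω = m0 * m0ᴴ := by
    rw [hm0, conjTranspose_smul, conjTranspose_mul, pw_conjTranspose_ofReal, Matrix.smul_mul,
      Matrix.mul_smul, smul_smul]
    have e1 : pw X (((α - 1) / 2 : ℝ) : ℂ) * M * (Mᴴ * pw X (((α - 1) / 2 : ℝ) : ℂ)) =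
        pw X (((α - 1) / 2 : ℝ) : ℂ) * X * pw X (((α - 1) / 2 : ℝ) : ℂ) := by
      rw [hX]; simp only [Matrix.mul_assoc]
    have e2 : pw X (((α - 1) / 2 : ℝ) : ℂ) * pw X 1 * pw X (((α - 1) / 2 : ℝ) : ℂ) =
        pw X (α : ℂ) := by
      rw [pw_mul, pw_mul]; congr 1; push_cast; ring
    rw [pw_one hXp] at e2
    rw [e1, e2, hω, Complex.star_def, Complex.conj_ofReal, ← Complex.ofReal_mul,
      ← Real.rpow_add hQ0]
    norm_num [Real.rpow_neg_one]
    rfl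
  have hωp : ω.PosSemidef := hωm ▸ posSemidef_self_mul_conjTranspose m0
  have hm01 : hs m0 = 1 := by
    rw [hs_eq_trace, ← hωm, hω, Matrix.trace_smul, smul_eq_mul, Complex.re_ofReal_mul]
    exact inv_mul_cancel₀ hQ0.ne'
  set H : κ → Matrix b' b' ℂ := fun k => ((w k ^ (α - 1) : ℝ) : ℂ) • pw ((B k)ᴴ * B k) (α : ℂ)
   
  have hHp : ∀ k, (H k).PosSemidef := fun k =>
    (pw_posSemidef _ _).smul (by exact_mod_cast Real.rpow_nonneg (hw k).le _)
  have hHs : ∑ k, (H k).trace.re = s :=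
    Finset.sum_congr rfl fun k _ => trp_weight (B k)
  have key := interpolation_bound (fun k : κ × ς => π k.1) Γ (q := α - 1) (bb := 1) (Λ := L * s ^ (α - 1)) (θ := θ)
    (w := fun k => w k.1) (H := fun k => H k.1) (by linarith) (by linarith) (by rw [hθ]; field_simp; ring) ht.posSemidef hωm hT
    (fun k => hHp k.1) (fun k => hw k.1) h0 (fun z hz => by
      have e1 : hs (pw t ((1 - z) / 2) * pw ω (-(1 - z) / 2) * m0) = 1 := by
        rw [← hm01, hs, hs]
        simp only [conjTranspose_mul, pw_conjTranspose]
        have : m0ᴴ * (pw ω (star (-(1 - z) / 2)) * pw t (star ((1 - z) / 2))) *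
            (pw t ((1 - z) / 2) * pw ω (-(1 - z) / 2) * m0) = m0ᴴ * (pw ω (star (-(1 - z) / 2)) *
            (pw t (star ((1 - z) / 2)) * pw t ((1 - z) / 2)) * pw ω (-(1 - z) / 2)) * m0 := by
          simp only [Matrix.mul_assoc]
        have e2 : star ((1 - z) / 2) + (1 - z) / 2 = 0 := by
          apply Complex.ext <;> simp [hz]; ring
        have e3 : star (-(1 - z) / 2) + -(1 - z) / 2 = 0 := by
          apply Complex.ext <;> simp [hz]; ring
        rw [this, pw_mul, e2, pw_zero_of_posDef ht, Matrix.mul_one, pw_mul, e3, Matrix.mul_assoc,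
          pw_mul_of_mul_conjTranspose hωp hωm]
      obtain ⟨ν, G, hν, hνb, hΓ, hG⟩ := h1 _ e1
      refine ⟨fun _ => 1, ν, G, fun _ => Contr.one, hν, hνb, fun k => ?_, ?_⟩
      · rw [hΓ, Matrix.one_mul]
      · have e11 : ∀ k, w k ^ (α - 1) * hs ((stk fun s => G (k, s)) *
            pw (H k) (((α - 1) / 2 : ℝ) : ℂ)) = ∑ s, w k ^ (α - 1) * hs (G (k, s) *
            pw (H k) (((α - 1) / 2 : ℝ) : ℂ)) := by
          intro k; rw [stk_mul, hs_stk, Finset.mul_sum]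
        rw [Fintype.sum_prod_type]
        simp only [← e11]
        refine (sum_weight_hs_mul_pw_le (by linarith) (by linarith) hHp hw).trans ?_
        rw [hHs]
        refine mul_le_mul_of_nonneg_right ?_ (Real.rpow_nonneg hs0 _)
        have e4 : 1 - (α - 1) = 2 - α := by ring
        have h2 : 0 < 2 - α := by linarith
        have e5 : (α - 1) / (2 - α) = 1 / (2 - α) - 1 := by field_simp; ring
        rw [e4, e5]
        refine (Real.rpow_le_rpow (Finset.sum_nonneg fun k _ => mul_nonneg
          (Real.rpow_nonneg (hw k).le _) (trp_nonneg _ _)) hG h2.le).trans (le_of_eq ?_)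
        rw [← Real.rpow_mul hL, one_div_mul_cancel h2.ne', Real.rpow_one])
  have hq : (α - 1) * θ = p := by rw [hθ, hp]; ring
  have e6 : pw t (((1 - θ) / 2 : ℝ) : ℂ) * pw ω ((-(1 - θ) / 2 : ℝ) : ℂ) * m0 =
      ((Q ^ (-θ / 2) : ℝ) : ℂ) • m := by
    have e7 : pw ω ((-(1 - θ) / 2 : ℝ) : ℂ) * m0 = ((Q ^ (-θ / 2) : ℝ) : ℂ) • M := by
      have hQi : (0 : ℝ) < Q⁻¹ := inv_pos.2 hQ0
      rw [hω, pw_smul (pw_isHermitian _ _), pe_ofReal_pos hQi, pw_pw hXp.1, hm0, Matrix.smul_mul,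
        Matrix.mul_smul, smul_smul, ← Matrix.mul_assoc, pw_mul]
      have e8 : (α : ℂ) * ((-(1 - θ) / 2 : ℝ) : ℂ) + (((α - 1) / 2 : ℝ) : ℂ) = 0 := by
        rw [← Complex.ofReal_mul, ← Complex.ofReal_add, hθp, hp]
        have : α * (-((α - 1) / α) / 2) + (α - 1) / 2 = 0 := by field_simp; ring
        rw [this]; simp
      rw [e8, pw_mul_of_mul_conjTranspose hXp hX, ← Complex.ofReal_mul, Real.inv_rpow hQ0.le,
        ← Real.rpow_neg hQ0.le, ← Real.rpow_add hQ0]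
      congr 3; ring
    rw [Matrix.mul_assoc, e7, Matrix.mul_smul, hθp, ← hmM]
  have e9 : ∑ k : κ × ς, w k.1 ^ ((α - 1) * θ) * hs (pw (T (π k.1)) ((-(1 - θ) / 2 : ℝ) : ℂ) *
      Γ k (pw t (((1 - θ) / 2 : ℝ) : ℂ) * pw ω ((-(1 - θ) / 2 : ℝ) : ℂ) * m0) *
        pw (H k.1) (((α - 1) * θ / 2 : ℝ) : ℂ)) = Q ^ (-θ) * s := by
    rw [e6, hs', ← sum_weight_hs_optimal hα hp hw, Finset.mul_sum,
      Fintype.sum_prod_type]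
    refine Finset.sum_congr rfl fun k _ => ?_
    rw [hB, stk_mul, hs_stk, Finset.mul_sum, Finset.mul_sum]
    refine Finset.sum_congr rfl fun s' _ => ?_
    rw [_root_.map_smul, Matrix.mul_smul, Matrix.smul_mul, hs_smul, hθp, hq, Complex.norm_real,
      Real.norm_of_nonneg (Real.rpow_nonneg hQ0.le _), ← Real.rpow_mul_natCast hQ0.le]
    have : -θ / 2 * ((2 : ℕ) : ℝ) = -θ := by push_cast; ring
    rw [this]; ring
  rw [e9, Real.one_rpow, one_mul] at key
  rcases hs0.eq_or_lt with hs1 | hs1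
  · rw [← hs1]; exact mul_nonneg hL hQ0.le
  have hθ0 : 0 < θ := by positivity
  rw [Real.mul_rpow hL (Real.rpow_nonneg hs0 _), ← Real.rpow_mul hs0, Real.rpow_neg hQ0.le,
    inv_mul_le_iff₀ (Real.rpow_pos_of_pos hQ0 _)] at key
  have e10 : s = s ^ θ * s ^ ((α - 1) * θ) := by
    rw [← Real.rpow_add hs1]
    have : θ + (α - 1) * θ = 1 := by rw [hθ]; field_simp; ring
    rw [this, Real.rpow_one]
  rw [← mul_assoc] at key
  nth_rewrite 1 [e10] at key
  have key2 := le_of_mul_le_mul_right key (Real.rpow_pos_of_pos hs1 _)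
  rw [← Real.mul_rpow hQ0.le hL] at key2
  have := (Real.rpow_le_rpow_iff hs0 (mul_nonneg hQ0.le hL) hθ0).1 key2
  linarith [mul_comm L Q]

end AbstractChain

section Channels

variable {R X Y : Type*} [Fintype R] [DecidableEq R] [Fintype X] [DecidableEq X]
  [Fintype Y] [DecidableEq Y]

lemma one_kronecker_conj_apply {Z : Type*} (K : Matrix Y X ℂ) (K' : Matrix X Z ℂ)
    (ρ : Matrix (R × X) (R × X) ℂ) (r r' : R) (y : Y) (z : Z) :
    (((1 : Matrix R R ℂ) ⊗ₖ K) * ρ * ((1 : Matrix R R ℂ) ⊗ₖ K')) (r, y) (r', z) =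
      (K * (of fun a a' => ρ (r, a) (r', a')) * K') y z := by
  simp only [mul_apply, kroneckerMap_apply, Fintype.sum_prod_type, one_apply, of_apply]
  rw [Finset.sum_eq_single r']
  · refine Finset.sum_congr rfl fun a _ => ?_
    rw [Finset.sum_eq_single r]
    · simp
    · intro b _ hb; simp [hb.symm]
    · simp
  · intro b _ hb; simp [hb]
  · simp

lemma kronecker_one_conj_apply {D D' Z : Type*} [Fintype D] (K : Matrix D' D ℂ) (K' : Matrix D Z ℂ)
    (ρ : Matrix (D × X) (D × X) ℂ) (d : D') (z : Z) (x x' : X) :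
    ((K ⊗ₖ (1 : Matrix X X ℂ)) * ρ * (K' ⊗ₖ (1 : Matrix X X ℂ))) (d, x) (z, x') =
      (K * (of fun a a' => ρ (a, x) (a', x')) * K') d z := by
  simp only [mul_apply, kroneckerMap_apply, Fintype.sum_prod_type, one_apply, of_apply]
  refine Finset.sum_congr rfl fun a _ => ?_
  rw [Finset.sum_eq_single x']
  · congr 1
    · refine Finset.sum_congr rfl fun a _ => ?_
      rw [Finset.sum_eq_single x]
      · simp
      · intro b _ hb; simp [hb.symm]
      · simp
    · simp
  · intro b _ hb; simp [hb]
  · simp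

lemma lext_sandwich {D D' : Type*} [Fintype D] (Φ : Matrix X X ℂ →ₗ[ℂ] Matrix Y Y ℂ)
    (K : Matrix D' D ℂ) (K' : Matrix D D' ℂ) (ρ : Matrix (D × X) (D × X) ℂ) :
    lext Φ ((K ⊗ₖ (1 : Matrix X X ℂ)) * ρ * (K' ⊗ₖ (1 : Matrix X X ℂ))) =
      (K ⊗ₖ (1 : Matrix Y Y ℂ)) * lext Φ ρ * (K' ⊗ₖ (1 : Matrix Y Y ℂ)) := by
  ext ⟨d, y⟩ ⟨d', y'⟩
  rw [kronecker_one_conj_apply]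
  simp only [lext, LinearMap.coe_mk, AddHom.coe_mk, of_apply, kronecker_one_conj_apply]
  have : (of fun x x' => (K * (of fun a a' => ρ (a, x) (a', x')) * K') d d') =
      ∑ a', ∑ a, (K d a * K' a' d') • (of fun x x' => ρ (a, x) (a', x')) := by
    ext x x'
    simp only [of_apply, Matrix.sum_apply, Matrix.smul_apply, smul_eq_mul, mul_apply, Finset.sum_mul]
    refine Finset.sum_congr rfl fun a _ => Finset.sum_congr rfl fun a' _ => by ring
  rw [this]
  simp only [map_sum, _root_.map_smul, Matrix.sum_apply, Matrix.smul_apply, smul_eq_mul, mul_apply,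
    Finset.sum_mul, of_apply]
  refine Finset.sum_congr rfl fun a _ => Finset.sum_congr rfl fun a' _ => by ring

lemma IsCPTP.exists_kraus {Φ : Matrix X X ℂ →ₗ[ℂ] Matrix Y Y ℂ} (h : IsCPTP Φ) :
    ∃ K : Fin (Fintype.card X) × Y → Matrix Y X ℂ,
      (∀ ρ, Φ ρ = ∑ k, K k * ρ * (K k)ᴴ) ∧ ∑ k, (K k)ᴴ * K k = 1 := by
  set e := Fintype.equivFin X
  set ψ : Fin (Fintype.card X) × X → ℂ := fun p => if e p.2 = p.1 then 1 else 0 with hψ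
  set J := lext (R := Fin (Fintype.card X)) Φ (vecMulVec ψ (star ψ))
  have hJp : J.PosSemidef := h.cp _ _ (posSemidef_vecMulVec_self_star ψ)
  set C := pw J ((1 / 2 : ℝ) : ℂ) with hC
  have hJC : J = C * Cᴴ := by
    rw [hC, pw_conjTranspose_ofReal, pw_mul, ← Complex.ofReal_add]
    norm_num
    rw [pw_one hJp]
  have hJe : ∀ x x' y y', J (e x, y) (e x', y') = Φ (single x x' 1) y y' := by
    intro x x' y y'
    have : (of fun a a' => vecMulVec ψ (star ψ) (e x, a) (e x', a')) = single x x' (1 : ℂ) := by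
      ext a a'
      simp only [vecMulVec_apply, hψ, of_apply, Pi.star_apply, single_apply,
        EmbeddingLike.apply_eq_iff_eq, ite_and]
      by_cases h1 : x = a
      · by_cases h2 : x' = a'
        · simp [h1, h2]
        · simp [h1, h2, eq_comm]
      · simp [h1, eq_comm]
    rw [← this]; rfl
  set K : Fin (Fintype.card X) × Y → Matrix Y X ℂ := fun k => of fun y x => C (e x, y) k with hK
  have hΦ : ∀ ρ, Φ ρ = ∑ k, K k * ρ * (K k)ᴴ := by
    intro ρ
    conv_lhs => rw [matrix_eq_sum_single ρ]
    ext y y'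
    have : ∀ x x', single x x' (ρ x x') = ρ x x' • single x x' (1 : ℂ) := by
      intro x x'; rw [smul_single, smul_eq_mul, mul_one]
    simp only [this, map_sum, _root_.map_smul, Matrix.sum_apply, Matrix.smul_apply, smul_eq_mul, ← hJe,
      hJC, hK, mul_apply, conjTranspose_apply, of_apply, Finset.mul_sum, Finset.sum_mul]
    conv_rhs => rw [Finset.sum_comm]
    rw [Finset.sum_comm]
    refine Finset.sum_congr rfl fun x' _ => ?_
    conv_rhs => rw [Finset.sum_comm]
    refine Finset.sum_congr rfl fun x _ => Finset.sum_congr rfl fun k _ => by ring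
  refine ⟨K, hΦ, ?_⟩
  refine ext_iff_trace_mul_right.2 fun ρ => ?_
  rw [Matrix.one_mul, ← h.tp ρ, hΦ, trace_sum, Finset.sum_mul, trace_sum]
  refine Finset.sum_congr rfl fun k _ => ?_
  rw [trace_mul_cycle, trace_mul_comm]
  simp only [Matrix.mul_assoc]

end Channels

section Purification

lemma pw_submatrix {m n : Type*} [Fintype m] [DecidableEq m] [Fintype n] [DecidableEq n]
    (e : m ≃ n) {P : Matrix n n ℂ} (hP : P.IsHermitian) (z : ℂ) :
    pw (P.submatrix e e) z = (pw P z).submatrix e e := by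
  have h : P.submatrix e e * (1 : Matrix n n ℂ).submatrix e id =
      (1 : Matrix n n ℂ).submatrix e id * P := by
    have h1 := submatrix_mul_equiv P (1 : Matrix n n ℂ) e e id
    have h2 := submatrix_mul_equiv (1 : Matrix n n ℂ) P e (Equiv.refl n) id
    rw [Matrix.mul_one] at h1
    simp only [Equiv.coe_refl, Matrix.one_mul, submatrix_id_id] at h2
    rw [h1, h2]
  have h3 := pw_intertwine (hP.submatrix e) hP h z
  have h1 := submatrix_mul_equiv ((1 : Matrix n n ℂ).submatrix e id) ((1 : Matrix n n ℂ).submatrix id e)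
    id (Equiv.refl n) id
  have h4 : (1 : Matrix n n ℂ).submatrix e id * (1 : Matrix n n ℂ).submatrix id e = 1 := by
    have := submatrix_mul_equiv (1 : Matrix n n ℂ) (1 : Matrix n n ℂ) e (Equiv.refl n) e
    simp only [Equiv.coe_refl, Matrix.one_mul, submatrix_one_equiv] at this
    exact this
  have h5 : (1 : Matrix n n ℂ).submatrix e id * pw P z * (1 : Matrix n n ℂ).submatrix id e =
      (pw P z).submatrix e e := by
    have h6 := submatrix_mul_equiv (1 : Matrix n n ℂ) (pw P z) e (Equiv.refl n) id
    have h7 := submatrix_mul_equiv (pw P z) (1 : Matrix n n ℂ) e (Equiv.refl n) e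
    simp only [Equiv.coe_refl, Matrix.one_mul, Matrix.mul_one, submatrix_id_id] at h6 h7
    rw [h6, h7]
  rw [← h5, ← h3, Matrix.mul_assoc, h4, Matrix.mul_one]

lemma trp_submatrix {m n : Type*} [Fintype m] [DecidableEq m] [Fintype n] [DecidableEq n]
    (e : m ≃ n) {P : Matrix n n ℂ} (hP : P.IsHermitian) (p : ℝ) :
    trp p (P.submatrix e e) = trp p P := by
  rw [trp, pw_submatrix e hP, trp]
  simp only [trace, diag_apply, submatrix_apply]
  rw [Equiv.sum_comp e (fun i => pw P p i i)]

variable {κ D R : Type*} [Fintype κ] [Fintype D] [DecidableEq D] [Fintype R] [DecidableEq R]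

lemma exists_sqrt_factor {P : Matrix D D ℂ} (hP : P.PosSemidef) :
    ∃ m : Matrix D D ℂ, P = m * mᴴ := by
  refine ⟨pw P ((1 / 2 : ℝ) : ℂ), ?_⟩
  rw [pw_conjTranspose_ofReal, pw_mul, ← Complex.ofReal_add]
  norm_num
  rw [pw_one hP]

lemma exists_purified_family {ω : κ → Matrix (D × R) (D × R) ℂ} (hω : ∀ c, (ω c).PosSemidef)
    (htr : ∑ c, (ω c).trace.re = 1) :
    ∃ (ω0 : Matrix (R × R) (R × R) ℂ) (K : κ × (D × R) → Matrix D R ℂ), IsState ω0 ∧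
      (∀ c, ω c = ∑ g, (K (c, g) ⊗ₖ (1 : Matrix R R ℂ)) * ω0 * (K (c, g) ⊗ₖ (1 : Matrix R R ℂ))ᴴ) ∧
      (1 - ∑ k, (K k)ᴴ * K k).PosSemidef := by
  classical
  choose m hm using fun c => exists_sqrt_factor (hω c)
  set n : Matrix ((κ × (D × R)) × D) R ℂ := of fun x r => m x.1.1 (x.2, r) x.1.2 with hn
  set N := nᴴ * n with hN
  have hNp : N.PosSemidef := posSemidef_conjTranspose_mul_self n
  set W := n * pw N ((-(1 / 2) : ℝ) : ℂ) with hW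
  have hWn : W * pw N ((1 / 2 : ℝ) : ℂ) = n := by
    rw [hW, mul_pw_assoc, ← Complex.ofReal_add]
    have h0 := pw_mul_of_mul_conjTranspose (m := nᴴ) hNp (by rw [conjTranspose_conjTranspose])
    have h1 := congrArg conjTranspose h0
    rw [conjTranspose_mul, pw_conjTranspose, conjTranspose_conjTranspose, star_zero] at h1
    norm_num
    exact h1
  have hWW : Wᴴ * W = pw N 0 := by
    rw [hW, conjTranspose_mul, pw_conjTranspose_ofReal, Matrix.mul_assoc, ← Matrix.mul_assoc nᴴ,
      ← hN]
    nth_rw 2 [← pw_one hNp]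
    rw [pw_mul_assoc, pw_mul]
    congr 1
    push_cast; ring
  set φ : R × R → ℂ := fun x => pw N ((1 / 2 : ℝ) : ℂ) x.1 x.2 with hφ
  set K : κ × (D × R) → Matrix D R ℂ := fun k => of fun d z => W (k, d) z with hK
  refine ⟨vecMulVec φ (star φ), K, ⟨posSemidef_vecMulVec_self_star φ, ?_⟩, ?_, ?_⟩
  · have h1 : (vecMulVec φ (star φ)).trace = N.trace := by
      have h2 : N = pw N ((1 / 2 : ℝ) : ℂ) * (pw N ((1 / 2 : ℝ) : ℂ))ᴴ := by
        rw [pw_conjTranspose_ofReal, pw_mul, ← Complex.ofReal_add]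
        norm_num
        rw [pw_one hNp]
      conv_rhs => rw [h2]
      simp only [trace, diag_apply, vecMulVec_apply, hφ, Pi.star_apply, Fintype.sum_prod_type,
        mul_apply, conjTranspose_apply]
    have h2 : N.trace = ∑ c, (ω c).trace := by
      simp only [hN, hm, trace, diag_apply, mul_apply, conjTranspose_apply, hn, of_apply]
      simp only [Fintype.sum_prod_type]
      rw [Finset.sum_comm]
      refine Finset.sum_congr rfl fun c _ => ?_
      simp only [Finset.sum_comm (s := (Finset.univ : Finset R)) (t := (Finset.univ : Finset D)), mul_comm]
      rw [Finset.sum_comm]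
    rw [h1, h2]
    have h3 : ∑ c, (ω c).trace = ((∑ c, (ω c).trace.re : ℝ) : ℂ) := by
      push_cast
      exact Finset.sum_congr rfl fun c _ => trace_eq_re (hω c)
    rw [h3, htr, Complex.ofReal_one]
  · intro c
    rw [hm]
    ext ⟨d, r⟩ ⟨d', r'⟩
    rw [Matrix.sum_apply]
    refine Finset.sum_congr rfl fun g _ => ?_
    have hv : ∀ (d : D) (r : R), m c (d, r) g = ∑ z, K (c, g) d z * pw N ((1 / 2 : ℝ) : ℂ) z r := by
      intro d r
      have := congrFun (congrFun hWn ((c, g), d)) r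
      rw [mul_apply] at this
      exact this.symm
    rw [conjTranspose_kronecker, conjTranspose_one, kronecker_one_conj_apply]
    simp only [conjTranspose_apply, hv, mul_apply, of_apply, vecMulVec_apply, hφ, Pi.star_apply,
      star_sum, star_mul', Finset.sum_mul, Finset.mul_sum]
    refine Finset.sum_congr rfl fun z _ => Finset.sum_congr rfl fun z' _ => by ring
  · have : ∑ k, (K k)ᴴ * K k = Wᴴ * W := by
      ext z z'
      simp only [Matrix.sum_apply, mul_apply, conjTranspose_apply, hK, of_apply]
      rw [Fintype.sum_prod_type (f := fun x => star (W x z) * W x z')]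
    rw [this, hWW]
    exact one_sub_pw_zero_posSemidef hNp.1

end Purification

section Leakage

variable {κ D R L : Type*} [Fintype κ] [DecidableEq κ] [Fintype D] [DecidableEq D]
  [Fintype R] [DecidableEq R] [Fintype L] [DecidableEq L]

lemma sub_kronecker {a b c d : Type*} (P Q : Matrix a b ℂ) (N : Matrix c d ℂ) :
    (P - Q) ⊗ₖ N = P ⊗ₖ N - Q ⊗ₖ N := by
  ext; simp [kroneckerMap_apply, sub_mul]

lemma kronecker_sub {a b c d : Type*} (N : Matrix a b ℂ) (P Q : Matrix c d ℂ) :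
    N ⊗ₖ (P - Q) = N ⊗ₖ P - N ⊗ₖ Q := by
  ext; simp [kroneckerMap_apply, mul_sub]

lemma sum_kronecker {ι a b c d : Type*} (s : Finset ι) (P : ι → Matrix a b ℂ) (N : Matrix c d ℂ) :
    (∑ i ∈ s, P i) ⊗ₖ N = ∑ i ∈ s, P i ⊗ₖ N := by
  ext; simp [kroneckerMap_apply, Matrix.sum_apply, Finset.sum_mul]

lemma sum_fiber_fst {ι M : Type*} [Fintype ι] [AddCommMonoid M] (f : κ × ι → M) (c : κ) :
    ∑ k : κ × ι with k.1 = c, f k = ∑ i, f (c, i) := by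
  rw [Finset.sum_filter, Fintype.sum_prod_type, Finset.sum_eq_single c]
  · simp
  · intro b _ hb; simp [hb]
  · simp

omit [Fintype D] [DecidableEq D] [DecidableEq R] in
lemma ptB_smul (c : ℂ) (ρ : Matrix (D × R) (D × R) ℂ) : ptB (c • ρ) = c • ptB ρ := by
  ext; simp [ptB, Finset.mul_sum]

omit [Fintype D] [DecidableEq D] [DecidableEq R] in
lemma ptB_sum {ι : Type*} (s : Finset ι) (ρ : ι → Matrix (D × R) (D × R) ℂ) :
    ptB (∑ i ∈ s, ρ i) = ∑ i ∈ s, ptB (ρ i) := by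
  ext; simp only [ptB, Matrix.sum_apply, of_apply]; rw [Finset.sum_comm]

omit [DecidableEq D] [DecidableEq R] in
lemma ptB_trace (ρ : Matrix (D × R) (D × R) ℂ) : (ptB ρ).trace = ρ.trace := by
  simp [ptB, trace, Fintype.sum_prod_type]

omit [DecidableEq D] in
lemma ptB_conj {D' : Type*} (K : Matrix D' D ℂ) (K' : Matrix D D' ℂ)
    (ρ : Matrix (D × R) (D × R) ℂ) :
    ptB ((K ⊗ₖ (1 : Matrix R R ℂ)) * ρ * (K' ⊗ₖ (1 : Matrix R R ℂ))) = K * ptB ρ * K' := by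
  ext d d'
  simp only [ptB, of_apply, kronecker_one_conj_apply]
  simp only [mul_apply, of_apply, Finset.mul_sum, Finset.sum_mul]
  rw [Finset.sum_comm]
  exact Finset.sum_congr rfl fun x _ => Finset.sum_comm

omit [DecidableEq D] [DecidableEq R] in
lemma ptB_posSemidef {ρ : Matrix (D × R) (D × R) ℂ} (hρ : ρ.PosSemidef) : (ptB ρ).PosSemidef := by
  have : ptB ρ = ∑ b, ρ.submatrix (fun a => (a, b)) (fun a => (a, b)) := by
    ext; simp [ptB, Matrix.sum_apply]
  rw [this]
  exact posSemidef_sum _ fun b _ => hρ.submatrix _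

lemma eq_zero_of_trace {P : Matrix D D ℂ} (hP : P.PosSemidef) (h : P.trace.re = 0) : P = 0 :=
  hP.trace_eq_zero_iff.1 (by rw [trace_eq_re hP, h, Complex.ofReal_zero])

lemma pw_ptB_mul {Y : Matrix (D × R) (D × R) ℂ} (hY : Y.PosSemidef) :
    (pw (ptB Y) 0 ⊗ₖ (1 : Matrix R R ℂ)) * Y = Y := by
  obtain ⟨m, hm⟩ := exists_sqrt_factor hY
  have hX := ptB_posSemidef hY
  set P := 1 - pw (ptB Y) 0 with hP
  have hPX : P * ptB Y = 0 := by
    have := congrArg conjTranspose (mul_pw_zero hX)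
    rw [conjTranspose_mul, pw_conjTranspose, star_zero, hX.1.eq] at this
    rw [hP, Matrix.sub_mul, this, Matrix.one_mul, sub_self]
  have h1 : hs ((P ⊗ₖ (1 : Matrix R R ℂ)) * m) = 0 := by
    rw [hs_eq_trace, conjTranspose_mul, Matrix.mul_assoc, ← Matrix.mul_assoc m, ← hm,
      conjTranspose_kronecker, conjTranspose_one, ← Matrix.mul_assoc, ← ptB_trace, ptB_conj, hPX]
    simp
  have h2 := hs_eq_zero h1
  have h3 : (P ⊗ₖ (1 : Matrix R R ℂ)) * Y = 0 := by
    rw [hm, ← Matrix.mul_assoc, h2, Matrix.zero_mul]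
  rw [hP, sub_kronecker, one_kronecker_one, Matrix.sub_mul, Matrix.one_mul, sub_eq_zero] at h3
  exact h3.symm

theorem leak_bound_of_pos {Ψ : Matrix R R ℂ →ₗ[ℂ] Matrix L L ℂ} {ρ : κ → Matrix (D × R) (D × R) ℂ}
    {T : κ → Matrix D D ℂ} {w : κ → ℝ} {α p Λ : ℝ} (hα : 1 < α) (hp : p = (α - 1) / α)
    (hρ : ∀ c, (ρ c).PosSemidef) (hT : ∀ c, (T c).PosDef) (hw : ∀ c, 0 < w c)
    (hρΨ : ∀ c, (lext Ψ (ρ c)).PosSemidef)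
    (hΨ : ∀ ω : Matrix (R × R) (R × R) ℂ, IsState ω → (lext Ψ ω).PosSemidef ∧
      ∃ σ : Matrix L L ℂ, IsState σ ∧ pw (ptB ω ⊗ₖ σ) 0 * lext Ψ ω * pw (ptB ω ⊗ₖ σ) 0 = lext Ψ ω ∧
        trp α (pw (ptB ω ⊗ₖ σ) ((-p / 2 : ℝ) : ℂ) * lext Ψ ω * pw (ptB ω ⊗ₖ σ) ((-p / 2 : ℝ) : ℂ)) ≤ Λ)
    (hQ : 0 < ∑ c, w c ^ (α - 1) *
      trp α (pw (T c) ((-p / 2 : ℝ) : ℂ) * ptB (ρ c) * pw (T c) ((-p / 2 : ℝ) : ℂ))) :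
    ∃ σ : Matrix L L ℂ, IsState σ ∧ ∀ σ' : Matrix L L ℂ, (σ' - σ).PosSemidef →
      ∑ c, w c ^ (α - 1) * trp α (pw (T c ⊗ₖ σ') ((-p / 2 : ℝ) : ℂ) * lext Ψ (ρ c) *
        pw (T c ⊗ₖ σ') ((-p / 2 : ℝ) : ℂ)) ≤
      Λ * ∑ c, w c ^ (α - 1) *
        trp α (pw (T c) ((-p / 2 : ℝ) : ℂ) * ptB (ρ c) * pw (T c) ((-p / 2 : ℝ) : ℂ)) := by
  have hα0 : 0 < α := by linarith
  have hpα : p * α = α - 1 := by rw [hp]; field_simp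
  set Q := ∑ c, w c ^ (α - 1) *
      trp α (pw (T c) ((-p / 2 : ℝ) : ℂ) * ptB (ρ c) * pw (T c) ((-p / 2 : ℝ) : ℂ))
  set Y : κ → Matrix (D × R) (D × R) ℂ := fun c => ((w c ^ p : ℝ) : ℂ) •
    ((pw (T c) ((-p / 2 : ℝ) : ℂ) ⊗ₖ (1 : Matrix R R ℂ)) * ρ c *
      (pw (T c) ((-p / 2 : ℝ) : ℂ) ⊗ₖ (1 : Matrix R R ℂ))) with hY
  have hherm : ∀ (n : ℝ) (P : Matrix D D ℂ),
      (pw P (n : ℂ) ⊗ₖ (1 : Matrix R R ℂ))ᴴ = pw P (n : ℂ) ⊗ₖ (1 : Matrix R R ℂ) := by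
    intro n P; rw [conjTranspose_kronecker, conjTranspose_one, pw_conjTranspose_ofReal]
  have hYp : ∀ c, (Y c).PosSemidef := by
    intro c
    refine PosSemidef.smul ?_ (by exact_mod_cast Real.rpow_nonneg (hw c).le _)
    have := (hρ c).mul_mul_conjTranspose_same (pw (T c) ((-p / 2 : ℝ) : ℂ) ⊗ₖ (1 : Matrix R R ℂ))
    rwa [hherm] at this
  set X : κ → Matrix D D ℂ := fun c => ptB (Y c) with hX
  have hXp : ∀ c, (X c).PosSemidef := fun c => ptB_posSemidef (hYp c)
  have hXe : ∀ c, X c = ((w c ^ p : ℝ) : ℂ) •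
      (pw (T c) ((-p / 2 : ℝ) : ℂ) * ptB (ρ c) * pw (T c) ((-p / 2 : ℝ) : ℂ)) := by
    intro c; simp only [hX, hY, ptB_smul, ptB_conj]
  have hwpow : ∀ c, (w c ^ p) ^ α = w c ^ (α - 1) := by
    intro c; rw [← Real.rpow_mul (hw c).le, hpα]
  have hXtr : ∑ c, trp α (X c) = Q := by
    refine Finset.sum_congr rfl fun c _ => ?_
    rw [hXe, trp_smul _ (Real.rpow_nonneg (hw c).le _) hα0.ne', hwpow]
    have := (ptB_posSemidef (hρ c)).mul_mul_conjTranspose_same (pw (T c) ((-p / 2 : ℝ) : ℂ))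
    rwa [pw_conjTranspose_ofReal] at this
  set ω : κ → Matrix (D × R) (D × R) ℂ := fun c => ((Q⁻¹ : ℝ) : ℂ) •
    ((pw (X c) (((α - 1) / 2 : ℝ) : ℂ) ⊗ₖ (1 : Matrix R R ℂ)) * Y c *
      (pw (X c) (((α - 1) / 2 : ℝ) : ℂ) ⊗ₖ (1 : Matrix R R ℂ))) with hω
  have hωp : ∀ c, (ω c).PosSemidef := by
    intro c
    refine PosSemidef.smul ?_ (by exact_mod_cast (inv_pos.2 hQ).le)
    have := (hYp c).mul_mul_conjTranspose_same (pw (X c) (((α - 1) / 2 : ℝ) : ℂ) ⊗ₖ (1 : Matrix R R ℂ))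
    rwa [hherm] at this
  have hωm : ∀ c, ptB (ω c) = ((Q⁻¹ : ℝ) : ℂ) • pw (X c) (α : ℂ) := by
    intro c
    simp only [hω, ptB_smul, ptB_conj]
    congr 1
    change pw (X c) _ * X c * pw (X c) _ = _
    nth_rw 2 [← pw_one (hXp c)]
    rw [pw_mul, pw_mul]
    congr 1; push_cast; ring
  have hωtr : ∑ c, (ω c).trace.re = 1 := by
    have : ∀ c, (ω c).trace.re = Q⁻¹ * trp α (X c) := by
      intro c
      rw [← ptB_trace, hωm, trace_smul, smul_eq_mul, Complex.re_ofReal_mul]; rfl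
    simp only [this, ← Finset.mul_sum, hXtr]
    exact inv_mul_cancel₀ hQ.ne'
  obtain ⟨ω0, K, hω0, hωK, hK⟩ := exists_purified_family hωp hωtr
  obtain ⟨hNp, σ, hσ, hsupp, hΛ⟩ := hΨ ω0 hω0
  refine ⟨σ, hσ, fun σ' hσσ' => ?_⟩
  have hσ'p : σ'.PosSemidef := by simpa using hσσ'.add hσ.1
  have hν : (ptB ω0).PosSemidef := ptB_posSemidef hω0.1
  have hT0 : (ptB ω0 ⊗ₖ σ).PosSemidef := hν.kronecker hσ.1
  set W : κ → Matrix D D ℂ := fun c => ptB (ω c) with hW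
  have hWp : ∀ c, (W c).PosSemidef := fun c => ptB_posSemidef (hωp c)
  set S := pw (ptB ω0 ⊗ₖ σ) ((-p / 2 : ℝ) : ℂ) * lext Ψ ω0 * pw (ptB ω0 ⊗ₖ σ) ((-p / 2 : ℝ) : ℂ) with hS
  have hSp : S.PosSemidef := by
    have := hNp.mul_mul_conjTranspose_same (pw (ptB ω0 ⊗ₖ σ) ((-p / 2 : ℝ) : ℂ))
    rwa [pw_conjTranspose_ofReal] at this
  have hSN : pw (ptB ω0 ⊗ₖ σ) ((p / 2 : ℝ) : ℂ) * S * pw (ptB ω0 ⊗ₖ σ) ((p / 2 : ℝ) : ℂ) =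
      lext Ψ ω0 := by
    conv_rhs => rw [← hsupp]
    rw [hS]
    simp only [← Matrix.mul_assoc, pw_mul]
    rw [mul_pw_assoc]
    congr 3 <;> push_cast <;> ring
  have hC := sum_trp_data_processing (κ := κ × (D × R)) (γ := κ) (fun k => k.1)
    (K := fun k => K k ⊗ₖ (1 : Matrix L L ℂ)) (σ := ptB ω0 ⊗ₖ σ) (X := S)
    (σ' := fun c => W c ⊗ₖ σ') hα hp ?_ hT0 (fun c => (hWp c).kronecker hσ'p) ?_ hSp
  rotate_left
  · have : 1 - ∑ k, (K k ⊗ₖ (1 : Matrix L L ℂ))ᴴ * (K k ⊗ₖ (1 : Matrix L L ℂ)) =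
        (1 - ∑ k, (K k)ᴴ * K k) ⊗ₖ (1 : Matrix L L ℂ) := by
      rw [sub_kronecker, one_kronecker_one, sum_kronecker]
      simp only [conjTranspose_kronecker, conjTranspose_one, ← mul_kronecker_mul, Matrix.one_mul]
    rw [this]
    exact hK.kronecker PosSemidef.one
  · intro c
    have h1 : ∑ k : κ × (D × R) with k.1 = c, (K k ⊗ₖ (1 : Matrix L L ℂ)) * (ptB ω0 ⊗ₖ σ) *
        (K k ⊗ₖ (1 : Matrix L L ℂ))ᴴ = W c ⊗ₖ σ := by
      rw [sum_fiber_fst]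
      simp only [conjTranspose_kronecker, conjTranspose_one, ← mul_kronecker_mul, Matrix.one_mul,
        Matrix.mul_one, hW]
      rw [hωK, ptB_sum, sum_kronecker]
      simp only [conjTranspose_kronecker, conjTranspose_one, ptB_conj]
    rw [h1, ← kronecker_sub]
    exact (hWp c).kronecker hσσ'
  have hkey : ∀ c, ∑ k : κ × (D × R) with k.1 = c, pw (W c ⊗ₖ σ') ((-p / 2 : ℝ) : ℂ) *
      (K k ⊗ₖ (1 : Matrix L L ℂ)) * pw (ptB ω0 ⊗ₖ σ) ((p / 2 : ℝ) : ℂ) * S *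
      pw (ptB ω0 ⊗ₖ σ) ((p / 2 : ℝ) : ℂ) * (K k ⊗ₖ (1 : Matrix L L ℂ))ᴴ *
      pw (W c ⊗ₖ σ') ((-p / 2 : ℝ) : ℂ) =
      ((Q ^ (p - 1) * w c ^ p : ℝ) : ℂ) • (pw (T c ⊗ₖ σ') ((-p / 2 : ℝ) : ℂ) * lext Ψ (ρ c) *
        pw (T c ⊗ₖ σ') ((-p / 2 : ℝ) : ℂ)) := by
    intro c
    have e1 : ∑ k : κ × (D × R) with k.1 = c, pw (W c ⊗ₖ σ') ((-p / 2 : ℝ) : ℂ) *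
        (K k ⊗ₖ (1 : Matrix L L ℂ)) * pw (ptB ω0 ⊗ₖ σ) ((p / 2 : ℝ) : ℂ) * S *
        pw (ptB ω0 ⊗ₖ σ) ((p / 2 : ℝ) : ℂ) * (K k ⊗ₖ (1 : Matrix L L ℂ))ᴴ *
        pw (W c ⊗ₖ σ') ((-p / 2 : ℝ) : ℂ) =
        pw (W c ⊗ₖ σ') ((-p / 2 : ℝ) : ℂ) * lext Ψ (ω c) * pw (W c ⊗ₖ σ') ((-p / 2 : ℝ) : ℂ) := by
      rw [hωK, map_sum, Matrix.mul_sum, Finset.sum_mul, sum_fiber_fst]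
      refine Finset.sum_congr rfl fun g _ => ?_
      simp only [conjTranspose_kronecker, conjTranspose_one]
      rw [lext_sandwich, ← hSN]
      simp only [Matrix.mul_assoc]
    have e2 : pw (W c ⊗ₖ σ') ((-p / 2 : ℝ) : ℂ) = ((Q ^ (p / 2) : ℝ) : ℂ) •
        (pw (X c) ((-(α - 1) / 2 : ℝ) : ℂ) ⊗ₖ pw σ' ((-p / 2 : ℝ) : ℂ)) := by
      rw [pw_kronecker (hWp c).1 hσ'p.1, hW]
      simp only [hωm]
      rw [pw_smul (pw_isHermitian _ _), pw_pw (hXp c).1, smul_kronecker, pe_ofReal_pos (inv_pos.2 hQ)]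
      congr 2
      · rw [Real.inv_rpow hQ.le, ← Real.rpow_neg hQ.le]; congr 2; ring
      · rw [← Complex.ofReal_mul]; congr 2; linear_combination (-1 / 2 : ℝ) * hpα
    have e3 : pw (X c) ((-(α - 1) / 2 : ℝ) : ℂ) * pw (X c) (((α - 1) / 2 : ℝ) : ℂ) = pw (X c) 0 := by
      rw [pw_mul]; congr 1; push_cast; ring
    have e3' : pw (X c) (((α - 1) / 2 : ℝ) : ℂ) * pw (X c) ((-(α - 1) / 2 : ℝ) : ℂ) = pw (X c) 0 := by
      rw [pw_mul]; congr 1; push_cast; ring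
    have e4 := pw_ptB_mul (hYp c)
    have e4' := congrArg conjTranspose e4
    rw [conjTranspose_mul, (hYp c).1.eq, conjTranspose_kronecker, conjTranspose_one, pw_conjTranspose,
      star_zero] at e4'
    have e5 : ∀ (P : Matrix D D ℂ) (N : Matrix L L ℂ),
        P ⊗ₖ N = ((1 : Matrix D D ℂ) ⊗ₖ N) * (P ⊗ₖ (1 : Matrix L L ℂ)) := by
      intro P N; rw [← mul_kronecker_mul, Matrix.one_mul, Matrix.mul_one]
    have e5' : ∀ (P : Matrix D D ℂ) (N : Matrix L L ℂ),
        P ⊗ₖ N = (P ⊗ₖ (1 : Matrix L L ℂ)) * ((1 : Matrix D D ℂ) ⊗ₖ N) := by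
      intro P N; rw [← mul_kronecker_mul, Matrix.one_mul, Matrix.mul_one]
    have e6 : ∀ (P P' : Matrix D D ℂ) (N : Matrix L L ℂ) (M : Matrix (D × R) (D × R) ℂ),
        (P ⊗ₖ N) * lext Ψ M * (P' ⊗ₖ N) = ((1 : Matrix D D ℂ) ⊗ₖ N) *
          lext Ψ ((P ⊗ₖ (1 : Matrix R R ℂ)) * M * (P' ⊗ₖ (1 : Matrix R R ℂ))) *
          ((1 : Matrix D D ℂ) ⊗ₖ N) := by
      intro P P' N M
      rw [lext_sandwich, e5 P N, e5' P' N]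
      simp only [Matrix.mul_assoc]
    have e7 : (pw (X c) ((-(α - 1) / 2 : ℝ) : ℂ) ⊗ₖ (1 : Matrix R R ℂ)) * ω c *
        (pw (X c) ((-(α - 1) / 2 : ℝ) : ℂ) ⊗ₖ (1 : Matrix R R ℂ)) = ((Q⁻¹ : ℝ) : ℂ) • Y c := by
      simp only [hω, Matrix.mul_smul, Matrix.smul_mul]
      congr 1
      simp only [← Matrix.mul_assoc, ← mul_kronecker_mul, Matrix.one_mul, e3]
      rw [e4, Matrix.mul_assoc, ← mul_kronecker_mul, Matrix.one_mul, e3', e4']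
    rw [e1, e2, Matrix.smul_mul, Matrix.smul_mul, Matrix.mul_smul, e6, e7,
      pw_kronecker (hT c).1 hσ'p.1, e6 (pw (T c) _)]
    simp only [hY, _root_.map_smul, Matrix.mul_smul, Matrix.smul_mul, smul_smul]
    congr 1
    rw [← Complex.ofReal_mul, ← Complex.ofReal_mul, ← Complex.ofReal_mul]
    congr 1
    rw [show Q ^ (p - 1) = Q ^ (p / 2) * Q ^ (p / 2) * Q⁻¹ by
      rw [← Real.rpow_add hQ, ← Real.rpow_neg_one, ← Real.rpow_add hQ]; congr 1; ring]
    ring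
  have hfin : ∀ c, trp α (((Q ^ (p - 1) * w c ^ p : ℝ) : ℂ) • (pw (T c ⊗ₖ σ') ((-p / 2 : ℝ) : ℂ) *
      lext Ψ (ρ c) * pw (T c ⊗ₖ σ') ((-p / 2 : ℝ) : ℂ))) = Q⁻¹ * (w c ^ (α - 1) *
      trp α (pw (T c ⊗ₖ σ') ((-p / 2 : ℝ) : ℂ) * lext Ψ (ρ c) *
        pw (T c ⊗ₖ σ') ((-p / 2 : ℝ) : ℂ))) := by
    intro c
    have h0 := (hρΨ c).mul_mul_conjTranspose_same (pw (T c ⊗ₖ σ') ((-p / 2 : ℝ) : ℂ))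
    rw [pw_conjTranspose_ofReal] at h0
    rw [trp_smul h0 (mul_nonneg (Real.rpow_nonneg hQ.le _) (Real.rpow_nonneg (hw c).le _)) hα0.ne',
      Real.mul_rpow (Real.rpow_nonneg hQ.le _) (Real.rpow_nonneg (hw c).le _), hwpow,
      ← Real.rpow_mul hQ.le, show (p - 1) * α = -1 by linarith, Real.rpow_neg_one, mul_assoc]
  simp only [hkey, hfin, ← Finset.mul_sum] at hC
  have := hC.trans hΛ
  rw [inv_mul_le_iff₀ hQ] at this
  linarith [mul_comm Q Λ]

end Leakage

section Supports

variable {D R L X Y : Type*} [Fintype D] [DecidableEq D] [Fintype R] [DecidableEq R]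
  [Fintype L] [DecidableEq L] [Fintype X] [DecidableEq X] [Fintype Y] [DecidableEq Y]

lemma lext_kraus {ι : Type*} [Fintype ι] {Φ : Matrix X X ℂ →ₗ[ℂ] Matrix Y Y ℂ} {K : ι → Matrix Y X ℂ}
    (hK : ∀ ρ, Φ ρ = ∑ k, K k * ρ * (K k)ᴴ) (ρ : Matrix (D × X) (D × X) ℂ) :
    lext Φ ρ = ∑ k, ((1 : Matrix D D ℂ) ⊗ₖ K k) * ρ * ((1 : Matrix D D ℂ) ⊗ₖ K k)ᴴ := by
  ext ⟨d, y⟩ ⟨d', y'⟩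
  simp only [Matrix.sum_apply, conjTranspose_kronecker, conjTranspose_one, one_kronecker_conj_apply]
  simp only [lext, LinearMap.coe_mk, AddHom.coe_mk, of_apply, hK, Matrix.sum_apply]

lemma IsCPTP.lext_posSemidef {Φ : Matrix X X ℂ →ₗ[ℂ] Matrix Y Y ℂ} (h : IsCPTP Φ)
    {ρ : Matrix (D × X) (D × X) ℂ} (hρ : ρ.PosSemidef) : (lext Φ ρ).PosSemidef := by
  obtain ⟨K, hK, -⟩ := h.exists_kraus
  rw [lext_kraus hK]
  exact posSemidef_sum _ fun k _ => hρ.mul_mul_conjTranspose_same _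

lemma IsCPTP.posSemidef {Φ : Matrix X X ℂ →ₗ[ℂ] Matrix Y Y ℂ} (h : IsCPTP Φ)
    {ρ : Matrix X X ℂ} (hρ : ρ.PosSemidef) : (Φ ρ).PosSemidef := by
  obtain ⟨K, hK, -⟩ := h.exists_kraus
  rw [hK]
  exact posSemidef_sum _ fun k _ => hρ.mul_mul_conjTranspose_same _

lemma ptB_lext {Φ : Matrix X X ℂ →ₗ[ℂ] Matrix Y Y ℂ} (h : IsCPTP Φ) (ρ : Matrix (D × X) (D × X) ℂ) :
    ptB (lext Φ ρ) = ptB ρ := by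
  ext d d'
  exact h.tp (of fun a a' => ρ (d, a) (d', a'))

lemma lext_trace {Φ : Matrix X X ℂ →ₗ[ℂ] Matrix Y Y ℂ} (h : IsCPTP Φ) (ρ : Matrix (D × X) (D × X) ℂ) :
    (lext Φ ρ).trace = ρ.trace := by
  rw [← ptB_trace, ptB_lext h, ptB_trace]

lemma IsCPTP.isState_lext {Φ : Matrix X X ℂ →ₗ[ℂ] Matrix Y Y ℂ} (h : IsCPTP Φ)
    {ρ : Matrix (D × X) (D × X) ℂ} (hρ : IsState ρ) : IsState (lext Φ ρ) :=
  ⟨h.lext_posSemidef hρ.1, (lext_trace h ρ).trans hρ.2⟩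

/-- The partial trace over the first factor, as a linear map. -/
def ptALin (R L : Type*) [Fintype R] : Matrix (R × L) (R × L) ℂ →ₗ[ℂ] Matrix L L ℂ where
  toFun := ptA
  map_add' ρ σ := by ext; simp [ptA, Finset.sum_add_distrib]
  map_smul' c ρ := by ext; simp [ptA, Finset.mul_sum]

lemma IsCPTP.ptALin_comp {Φ : Matrix X X ℂ →ₗ[ℂ] Matrix (R × L) (R × L) ℂ} (h : IsCPTP Φ) :
    IsCPTP (ptALin R L ∘ₗ Φ) where
  cp n ρ hρ := by
    have h1 := h.cp n ρ hρ
    have : lext (ptALin R L ∘ₗ Φ) ρ =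
        ∑ r, (lext Φ ρ).submatrix (fun x => (x.1, (r, x.2))) (fun x => (x.1, (r, x.2))) := by
      ext x y
      simp [Matrix.sum_apply, lext, ptALin, ptA]
    rw [this]
    exact posSemidef_sum _ fun r _ => h1.submatrix _
  tp ρ := by
    rw [← h.tp ρ]
    simp only [ptALin, ptA, trace, LinearMap.comp_apply, LinearMap.coe_mk, AddHom.coe_mk, diag_apply,
      of_apply, Fintype.sum_prod_type]
    rw [Finset.sum_comm]

lemma mul_pw_zero_of_suppSubset {ρ σ : Matrix X X ℂ} (hσ : σ.PosSemidef) (h : suppSubset ρ σ) :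
    ρ * pw σ 0 = ρ := by
  have h1 : ρ * (1 - pw σ 0) = 0 := by
    refine Matrix.ext fun i j => ?_
    have h2 : σ *ᵥ (fun k => (1 - pw σ 0) k j) = 0 := by
      funext i
      have : (σ * (1 - pw σ 0)) i j = 0 := by
        rw [Matrix.mul_sub, Matrix.mul_one, mul_pw_zero hσ, sub_self, Matrix.zero_apply]
      simpa [mul_apply, mulVec, dotProduct] using this
    have := congrFun (h _ h2) i
    simpa [mul_apply, mulVec, dotProduct] using this
  rw [Matrix.mul_sub, Matrix.mul_one, sub_eq_zero] at h1
  exact h1.symm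

lemma suppSubset_of_mul_pw_zero {ρ σ : Matrix X X ℂ} (hσ : σ.PosSemidef) (h : ρ * pw σ 0 = ρ) :
    suppSubset ρ σ := by
  intro v hv
  have h1 : pw σ (-1) * pw σ 1 = pw σ 0 := by rw [pw_mul, neg_add_cancel]
  rw [pw_one hσ] at h1
  rw [← h, ← h1, ← mulVec_mulVec, ← mulVec_mulVec, hv, mulVec_zero, mulVec_zero]

lemma pw_zero_mul_of_mul_pw_zero {ρ σ : Matrix X X ℂ} (hρ : ρ.IsHermitian) (h : ρ * pw σ 0 = ρ) :
    pw σ 0 * ρ = ρ := by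
  have := congrArg conjTranspose h
  rwa [conjTranspose_mul, hρ.eq, pw_conjTranspose, star_zero] at this

lemma trp_le_card {P : Matrix X X ℂ} (hP : P.PosSemidef) (h : P.trace.re ≤ 1) {s : ℝ} (hs : 0 < s) :
    trp s P ≤ Fintype.card X := by
  rw [trp_eq_sum hP hs.ne', ← Finset.card_univ, ← nsmul_one, ← Finset.sum_const]
  refine Finset.sum_le_sum fun i _ => Real.rpow_le_one (hP.eigenvalues_nonneg i) ?_ hs.le
  rw [trace_re_eq_sum hP] at h
  exact (Finset.single_le_sum (fun i _ => hP.eigenvalues_nonneg i) (Finset.mem_univ i)).trans h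

end Supports

section LeakageCondition

variable {κ Q R Rh L : Type*} [Fintype κ] [DecidableEq κ] [Fintype Q] [DecidableEq Q]
  [Fintype R] [DecidableEq R] [Fintype Rh] [DecidableEq Rh] [Fintype L] [DecidableEq L]

lemma D_of_suppSubset {α : ℝ} {ρ σ : Matrix Q Q ℂ} (h : suppSubset ρ σ) : D α ρ σ = (DR α ρ σ : ℝ) := by
  unfold D; rw [if_pos (Or.inr h)]

lemma DR_eq {α p : ℝ} (hα : 1 < α) (hp : p = (α - 1) / α) {ρ σ : Matrix Q Q ℂ} (hρ : IsState ρ)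
    (hσ : σ.PosSemidef) : DR α ρ σ = (α - 1)⁻¹ * Real.logb 2
      (trp α (pw σ ((-p / 2 : ℝ) : ℂ) * ρ * pw σ ((-p / 2 : ℝ) : ℂ))) := by
  have hα0 : 0 < α := by linarith
  have hs : (1 - α) / (2 * α) = -p / 2 := by rw [hp]; field_simp; ring
  have hs0 : -p / 2 ≠ 0 := by
    rw [hp]; have : 0 < (α - 1) / α := div_pos (by linarith) hα0
    intro h; linarith
  have h0 := hρ.1.mul_mul_conjTranspose_same (pw σ ((-p / 2 : ℝ) : ℂ))
  rw [pw_conjTranspose_ofReal] at h0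
  unfold DR
  rw [hs, mpow_eq_pw hσ hs0, mpow_trace_re h0 hα0.ne', hρ.2]
  simp

lemma exists_isState [Nonempty L] : ∃ σ : Matrix L L ℂ, IsState σ ∧
    σ = (((Fintype.card L : ℝ)⁻¹ : ℝ) : ℂ) • 1 := by
  have hc : (Fintype.card L : ℂ) ≠ 0 := by simp
  refine ⟨_, ⟨PosSemidef.smul PosSemidef.one (by
    have : (0 : ℝ) ≤ (Fintype.card L : ℝ)⁻¹ := by positivity
    exact_mod_cast this), ?_⟩, rfl⟩
  rw [trace_smul, trace_one, smul_eq_mul]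
  push_cast
  exact inv_mul_cancel₀ hc

lemma ptB_isState {Ω : Matrix (Q × L) (Q × L) ℂ} (hΩ : IsState Ω) : IsState (ptB Ω) :=
  ⟨ptB_posSemidef hΩ.1, (ptB_trace _).trans hΩ.2⟩

lemma trace_mul_kronecker_one (P : Matrix Q Q ℂ) (Ω : Matrix (Q × L) (Q × L) ℂ) :
    ((P ⊗ₖ (1 : Matrix L L ℂ)) * Ω).trace = (P * ptB Ω).trace := by
  have := ptB_conj P 1 Ω
  rw [one_kronecker_one, Matrix.mul_one, Matrix.mul_one] at this
  rw [← ptB_trace, this]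

/-- A dimension bound for the sandwiched trace functional at the maximally mixed leakage state. -/
lemma trp_maximally_mixed_le [Nonempty L] {α p : ℝ} (hα : 1 < α) (hp : p = (α - 1) / α)
    {Ω : Matrix (Q × L) (Q × L) ℂ} (hΩ : IsState Ω) {σ : Matrix L L ℂ}
    (hσ : σ = (((Fintype.card L : ℝ)⁻¹ : ℝ) : ℂ) • 1) :
    trp α (pw (ptB Ω ⊗ₖ σ) ((-p / 2 : ℝ) : ℂ) * Ω * pw (ptB Ω ⊗ₖ σ) ((-p / 2 : ℝ) : ℂ)) ≤
      ((Fintype.card L : ℝ) ^ p * Fintype.card Q) ^ α := by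
  have hα0 : 0 < α := by linarith
  have hc : 0 < (Fintype.card L : ℝ) := by positivity
  have hp1 : p < 1 := by rw [hp, div_lt_one hα0]; linarith
  have hX := ptB_isState hΩ
  have h0 := hΩ.1.mul_mul_conjTranspose_same (pw (ptB Ω ⊗ₖ σ) ((-p / 2 : ℝ) : ℂ))
  rw [pw_conjTranspose_ofReal] at h0
  refine (trp_le_trace_rpow h0 hα.le).trans ?_
  refine Real.rpow_le_rpow (trace_re_nonneg h0) ?_ hα0.le
  have h1 : pw (ptB Ω ⊗ₖ σ) ((-p : ℝ) : ℂ) =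
      (((Fintype.card L : ℝ) ^ p : ℝ) : ℂ) • (pw (ptB Ω) ((-p : ℝ) : ℂ) ⊗ₖ (1 : Matrix L L ℂ)) := by
    have h2 : σ.IsHermitian := by
      rw [hσ]
      exact (PosSemidef.smul PosSemidef.one (by
        have : (0 : ℝ) ≤ (Fintype.card L : ℝ)⁻¹ := by positivity
        exact_mod_cast this)).1
    rw [pw_kronecker hX.1.1 h2, hσ, pw_smul isHermitian_one, pw_one_left, kronecker_smul,
      pe_ofReal_pos (inv_pos.2 hc), Real.inv_rpow hc.le, ← Real.rpow_neg hc.le, neg_neg]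
  rw [trace_mul_comm, ← Matrix.mul_assoc, pw_mul, ← Complex.ofReal_add,
    show -p / 2 + -p / 2 = -p by ring, h1, Matrix.smul_mul, trace_smul, trace_mul_kronecker_one,
    smul_eq_mul, Complex.re_ofReal_mul]
  refine mul_le_mul_of_nonneg_left ?_ (Real.rpow_nonneg hc.le _)
  have h2 : pw (ptB Ω) ((-p : ℝ) : ℂ) * ptB Ω = pw (ptB Ω) ((1 - p : ℝ) : ℂ) := by
    nth_rewrite 2 [← pw_one hX.1]
    rw [pw_mul]; congr 1; push_cast; ring
  rw [h2]
  exact trp_le_card hX.1 (by rw [hX.2]; simp) (by linarith)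

lemma pw_zero_sandwich_eq {Ω : Matrix Q Q ℂ} {σ : Matrix Q Q ℂ} (hΩ : Ω.IsHermitian)
    (h : Ω * pw σ 0 = Ω) : pw σ 0 * Ω * pw σ 0 = Ω := by
  rw [pw_zero_mul_of_mul_pw_zero hΩ h, h]

lemma suppSubset_ptB_kronecker [Nonempty L] {Ω : Matrix (Q × L) (Q × L) ℂ} (hΩ : IsState Ω)
    {σ : Matrix L L ℂ} (hσ : σ.PosSemidef) (hσ0 : pw σ 0 = 1) : suppSubset Ω (ptB Ω ⊗ₖ σ) := by
  have hX := ptB_isState hΩ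
  refine suppSubset_of_mul_pw_zero (hX.1.kronecker hσ) ?_
  rw [pw_kronecker hX.1.1 hσ.1, hσ0]
  have := congrArg conjTranspose (pw_ptB_mul hΩ.1)
  rwa [conjTranspose_mul, hΩ.1.1.eq, conjTranspose_kronecker, pw_conjTranspose, star_zero,
    conjTranspose_one] at this

lemma Idown_le [Nonempty L] {α p : ℝ} (hα : 1 < α) (hp : p = (α - 1) / α)
    {Ω : Matrix (Q × L) (Q × L) ℂ} (hΩ : IsState Ω) :
    Idown α Ω ≤ (((α - 1)⁻¹ * Real.logb 2
      (max 1 (((Fintype.card L : ℝ) ^ p * Fintype.card Q) ^ α)) : ℝ) : EReal) := by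
  obtain ⟨σ, hσ, hσe⟩ := exists_isState (L := L)
  have hc : 0 < (Fintype.card L : ℝ) := by positivity
  have hσ0 : pw σ 0 = 1 := by
    rw [hσe, pw_smul isHermitian_one, pw_one_left, ← Complex.ofReal_zero,
      pe_ofReal_pos (inv_pos.2 hc), Real.rpow_zero]; simp
  have h0 : Idown α Ω ≤ D α Ω (ptB Ω ⊗ₖ σ) := sInf_le ⟨σ, hσ, rfl⟩
  refine h0.trans ?_
  rw [D_of_suppSubset (suppSubset_ptB_kronecker hΩ hσ.1 hσ0),
    DR_eq hα hp hΩ ((ptB_isState hΩ).1.kronecker hσ.1)]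
  have h1 := trp_maximally_mixed_le hα hp hΩ hσe
  have h2 := trp_nonneg α (pw (ptB Ω ⊗ₖ σ) ((-p / 2 : ℝ) : ℂ) * Ω *
    pw (ptB Ω ⊗ₖ σ) ((-p / 2 : ℝ) : ℂ))
  norm_cast
  refine mul_le_mul_of_nonneg_left ?_ (inv_nonneg.2 (by linarith))
  rcases h2.eq_or_lt with h3 | h3
  · rw [← h3, Real.logb_zero]
    exact Real.logb_nonneg (by norm_num) (le_max_left _ _)
  · exact Real.logb_le_logb_of_le (by norm_num) h3 (h1.trans (le_max_right _ _))

lemma trp_le_of_DR_lt {α p y : ℝ} (hα : 1 < α) (hp : p = (α - 1) / α) {ρ σ : Matrix Q Q ℂ}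
    (hρ : IsState ρ) (hσ : σ.PosSemidef) (h : DR α ρ σ < y) :
    trp α (pw σ ((-p / 2 : ℝ) : ℂ) * ρ * pw σ ((-p / 2 : ℝ) : ℂ)) ≤ 2 ^ ((α - 1) * y) := by
  rw [DR_eq hα hp hρ hσ, inv_mul_lt_iff₀ (by linarith)] at h
  rcases (trp_nonneg α (pw σ ((-p / 2 : ℝ) : ℂ) * ρ * pw σ ((-p / 2 : ℝ) : ℂ))).eq_or_lt with h3 | h3
  · rw [← h3]; positivity
  · exact ((Real.logb_lt_iff_lt_rpow (by norm_num) h3).1 h).le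

lemma traceOut_eXi_lext {R Rh L : Type} [Fintype Rh]
    (Φ : Matrix R R ℂ →ₗ[ℂ] Matrix (Rh × L) (Rh × L) ℂ) (ω : Matrix (R × R) (R × R) ℂ) :
    traceOut (eXi R Rh L) (lext Φ ω) = lext (ptALin Rh L ∘ₗ Φ) ω := by
  ext x y
  simp [traceOut, eXi, lext, ptALin, ptA]

/-- Every state has a nearly optimal leakage reference state. -/
lemma exists_leakage_reference {R Rh L : Type} [Fintype R] [DecidableEq R] [Fintype Rh]
    [DecidableEq Rh] [Fintype L] [DecidableEq L] [Nonempty L]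
    {Φ : Matrix R R ℂ →ₗ[ℂ] Matrix (Rh × L) (Rh × L) ℂ} (hΦ : IsCPTP Φ) {α p ξ ε : ℝ} (hα : 1 < α)
    (hp : p = (α - 1) / α)
    (hξ : ξ = sSup {x : ℝ | ∃ ω : Matrix (R × R) (R × R) ℂ, IsState ω ∧
      x = (Idown α (traceOut (eXi R Rh L) (lext Φ ω))).toReal}) (hε : 0 < ε)
    {ω : Matrix (R × R) (R × R) ℂ} (hω : IsState ω) :
    ∃ σ : Matrix L L ℂ, IsState σ ∧
      pw (ptB ω ⊗ₖ σ) 0 * lext (ptALin Rh L ∘ₗ Φ) ω * pw (ptB ω ⊗ₖ σ) 0 = lext (ptALin Rh L ∘ₗ Φ) ω ∧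
      trp α (pw (ptB ω ⊗ₖ σ) ((-p / 2 : ℝ) : ℂ) * lext (ptALin Rh L ∘ₗ Φ) ω *
        pw (ptB ω ⊗ₖ σ) ((-p / 2 : ℝ) : ℂ)) ≤ 2 ^ ((α - 1) * (ξ + ε)) := by
  have hΨ := hΦ.ptALin_comp
  set Ψ := ptALin Rh L ∘ₗ Φ with hΨe
  simp only [traceOut_eXi_lext, ← hΨe] at hξ
  set B := (α - 1)⁻¹ * Real.logb 2 (max 1 (((Fintype.card L : ℝ) ^ p * Fintype.card R) ^ α))
  have hB0 : 0 ≤ B := mul_nonneg (inv_nonneg.2 (by linarith))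
    (Real.logb_nonneg (by norm_num) (le_max_left _ _))
  have hbdd : BddAbove {x : ℝ | ∃ ω : Matrix (R × R) (R × R) ℂ, IsState ω ∧
      x = (Idown α (lext Ψ ω)).toReal} := by
    refine ⟨B, ?_⟩
    rintro x ⟨ω, hω, rfl⟩
    have h1 := Idown_le hα hp (hΨ.isState_lext hω)
    by_cases h2 : Idown α (lext Ψ ω) = ⊥
    · rw [h2, EReal.toReal_bot]; exact hB0
    · exact_mod_cast (EReal.toReal_le_toReal h1 h2 (EReal.coe_ne_top _))
  have h1 : Idown α (lext Ψ ω) < ((ξ + ε : ℝ) : EReal) := by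
    by_cases h2 : Idown α (lext Ψ ω) = ⊥
    · rw [h2]; exact EReal.bot_lt_coe _
    · have h3 : Idown α (lext Ψ ω) ≠ ⊤ := fun h => by
        have := Idown_le hα hp (hΨ.isState_lext hω)
        rw [h, top_le_iff] at this
        exact EReal.coe_ne_top _ this
      rw [← EReal.coe_toReal h3 h2, EReal.coe_lt_coe_iff]
      have : (Idown α (lext Ψ ω)).toReal ≤ ξ := by
        rw [hξ]; exact le_csSup hbdd ⟨ω, hω, rfl⟩
      linarith
  obtain ⟨x, ⟨σ, hσ, rfl⟩, hx⟩ := sInf_lt_iff.1 h1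
  have hs : suppSubset (lext Ψ ω) (ptB (lext Ψ ω) ⊗ₖ σ) := by
    by_contra hcon
    unfold D at hx
    rw [if_neg (by rintro (h | h); exacts [absurd h.1 (by linarith), hcon h])] at hx
    exact not_top_lt hx
  rw [D_of_suppSubset hs, EReal.coe_lt_coe_iff] at hx
  have hst := hΨ.isState_lext hω
  have hP := (ptB_isState hst).1.kronecker hσ.1
  refine ⟨σ, hσ, ?_, ?_⟩
  · have := pw_zero_sandwich_eq hst.1.1 (mul_pw_zero_of_suppSubset hP hs)
    rwa [ptB_lext hΨ] at this
  · have := trp_le_of_DR_lt hα hp hst hP hx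
    rwa [ptB_lext hΨ] at this

lemma trp_sandwich_pos {T X : Matrix Q Q ℂ} (hT : T.PosDef) (hX : X.PosSemidef) (hX0 : X ≠ 0) {α : ℝ}
    (hα : α ≠ 0) (s : ℝ) : 0 < trp α (pw T (s : ℂ) * X * pw T (s : ℂ)) := by
  have h0 := hX.mul_mul_conjTranspose_same (pw T (s : ℂ))
  rw [pw_conjTranspose_ofReal] at h0
  refine (trp_nonneg _ _).lt_of_ne fun h => hX0 ?_
  have h1 := trp_eq_zero h0 hα h.symm
  have h2 : pw T ((-s : ℝ) : ℂ) * (pw T (s : ℂ) * X * pw T (s : ℂ)) * pw T ((-s : ℝ) : ℂ) = X := by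
    rw [Matrix.mul_assoc, Matrix.mul_assoc (pw T (s : ℂ) * X), pw_mul, ← Complex.ofReal_add,
      ← Matrix.mul_assoc, ← Matrix.mul_assoc, pw_mul, ← Complex.ofReal_add]
    simp [pw_zero_of_posDef hT]
  rw [← h2, h1]; simp

theorem leak_bound {R Rh L : Type} [Fintype R] [DecidableEq R] [Fintype Rh]
    [DecidableEq Rh] [Fintype L] [DecidableEq L] [Nonempty L]
    {Φ : Matrix R R ℂ →ₗ[ℂ] Matrix (Rh × L) (Rh × L) ℂ} (hΦ : IsCPTP Φ)
    {ρ : κ → Matrix (Q × R) (Q × R) ℂ} {T : κ → Matrix Q Q ℂ} {w : κ → ℝ} {α p ξ ε : ℝ} (hα : 1 < α)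
    (hp : p = (α - 1) / α)
    (hξ : ξ = sSup {x : ℝ | ∃ ω : Matrix (R × R) (R × R) ℂ, IsState ω ∧
      x = (Idown α (traceOut (eXi R Rh L) (lext Φ ω))).toReal}) (hε : 0 < ε)
    (hρ : ∀ c, (ρ c).PosSemidef) (hρ0 : ∃ c, ρ c ≠ 0) (hT : ∀ c, (T c).PosDef) (hw : ∀ c, 0 < w c) :
    ∃ σ : Matrix L L ℂ, IsState σ ∧ ∀ σ' : Matrix L L ℂ, (σ' - σ).PosSemidef →
      ∑ c, w c ^ (α - 1) * trp α (pw (T c ⊗ₖ σ') ((-p / 2 : ℝ) : ℂ) *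
        lext (ptALin Rh L ∘ₗ Φ) (ρ c) * pw (T c ⊗ₖ σ') ((-p / 2 : ℝ) : ℂ)) ≤
      2 ^ ((α - 1) * (ξ + ε)) * ∑ c, w c ^ (α - 1) *
        trp α (pw (T c) ((-p / 2 : ℝ) : ℂ) * ptB (ρ c) * pw (T c) ((-p / 2 : ℝ) : ℂ)) := by
  have hΨ := hΦ.ptALin_comp
  refine leak_bound_of_pos hα hp hρ hT hw (fun c => hΨ.lext_posSemidef (hρ c))
    (fun ω hω => ⟨(hΨ.isState_lext hω).1, exists_leakage_reference hΦ hα hp hξ hε hω⟩) ?_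
  obtain ⟨c, hc⟩ := hρ0
  refine Finset.sum_pos' (fun c _ => mul_nonneg (Real.rpow_nonneg (hw c).le _) (trp_nonneg _ _))
    ⟨c, Finset.mem_univ _, mul_pos (Real.rpow_pos_of_pos (hw c) _)
      (trp_sandwich_pos (hT c) (ptB_posSemidef (hρ c)) (fun h => hc ?_) (by linarith) _)⟩
  refine eq_zero_of_trace (hρ c) ?_
  rw [← ptB_trace, h]; simp

end LeakageCondition

section RoundOutput

variable {ι A X S Cb Ch R' E' g : Type*} [Fintype ι] [Fintype A] [DecidableEq A] [Fintype X]
  [DecidableEq X] [Fintype S] [DecidableEq S] [Fintype Cb] [DecidableEq Cb] [Fintype Ch]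
  [DecidableEq Ch] [Fintype R'] [DecidableEq R'] [Fintype E'] [DecidableEq E'] [Fintype g]

lemma pw_zero_mul_of_le {a b : Type*} [Fintype a] [DecidableEq a] [Fintype b] {ι : Type*} (s : Finset ι)
    {ν : Matrix a a ℂ} (hν : ν.PosSemidef) {F : ι → Matrix a b ℂ}
    (h : (ν - ∑ k ∈ s, F k * (F k)ᴴ).PosSemidef) {k : ι} (hk : k ∈ s) : pw ν 0 * F k = F k := by
  have h1 := sum_hs_mul_le s h (1 - pw ν 0)
  have h2 : (1 - pw ν 0) * ν = 0 := by
    have := congrArg conjTranspose (mul_pw_zero hν)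
    rw [conjTranspose_mul, pw_conjTranspose, star_zero, hν.1.eq] at this
    rw [Matrix.sub_mul, this, Matrix.one_mul, sub_self]
  rw [h2, Matrix.zero_mul, trace_zero, Complex.zero_re] at h1
  have h3 : hs ((1 - pw ν 0) * F k) = 0 :=
    le_antisymm ((Finset.single_le_sum (f := fun k => hs ((1 - pw ν 0) * F k))
      (fun i _ => hs_nonneg _) hk).trans h1) (hs_nonneg _)
  have h4 := hs_eq_zero h3
  rw [Matrix.sub_mul, Matrix.one_mul, sub_eq_zero] at h4
  exact h4.symm

/-- The block on `S E' A` of the output of a round for the classical value `c`. -/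
def blk (N : Matrix X X ℂ →ₗ[ℂ] Matrix ((S × (Cb × Ch)) × (R' × E')) ((S × (Cb × Ch)) × (R' × E')) ℂ)
    (ρ : Matrix (A × X) (A × X) ℂ) (c : Cb × Ch) : Matrix (S × (E' × A)) (S × (E' × A)) ℂ :=
  of fun x y => ∑ r', lext N ρ (x.2.2, ((x.1, c), (r', x.2.1))) (y.2.2, ((y.1, c), (r', y.2.1)))

/-- The block on `E' A` of the output of a round for the public classical value `ch`. -/
def qblk (N : Matrix X X ℂ →ₗ[ℂ] Matrix ((S × (Cb × Ch)) × (R' × E')) ((S × (Cb × Ch)) × (R' × E')) ℂ)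
    (ρ : Matrix (A × X) (A × X) ℂ) (ch : Ch) : Matrix (E' × A) (E' × A) ℂ :=
  ∑ cb, ptA (blk N ρ (cb, ch))

/-- The pieces of a factor of the output of a round, given Kraus operators and a factor of the input. -/
def outFactor (K : ι → Matrix ((S × (Cb × Ch)) × (R' × E')) X ℂ) (c : Cb × Ch) (s : S)
    (n : Matrix (A × X) g ℂ) : Matrix (E' × A) ((ι × R') × g) ℂ :=
  of fun i j => (((1 : Matrix A A ℂ) ⊗ₖ K j.1.1) * n) (i.2, ((s, c), (j.1.2, i.1))) j.2

lemma blk_eq_stk {N : Matrix X X ℂ →ₗ[ℂ] Matrix ((S × (Cb × Ch)) × (R' × E')) ((S × (Cb × Ch)) × (R' × E')) ℂ}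
    {K : ι → Matrix ((S × (Cb × Ch)) × (R' × E')) X ℂ} (hK : ∀ ρ, N ρ = ∑ k, K k * ρ * (K k)ᴴ)
    (n : Matrix (A × X) g ℂ) (c : Cb × Ch) :
    blk N (n * nᴴ) c = (stk fun s => outFactor K c s n) * (stk fun s => outFactor K c s n)ᴴ := by
  ext ⟨s, e, a⟩ ⟨s', e', a'⟩
  have h : ∀ k, ((1 : Matrix A A ℂ) ⊗ₖ K k) * (n * nᴴ) * ((1 : Matrix A A ℂ) ⊗ₖ K k)ᴴ =
      (((1 : Matrix A A ℂ) ⊗ₖ K k) * n) * (((1 : Matrix A A ℂ) ⊗ₖ K k) * n)ᴴ := by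
    intro k; rw [conjTranspose_mul]; simp only [Matrix.mul_assoc]
  simp only [blk, of_apply, lext_kraus hK, Matrix.sum_apply, h]
  rw [mul_apply, Fintype.sum_prod_type, Fintype.sum_prod_type, Finset.sum_comm]
  refine Finset.sum_congr rfl fun k _ => Finset.sum_congr rfl fun r _ => ?_
  rw [mul_apply]
  rfl

lemma qblk_eq_sum {N : Matrix X X ℂ →ₗ[ℂ] Matrix ((S × (Cb × Ch)) × (R' × E')) ((S × (Cb × Ch)) × (R' × E')) ℂ}
    {K : ι → Matrix ((S × (Cb × Ch)) × (R' × E')) X ℂ} (hK : ∀ ρ, N ρ = ∑ k, K k * ρ * (K k)ᴴ)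
    (n : Matrix (A × X) g ℂ) (ch : Ch) :
    qblk N (n * nᴴ) ch = ∑ k : (Cb × Ch) × S with k.1.2 = ch,
      outFactor K k.1 k.2 n * (outFactor K k.1 k.2 n)ᴴ := by
  have h : ∀ c, ptA (blk N (n * nᴴ) c) = ∑ s, outFactor K c s n * (outFactor K c s n)ᴴ := by
    intro c
    rw [blk_eq_stk hK]
    ext i j
    simp only [ptA, of_apply, Matrix.sum_apply, mul_apply]
    rfl
  simp only [qblk, h]
  rw [Finset.sum_filter, Fintype.sum_prod_type, Fintype.sum_prod_type]
  refine Finset.sum_congr rfl fun cb _ => ?_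
  rw [Finset.sum_eq_single ch]
  · simp
  · intro b _ hb; simp [hb]
  · simp

lemma qblk_posSemidef {N : Matrix X X ℂ →ₗ[ℂ] Matrix ((S × (Cb × Ch)) × (R' × E')) ((S × (Cb × Ch)) × (R' × E')) ℂ}
    (hN : IsCPTP N) {ρ : Matrix (A × X) (A × X) ℂ} (hρ : ρ.PosSemidef) (ch : Ch) :
    (qblk N ρ ch).PosSemidef := by
  obtain ⟨K, hK, -⟩ := hN.exists_kraus
  obtain ⟨n, rfl⟩ := exists_sqrt_factor hρ
  rw [qblk_eq_sum hK]
  exact posSemidef_sum _ fun k _ => posSemidef_self_mul_conjTranspose _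

lemma blk_posSemidef {N : Matrix X X ℂ →ₗ[ℂ] Matrix ((S × (Cb × Ch)) × (R' × E')) ((S × (Cb × Ch)) × (R' × E')) ℂ}
    (hN : IsCPTP N) {ρ : Matrix (A × X) (A × X) ℂ} (hρ : ρ.PosSemidef) (c : Cb × Ch) :
    (blk N ρ c).PosSemidef := by
  obtain ⟨K, hK, -⟩ := hN.exists_kraus
  obtain ⟨n, rfl⟩ := exists_sqrt_factor hρ
  rw [blk_eq_stk hK]
  exact posSemidef_self_mul_conjTranspose _

lemma one_kronecker_pw_qblk_mul_blk {N : Matrix X X ℂ →ₗ[ℂ] Matrix ((S × (Cb × Ch)) × (R' × E')) ((S × (Cb × Ch)) × (R' × E')) ℂ}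
    (hN : IsCPTP N) {ρ : Matrix (A × X) (A × X) ℂ} (hρ : ρ.PosSemidef) (c : Cb × Ch) :
    ((1 : Matrix S S ℂ) ⊗ₖ pw (qblk N ρ c.2) 0) * blk N ρ c = blk N ρ c := by
  obtain ⟨K, hK, -⟩ := hN.exists_kraus
  have hq := qblk_posSemidef hN hρ c.2
  obtain ⟨n, rfl⟩ := exists_sqrt_factor hρ
  have h : ∀ s, pw (qblk N (n * nᴴ) c.2) 0 * outFactor K c s n = outFactor K c s n := by
    intro s
    refine pw_zero_mul_of_le (Finset.univ.filter fun k : (Cb × Ch) × S => k.1.2 = c.2) hq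
      (F := fun k => outFactor K k.1 k.2 n) ?_ (k := (c, s)) (by simp)
    rw [← qblk_eq_sum hK, sub_self]
    exact PosSemidef.zero
  rw [blk_eq_stk hK, ← Matrix.mul_assoc, one_kronecker_mul_stk]
  simp only [h]

lemma sum_trace_qblk {N : Matrix X X ℂ →ₗ[ℂ] Matrix ((S × (Cb × Ch)) × (R' × E')) ((S × (Cb × Ch)) × (R' × E')) ℂ}
    (hN : IsCPTP N) (ρ : Matrix (A × X) (A × X) ℂ) : ∑ ch, (qblk N ρ ch).trace = ρ.trace := by
  rw [← lext_trace hN]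
  let e : Ch × Cb × (E' × A) × S × R' ≃ A × ((S × (Cb × Ch)) × (R' × E')) :=
    { toFun := fun y => (y.2.2.1.2, ((y.2.2.2.1, (y.2.1, y.1)), (y.2.2.2.2, y.2.2.1.1)))
      invFun := fun x => (x.2.1.2.2, x.2.1.2.1, (x.2.2.2, x.1), x.2.1.1, x.2.2.1)
      left_inv := fun _ => rfl
      right_inv := fun _ => rfl }
  refine Eq.trans ?_ (Fintype.sum_equiv e (fun y => lext N ρ (e y) (e y)) (fun x => lext N ρ x x)
    (fun _ => rfl))
  rw [Fintype.sum_prod_type]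
  refine Finset.sum_congr rfl fun ch _ => ?_
  rw [Fintype.sum_prod_type, qblk, trace_sum]
  refine Finset.sum_congr rfl fun cb _ => ?_
  rw [Fintype.sum_prod_type]
  refine Finset.sum_congr rfl fun i _ => ?_
  rw [Fintype.sum_prod_type]
  rfl

end RoundOutput

section RoundEntropy

lemma ptA_posSemidef {S B : Type*} [Fintype S] [Fintype B] {Y : Matrix (S × B) (S × B) ℂ}
    (hY : Y.PosSemidef) : (ptA Y).PosSemidef := by
  have : ptA Y = ∑ s, Y.submatrix (fun b => (s, b)) (fun b => (s, b)) := by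
    ext; simp [ptA, Matrix.sum_apply]
  rw [this]
  exact posSemidef_sum _ fun s _ => hY.submatrix _

lemma trace_one_kronecker_mul {S B : Type*} [Fintype S] [DecidableEq S] [Fintype B]
    (P : Matrix B B ℂ) (Y : Matrix (S × B) (S × B) ℂ) :
    (((1 : Matrix S S ℂ) ⊗ₖ P) * Y).trace = (P * ptA Y).trace := by
  simp only [trace, diag_apply, mul_apply, Fintype.sum_prod_type, kroneckerMap_apply, ptA, of_apply,
    Finset.mul_sum, one_apply, ite_mul, one_mul, zero_mul]
  rw [Finset.sum_comm]
  refine Finset.sum_congr rfl fun b _ => ?_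
  conv_rhs => rw [Finset.sum_comm]
  refine Finset.sum_congr rfl fun s _ => ?_
  rw [Finset.sum_eq_single s]
  · simp
  · intro t _ ht; simp [ht.symm]
  · simp

section QES

variable {Q Q' Cb Ch : Type*} [Fintype Q] [DecidableEq Q] [Fintype Q'] [DecidableEq Q'] [Fintype Cb]
  [DecidableEq Cb] [Fintype Ch] [DecidableEq Ch]

/-- The sum inside the logarithm of the QES-entropy, for given blocks. -/
def qesSum (α r : ℝ) (f : Cb → Ch → ℝ) (Y : Cb × Ch → Matrix (Q × Q') (Q × Q') ℂ)
    (ν : Ch → Matrix Q' Q' ℂ) : ℝ :=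
  ∑ c : Cb × Ch, (2 : ℝ) ^ ((α - 1) * f c.1 c.2) *
    trp α (((1 : Matrix Q Q ℂ) ⊗ₖ pw (ν c.2) ((-r / 2 : ℝ) : ℂ)) * Y c *
      ((1 : Matrix Q Q ℂ) ⊗ₖ pw (ν c.2) ((-r / 2 : ℝ) : ℂ)))

lemma qesSum_nonneg (α r : ℝ) (f : Cb → Ch → ℝ) (Y : Cb × Ch → Matrix (Q × Q') (Q × Q') ℂ)
    (ν : Ch → Matrix Q' Q' ℂ) : 0 ≤ qesSum α r f Y ν :=
  Finset.sum_nonneg fun _ _ => mul_nonneg (by positivity) (trp_nonneg _ _)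

lemma one_kronecker_pw_conjTranspose {B : Type*} [Fintype B] [DecidableEq B] (P : Matrix B B ℂ) (s : ℝ) :
    ((1 : Matrix Q Q ℂ) ⊗ₖ pw P (s : ℂ))ᴴ = (1 : Matrix Q Q ℂ) ⊗ₖ pw P (s : ℂ) := by
  rw [conjTranspose_kronecker, conjTranspose_one, pw_conjTranspose_ofReal]

lemma sandwich_one_kronecker_posSemidef {Y : Matrix (Q × Q') (Q × Q') ℂ} (hY : Y.PosSemidef)
    (P : Matrix Q' Q' ℂ) (s : ℝ) : (((1 : Matrix Q Q ℂ) ⊗ₖ pw P (s : ℂ)) * Y *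
      ((1 : Matrix Q Q ℂ) ⊗ₖ pw P (s : ℂ))).PosSemidef := by
  have := hY.mul_mul_conjTranspose_same ((1 : Matrix Q Q ℂ) ⊗ₖ pw P (s : ℂ))
  rwa [one_kronecker_pw_conjTranspose] at this

lemma QESent_eq {α r : ℝ} (hα : 1 < α) (hr : r = (α - 1) / α) (f : Cb → Ch → ℝ)
    {ρ : Matrix ((Q × Q') × (Cb × Ch)) ((Q × Q') × (Cb × Ch)) ℂ}
    {Y : Cb × Ch → Matrix (Q × Q') (Q × Q') ℂ} {ν : Ch → Matrix Q' Q' ℂ}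
    (hY : ∀ c, (Y c).PosSemidef) (hν : ∀ ch, (ν ch).PosSemidef)
    (hρY : ∀ c, (of fun x y => ρ (x, c) (y, c)) = Y c) (hρν : ∀ ch, QprimeBlock ρ ch = ν ch) :
    QESent α f ρ = (1 - α)⁻¹ * Real.logb 2 (qesSum α r f Y ν) := by
  have hα0 : 0 < α := by linarith
  have hs : (1 - α) / (2 * α) = -r / 2 := by rw [hr]; field_simp; ring
  have hs0 : -r / 2 ≠ 0 := by
    rw [hr]; have : 0 < (α - 1) / α := div_pos (by linarith) hα0
    intro h; linarith
  unfold QESent qesSum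
  congr 2
  refine Finset.sum_congr rfl fun c _ => ?_
  rw [hρY, hρν, hs, mpow_eq_pw (hν c.2) hs0,
    mpow_trace_re (sandwich_one_kronecker_posSemidef (hY c) _ _) hα0.ne', neg_sub]

lemma le_QESent {α K x : ℝ} (hα : 1 < α) (hx : 0 ≤ x) (h : K ≤ (1 - α)⁻¹ * Real.logb 2 x) :
    x ≤ 2 ^ (-(α - 1) * K) := by
  rcases hx.eq_or_lt with h0 | h0
  · rw [← h0]; positivity
  · rw [← Real.logb_le_iff_le_rpow (by norm_num) h0]
    have h1 : (1 - α)⁻¹ = -(α - 1)⁻¹ := by rw [← inv_neg]; congr 1; ring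
    rw [h1, neg_mul, ← div_eq_inv_mul] at h
    have h2 : Real.logb 2 x / (α - 1) ≤ -K := by linarith
    rw [div_le_iff₀ (by linarith)] at h2
    linarith

lemma qesSum_le {α r : ℝ} (hα : 1 < α) (hr1 : r < 1) (f : Cb → Ch → ℝ)
    {Y : Cb × Ch → Matrix (Q × Q') (Q × Q') ℂ} (hY : ∀ c, (Y c).PosSemidef)
    (htr : ∑ ch, ∑ cb, (ptA (Y (cb, ch))).trace.re ≤ 1) :
    qesSum α r f Y (fun ch => ∑ cb, ptA (Y (cb, ch))) ≤
      ∑ c : Cb × Ch, (2 : ℝ) ^ ((α - 1) * f c.1 c.2) * (Fintype.card Q' : ℝ) ^ α := by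
  refine Finset.sum_le_sum fun c _ => mul_le_mul_of_nonneg_left ?_ (by positivity)
  set ν := ∑ cb, ptA (Y (cb, c.2)) with hν
  have hνp : ν.PosSemidef := posSemidef_sum _ fun cb _ => ptA_posSemidef (hY _)
  have h0 := sandwich_one_kronecker_posSemidef (hY c) ν (-r / 2)
  refine (trp_le_trace_rpow h0 hα.le).trans (Real.rpow_le_rpow (trace_re_nonneg h0) ?_ (by linarith))
  have h1 : (ν - ptA (Y c)).PosSemidef := by
    rw [hν, ← Finset.sum_erase_add _ _ (Finset.mem_univ c.1), add_sub_cancel_right]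
    exact posSemidef_sum _ fun cb _ => ptA_posSemidef (hY _)
  have h2 := trace_re_nonneg (h1.mul_mul_conjTranspose_same (pw ν ((-r / 2 : ℝ) : ℂ)))
  have h3 : ∀ M, (pw ν ((-r / 2 : ℝ) : ℂ) * M * (pw ν ((-r / 2 : ℝ) : ℂ))ᴴ).trace =
      (pw ν ((-r : ℝ) : ℂ) * M).trace := by
    intro M
    rw [pw_conjTranspose_ofReal, trace_mul_comm, ← Matrix.mul_assoc, pw_mul, ← Complex.ofReal_add]
    ring_nf
  rw [h3, Matrix.mul_sub, trace_sub, Complex.sub_re] at h2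
  rw [trace_mul_comm, ← Matrix.mul_assoc, ← mul_kronecker_mul, Matrix.one_mul, pw_mul,
    ← Complex.ofReal_add, show -r / 2 + -r / 2 = -r by ring, trace_one_kronecker_mul]
  have h4 : pw ν ((-r : ℝ) : ℂ) * ν = pw ν ((1 - r : ℝ) : ℂ) := by
    nth_rewrite 2 [← pw_one hνp]
    rw [pw_mul]; congr 1; push_cast; ring
  rw [h4] at h2
  have h5 : ν.trace.re ≤ 1 := by
    refine le_trans ?_ htr
    rw [hν, trace_sum, Complex.re_sum]
    exact Finset.single_le_sum (f := fun ch => ∑ cb, (ptA (Y (cb, ch))).trace.re)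
      (fun ch _ => Finset.sum_nonneg fun cb _ => trace_re_nonneg (ptA_posSemidef (hY _)))
      (Finset.mem_univ c.2)
  have h6 := trp_le_card hνp h5 (s := 1 - r) (by linarith)
  unfold trp at h6
  linarith

end QES

variable {A A' X S Cb Ch R' E' : Type} [Fintype A] [DecidableEq A] [Fintype A'] [DecidableEq A']
  [Fintype X]
  [DecidableEq X] [Fintype S] [DecidableEq S] [Fintype Cb] [DecidableEq Cb] [Fintype Ch]
  [DecidableEq Ch] [Fintype R'] [DecidableEq R'] [Fintype E'] [DecidableEq E']

lemma blk_sum {ι : Type*} (s : Finset ι)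
    (N : Matrix X X ℂ →ₗ[ℂ] Matrix ((S × (Cb × Ch)) × (R' × E')) ((S × (Cb × Ch)) × (R' × E')) ℂ)
    (ρ : ι → Matrix (A × X) (A × X) ℂ) (c : Cb × Ch) : blk N (∑ i ∈ s, ρ i) c = ∑ i ∈ s, blk N (ρ i) c := by
  ext x y
  simp only [blk, map_sum, Matrix.sum_apply, of_apply]
  rw [Finset.sum_comm]

lemma blk_conj
    (N : Matrix X X ℂ →ₗ[ℂ] Matrix ((S × (Cb × Ch)) × (R' × E')) ((S × (Cb × Ch)) × (R' × E')) ℂ)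
    (K : Matrix A' A ℂ) (ρ : Matrix (A × X) (A × X) ℂ) (c : Cb × Ch) :
    blk N ((K ⊗ₖ (1 : Matrix X X ℂ)) * ρ * (K ⊗ₖ (1 : Matrix X X ℂ))ᴴ) c =
      ((1 : Matrix S S ℂ) ⊗ₖ ((1 : Matrix E' E' ℂ) ⊗ₖ K)) * blk N ρ c *
      ((1 : Matrix S S ℂ) ⊗ₖ ((1 : Matrix E' E' ℂ) ⊗ₖ K))ᴴ := by
  ext ⟨s, e, a⟩ ⟨s', e', a'⟩
  simp only [conjTranspose_kronecker, conjTranspose_one, one_kronecker_conj_apply, blk, of_apply,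
    lext_sandwich, kronecker_one_conj_apply]
  simp only [mul_apply, of_apply, Finset.sum_mul, Finset.mul_sum]
  rw [Finset.sum_comm]
  refine Finset.sum_congr rfl fun i _ => ?_
  rw [Finset.sum_comm]

end RoundEntropy

section RoundEntropy

lemma kronecker_sum {ι a b c d : Type*} (s : Finset ι) (N : Matrix a b ℂ) (P : ι → Matrix c d ℂ) :
    N ⊗ₖ (∑ i ∈ s, P i) = ∑ i ∈ s, N ⊗ₖ P i := by
  ext; simp [kroneckerMap_apply, Matrix.sum_apply, Finset.mul_sum]

lemma ptA_sum {S B ι : Type*} [Fintype S] (s : Finset ι) (Y : ι → Matrix (S × B) (S × B) ℂ) :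
    ptA (∑ i ∈ s, Y i) = ∑ i ∈ s, ptA (Y i) := by
  ext; simp only [ptA, Matrix.sum_apply, of_apply]; rw [Finset.sum_comm]

lemma ptA_conj {S B B' : Type*} [Fintype S] [DecidableEq S] [Fintype B] [DecidableEq B]
    [Fintype B'] [DecidableEq B'] (K : Matrix B' B ℂ)
    (K' : Matrix B B' ℂ) (Y : Matrix (S × B) (S × B) ℂ) :
    ptA (((1 : Matrix S S ℂ) ⊗ₖ K) * Y * ((1 : Matrix S S ℂ) ⊗ₖ K')) = K * ptA Y * K' := by
  ext b b'
  simp only [ptA, of_apply, one_kronecker_conj_apply]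
  simp only [mul_apply, of_apply, Finset.mul_sum, Finset.sum_mul]
  rw [Finset.sum_comm]
  exact Finset.sum_congr rfl fun x _ => Finset.sum_comm

variable {A X S Cb Ch R' E' : Type} [Fintype A] [DecidableEq A] [Fintype X]
  [DecidableEq X] [Fintype S] [DecidableEq S] [Fintype Cb] [DecidableEq Cb] [Fintype Ch]
  [DecidableEq Ch] [Fintype R'] [DecidableEq R'] [Fintype E'] [DecidableEq E']

lemma qesSum_blk_le_of_copy
    {N : Matrix X X ℂ →ₗ[ℂ] Matrix ((S × (Cb × Ch)) × (R' × E')) ((S × (Cb × Ch)) × (R' × E')) ℂ}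
    (hN : IsCPTP N) {α r : ℝ} (hα : 1 < α) (hr : r = (α - 1) / α) (f : Cb → Ch → ℝ)
    {ω : Matrix (X × X) (X × X) ℂ} (hω : IsState ω) :
    qesSum α r f (blk N ω) (qblk N ω) ≤ 2 ^ (-(α - 1) * sInf {x : ℝ | ∃ ω : Matrix (X × X) (X × X) ℂ,
      IsState ω ∧ x = QESent α f (traceOut (eKappa X S Cb Ch R' E') (lext N ω))}) := by
  have hr1 : r < 1 := by rw [hr, div_lt_one (by linarith)]; linarith
  have key : ∀ ω : Matrix (X × X) (X × X) ℂ, IsState ω →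
      QESent α f (traceOut (eKappa X S Cb Ch R' E') (lext N ω)) =
        (1 - α)⁻¹ * Real.logb 2 (qesSum α r f (blk N ω) (qblk N ω)) := by
    intro ω hω
    refine QESent_eq hα hr f (fun c => blk_posSemidef hN hω.1 c) (fun ch => qblk_posSemidef hN hω.1 ch)
      (fun c => rfl) fun ch => ?_
    ext x y
    simp only [qblk, QprimeBlock, Matrix.sum_apply, ptA]
    rfl
  refine le_QESent hα (qesSum_nonneg _ _ _ _ _) ?_
  rw [← key ω hω]
  refine csInf_le ⟨(1 - α)⁻¹ * Real.logb 2 (max 1 (∑ c : Cb × Ch, (2 : ℝ) ^ ((α - 1) * f c.1 c.2) *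
    (Fintype.card (E' × X) : ℝ) ^ α)), ?_⟩ ⟨ω, hω, rfl⟩
  rintro x ⟨ω, hω, rfl⟩
  rw [key ω hω]
  refine mul_le_mul_of_nonpos_left ?_ (inv_nonpos.2 (by linarith))
  have h1 : qesSum α r f (blk N ω) (qblk N ω) ≤ _ :=
    qesSum_le hα hr1 f (fun c => blk_posSemidef hN hω.1 c) (by
      have h := congrArg Complex.re (sum_trace_qblk hN ω)
      rw [hω.2, Complex.one_re, Complex.re_sum] at h
      rw [← h]
      refine Finset.sum_le_sum fun ch _ => ?_
      rw [qblk, trace_sum, Complex.re_sum])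
  rcases (qesSum_nonneg α r f (blk N ω) (qblk N ω)).eq_or_lt with h0 | h0
  · rw [← h0, Real.logb_zero]
    exact Real.logb_nonneg (by norm_num) (le_max_left _ _)
  · exact Real.logb_le_logb_of_le (by norm_num) h0 (h1.trans (le_max_right _ _))

lemma qesSum_blk_le
    {N : Matrix X X ℂ →ₗ[ℂ] Matrix ((S × (Cb × Ch)) × (R' × E')) ((S × (Cb × Ch)) × (R' × E')) ℂ}
    (hN : IsCPTP N) {α r : ℝ} (hα : 1 < α) (hr : r = (α - 1) / α) (f : Cb → Ch → ℝ)
    {ρ : Matrix (A × X) (A × X) ℂ} (hρ : IsState ρ) :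
    qesSum α r f (blk N ρ) (qblk N ρ) ≤ 2 ^ (-(α - 1) * sInf {x : ℝ | ∃ ω : Matrix (X × X) (X × X) ℂ,
      IsState ω ∧ x = QESent α f (traceOut (eKappa X S Cb Ch R' E') (lext N ω))}) := by
  obtain ⟨ω, K', hω, hK', hK1'⟩ := exists_purified_family (κ := Unit) (ω := fun _ => ρ) (fun _ => hρ.1)
    (by simp [hρ.2])
  set K : A × X → Matrix A X ℂ := fun g => K' ((), g) with hK
  have hρK : ρ = ∑ g, (K g ⊗ₖ (1 : Matrix X X ℂ)) * ω * (K g ⊗ₖ (1 : Matrix X X ℂ))ᴴ := hK' ()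
  have hK1 : (1 - ∑ g, (K g)ᴴ * K g).PosSemidef := by
    have : ∑ k, (K' k)ᴴ * K' k = ∑ g, (K g)ᴴ * K g := by
      rw [Fintype.sum_prod_type]; simp [hK]
    rwa [this] at hK1'
  refine le_trans ?_ (qesSum_blk_le_of_copy hN hα hr f hω)
  refine Finset.sum_le_sum fun c _ => mul_le_mul_of_nonneg_left ?_ (by positivity)
  set G : A × X → Matrix (S × (E' × A)) (S × (E' × X)) ℂ := fun g =>
    (1 : Matrix S S ℂ) ⊗ₖ ((1 : Matrix E' E' ℂ) ⊗ₖ K g) with hG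
  have hblk : ∀ c, blk N ρ c = ∑ g, G g * blk N ω c * (G g)ᴴ := by
    intro c
    rw [hρK, blk_sum]
    exact Finset.sum_congr rfl fun g _ => blk_conj N (K g) ω c
  have hq : qblk N ρ c.2 = ∑ g, ((1 : Matrix E' E' ℂ) ⊗ₖ K g) * qblk N ω c.2 *
      ((1 : Matrix E' E' ℂ) ⊗ₖ K g)ᴴ := by
    have h2 : ∀ (g : A × X) (Y : Matrix (S × (E' × X)) (S × (E' × X)) ℂ),
        ptA (G g * Y * (G g)ᴴ) = ((1 : Matrix E' E' ℂ) ⊗ₖ K g) * ptA Y *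
        ((1 : Matrix E' E' ℂ) ⊗ₖ K g)ᴴ := by
      intro g Y
      rw [hG, conjTranspose_kronecker, conjTranspose_one, ptA_conj]
    simp only [qblk, hblk, ptA_sum, h2]
    rw [Finset.sum_comm]
    refine Finset.sum_congr rfl fun g _ => ?_
    rw [Matrix.mul_sum, Matrix.sum_mul]
  have hν0 := qblk_posSemidef hN hω.1 c.2
  have hν := qblk_posSemidef hN hρ.1 c.2
  set ν0 := qblk N ω c.2
  set ν := qblk N ρ c.2
  have hs0 : ((1 : Matrix S S ℂ) ⊗ₖ ν0).PosSemidef := PosSemidef.one.kronecker hν0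
  have hs1 : ((1 : Matrix S S ℂ) ⊗ₖ ν).PosSemidef := PosSemidef.one.kronecker hν
  set X0 := ((1 : Matrix S S ℂ) ⊗ₖ pw ν0 ((-r / 2 : ℝ) : ℂ)) * blk N ω c *
    ((1 : Matrix S S ℂ) ⊗ₖ pw ν0 ((-r / 2 : ℝ) : ℂ)) with hX0
  have hX0p : X0.PosSemidef := sandwich_one_kronecker_posSemidef (blk_posSemidef hN hω.1 c) _ _
  have hGG : (1 - ∑ g, (G g)ᴴ * G g).PosSemidef := by
    have : (1 - ∑ g, (G g)ᴴ * G g) = (1 : Matrix S S ℂ) ⊗ₖ ((1 : Matrix E' E' ℂ) ⊗ₖ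
        (1 - ∑ g, (K g)ᴴ * K g)) := by
      rw [kronecker_sub, kronecker_sub, one_kronecker_one, one_kronecker_one, kronecker_sum,
        kronecker_sum]
      simp only [hG, conjTranspose_kronecker, conjTranspose_one, ← mul_kronecker_mul, Matrix.one_mul]
    rw [this]
    exact PosSemidef.one.kronecker (PosSemidef.one.kronecker hK1)
  have hdp := sum_trp_data_processing (γ := Unit) (fun _ => ()) (σ' := fun _ => (1 : Matrix S S ℂ) ⊗ₖ ν)
    hα hr hGG hs0 (fun _ => hs1) (fun _ => by
      have : (1 : Matrix S S ℂ) ⊗ₖ ν = ∑ g, G g * ((1 : Matrix S S ℂ) ⊗ₖ ν0) * (G g)ᴴ := by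
        rw [hq, kronecker_sum]
        simp only [hG, conjTranspose_kronecker, conjTranspose_one, ← mul_kronecker_mul,
          Matrix.mul_one]
      simp only [Finset.filter_true, this, sub_self]
      exact PosSemidef.zero) hX0p
  refine le_trans (le_of_eq ?_) hdp
  have hb1 := one_kronecker_pw_qblk_mul_blk hN hω.1 c
  have hb2 := congrArg conjTranspose hb1
  rw [conjTranspose_mul, (blk_posSemidef hN hω.1 c).1.eq, conjTranspose_kronecker, conjTranspose_one,
    pw_conjTranspose, star_zero] at hb2
  have hmid : pw ((1 : Matrix S S ℂ) ⊗ₖ ν0) ((r / 2 : ℝ) : ℂ) * X0 *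
      pw ((1 : Matrix S S ℂ) ⊗ₖ ν0) ((r / 2 : ℝ) : ℂ) = blk N ω c := by
    rw [pw_one_kronecker hν0.1, hX0]
    have e1 : pw ν0 ((r / 2 : ℝ) : ℂ) * pw ν0 ((-r / 2 : ℝ) : ℂ) = pw ν0 0 := by
      rw [pw_mul, ← Complex.ofReal_add]; congr 1; push_cast; ring
    have e2 : pw ν0 ((-r / 2 : ℝ) : ℂ) * pw ν0 ((r / 2 : ℝ) : ℂ) = pw ν0 0 := by
      rw [pw_mul, ← Complex.ofReal_add]; congr 1; push_cast; ring
    simp only [← Matrix.mul_assoc]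
    rw [← mul_kronecker_mul, Matrix.one_mul, e1, Matrix.mul_assoc _ _ (_ ⊗ₖ _),
      ← mul_kronecker_mul, Matrix.one_mul, e2, hb1, hb2]
  simp only [Finset.univ_unique, Finset.sum_singleton, Finset.filter_true]
  congr 1
  rw [hblk c, pw_one_kronecker hν.1, Finset.mul_sum, Finset.sum_mul]
  refine Finset.sum_congr rfl fun g _ => ?_
  rw [← hmid]
  simp only [Matrix.mul_assoc]

end RoundEntropy

section RoundChain

variable {A Rh L E S Cb Ch R' E' g : Type} [Fintype A] [DecidableEq A] [Fintype Rh]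
  [DecidableEq Rh] [Fintype L] [DecidableEq L] [Fintype E] [DecidableEq E] [Fintype S] [DecidableEq S]
  [Fintype Cb] [DecidableEq Cb] [Fintype Ch]
  [DecidableEq Ch] [Fintype R'] [DecidableEq R'] [Fintype E'] [DecidableEq E'] [Fintype g]

/-- The partial trace over `R̂` of a state on `A ((R̂ L) E)`. -/
def rtr (ρ : Matrix (A × ((Rh × L) × E)) (A × ((Rh × L) × E)) ℂ) : Matrix (A × (L × E)) (A × (L × E)) ℂ :=
  of fun x y => ∑ r, ρ (x.1, ((r, x.2.1), x.2.2)) (y.1, ((r, y.2.1), y.2.2))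

/-- Moving the register `R̂` from the columns to the rows of a matrix. -/
def rowMove (m : Matrix (A × (L × E)) (Rh × g) ℂ) : Matrix (A × ((Rh × L) × E)) g ℂ :=
  of fun x j => m (x.1, (x.2.1.2, x.2.2)) (x.2.1.1, j)

omit [Fintype A] [DecidableEq A] [DecidableEq Rh] [Fintype L] [DecidableEq L] [Fintype E] [DecidableEq E] in
lemma rtr_rowMove (m : Matrix (A × (L × E)) (Rh × g) ℂ) : rtr (rowMove m * (rowMove m)ᴴ) = m * mᴴ := by
  ext x y
  simp only [rtr, of_apply, mul_apply, Fintype.sum_prod_type]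
  rfl

omit [DecidableEq A] [DecidableEq Rh] [DecidableEq L] [DecidableEq E] in
lemma rtr_trace (ρ : Matrix (A × ((Rh × L) × E)) (A × ((Rh × L) × E)) ℂ) : (rtr ρ).trace = ρ.trace := by
  simp only [rtr, trace, diag_apply, of_apply, Fintype.sum_prod_type]
  refine Finset.sum_congr rfl fun a _ => ?_
  simp only [Finset.sum_comm (s := (Finset.univ : Finset E)) (t := (Finset.univ : Finset Rh))]
  rw [Finset.sum_comm]

lemma qblk_eq_of_nonsignalling
    {N : Matrix ((Rh × L) × E) ((Rh × L) × E) ℂ →ₗ[ℂ]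
      Matrix ((S × (Cb × Ch)) × (R' × E')) ((S × (Cb × Ch)) × (R' × E')) ℂ}
    {Q : Matrix (L × E) (L × E) ℂ →ₗ[ℂ] Matrix (E' × Ch) (E' × Ch) ℂ}
    (hNS : ∀ τ, traceOut (eNSout S Cb Ch R' E') (N τ) = Q (traceOut (eNSin Rh L E) τ))
    (ρ : Matrix (A × ((Rh × L) × E)) (A × ((Rh × L) × E)) ℂ) (ch : Ch) :
    qblk N ρ ch = (lext Q (rtr ρ)).submatrix (fun x : E' × A => (x.2, (x.1, ch)))
      (fun x : E' × A => (x.2, (x.1, ch))) := by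
  ext ⟨e, a⟩ ⟨e', a'⟩
  have h := congrFun (congrFun (hNS (of fun x x' => ρ (a, x) (a', x'))) (e, ch)) (e', ch)
  refine Eq.trans ?_ h
  simp only [traceOut, of_apply, Fintype.sum_prod_type, qblk, Matrix.sum_apply, ptA, blk]
  rw [Finset.sum_comm]
  rfl

omit [Fintype A] [Fintype L] [DecidableEq L] [Fintype E] [DecidableEq E] [Fintype Ch] [DecidableEq Ch]
  [Fintype E'] [DecidableEq E'] in
lemma lext_one_kronecker_apply {x y : Type*} (Q : Matrix x x ℂ →ₗ[ℂ] Matrix y y ℂ) (τ : Matrix x x ℂ)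
    (u v : A × y) : lext Q ((1 : Matrix A A ℂ) ⊗ₖ τ) u v = (1 : Matrix A A ℂ) u.1 v.1 * Q τ u.2 v.2 := by
  have : (of fun a a' => ((1 : Matrix A A ℂ) ⊗ₖ τ) (u.1, a) (v.1, a')) = (1 : Matrix A A ℂ) u.1 v.1 • τ := by
    ext; simp [kroneckerMap_apply]
  change Q (of fun a a' => ((1 : Matrix A A ℂ) ⊗ₖ τ) (u.1, a) (v.1, a')) u.2 v.2 = _
  rw [this, _root_.map_smul, Matrix.smul_apply, smul_eq_mul]

/-- The accumulation of one round of a non-signalling channel. -/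
theorem round_chain
    {N : Matrix ((Rh × L) × E) ((Rh × L) × E) ℂ →ₗ[ℂ]
      Matrix ((S × (Cb × Ch)) × (R' × E')) ((S × (Cb × Ch)) × (R' × E')) ℂ} (hN : IsCPTP N)
    {Q : Matrix (L × E) (L × E) ℂ →ₗ[ℂ] Matrix (E' × Ch) (E' × Ch) ℂ} (hQ : IsCPTP Q)
    (hNS : ∀ τ, traceOut (eNSout S Cb Ch R' E') (N τ) = Q (traceOut (eNSin Rh L E) τ))
    {α p : ℝ} (hα : 1 < α) (hα2 : α < 2) (hp : p = (α - 1) / α)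
    {τ : Matrix (L × E) (L × E) ℂ} (hτ : τ.PosDef) {τ' : Ch → Matrix E' E' ℂ}
    (hτ' : ∀ ch, (τ' ch).PosSemidef)
    (hτQ : ∀ ch, (τ' ch - (Q τ).submatrix (fun e => (e, ch)) (fun e => (e, ch))).PosSemidef)
    (f : Cb → Ch → ℝ) {K : ℝ} (hK : K = sInf {x : ℝ | ∃ ω : Matrix (((Rh × L) × E) × ((Rh × L) × E))
        (((Rh × L) × E) × ((Rh × L) × E)) ℂ, IsState ω ∧
      x = QESent (1 / (2 - α)) f (traceOut (eKappa ((Rh × L) × E) S Cb Ch R' E') (lext N ω))})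
    {ρ : Matrix (A × ((Rh × L) × E)) (A × ((Rh × L) × E)) ℂ} (hρ : ρ.PosSemidef) :
    qesSum α p f (blk N ρ) (fun ch => τ' ch ⊗ₖ (1 : Matrix A A ℂ)) ≤
      2 ^ (-(α - 1) * K) * trp α (pw ((1 : Matrix A A ℂ) ⊗ₖ τ) ((-p / 2 : ℝ) : ℂ) * rtr ρ *
        pw ((1 : Matrix A A ℂ) ⊗ₖ τ) ((-p / 2 : ℝ) : ℂ)) := by
  obtain ⟨M, hM, -⟩ := hN.exists_kraus
  obtain ⟨n, hn⟩ := exists_sqrt_factor hρ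
  have hd : 0 < 2 - α := by linarith
  have hα' : 1 < 1 / (2 - α) := by rw [lt_div_iff₀ hd]; linarith
  have hr' : α - 1 = (1 / (2 - α) - 1) / (1 / (2 - α)) := by field_simp; ring
  let Γ : (Cb × Ch) × S → Matrix (A × (L × E)) (Rh × (A × ((Rh × L) × E))) ℂ →ₗ[ℂ]
      Matrix (E' × A) ((_ × R') × (A × ((Rh × L) × E))) ℂ := fun k =>
    { toFun := fun m => outFactor M k.1 k.2 (rowMove m)
      map_add' := fun x y => by
        ext i j
        simp only [outFactor, of_apply, mul_apply, rowMove, Matrix.add_apply, mul_add,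
          Finset.sum_add_distrib]
      map_smul' := fun c x => by
        ext i j
        simp only [outFactor, of_apply, mul_apply, rowMove, Matrix.smul_apply, smul_eq_mul, RingHom.id_apply,
          Finset.mul_sum]
        exact Finset.sum_congr rfl fun _ _ => by ring }
  set m : Matrix (A × (L × E)) (Rh × (A × ((Rh × L) × E))) ℂ :=
    of fun x j => n (x.1, ((j.1, x.2.1), x.2.2)) j.2
  have hnm : n = rowMove m := rfl
  have ht : ((1 : Matrix A A ℂ) ⊗ₖ τ).PosDef := PosDef.one.kronecker hτ
  have hstk : ∀ (P : Matrix (E' × A) (E' × A) ℂ) (s : ℝ) (c : Cb × Ch)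
      (m : Matrix (A × (L × E)) (Rh × (A × ((Rh × L) × E))) ℂ),
      (stk fun s' => pw P (s : ℂ) * Γ (c, s') m) * (stk fun s' => pw P (s : ℂ) * Γ (c, s') m)ᴴ =
        ((1 : Matrix S S ℂ) ⊗ₖ pw P (s : ℂ)) * blk N (rowMove m * (rowMove m)ᴴ) c *
          ((1 : Matrix S S ℂ) ⊗ₖ pw P (s : ℂ)) := by
    intro P s c m
    rw [← one_kronecker_mul_stk, conjTranspose_mul, one_kronecker_pw_conjTranspose, blk_eq_stk hM]
    simp only [Matrix.mul_assoc]
    rfl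
  have : DecidableEq (((Fin (Fintype.card ((Rh × L) × E)) × (S × Cb × Ch) × R' × E') × R') ×
    (A × ((Rh × L) × E))) := Classical.decEq _
  have key := chain_bound (π := Prod.snd) Γ (t := (1 : Matrix A A ℂ) ⊗ₖ τ)
    (T := fun ch => τ' ch ⊗ₖ (1 : Matrix A A ℂ)) (w := fun c => 2 ^ f c.1 c.2) (L := 2 ^ (-(α - 1) * K))
    hα hα2 hp (by positivity) ht (fun ch => (hτ' ch).kronecker PosSemidef.one) (fun k => by positivity)
    ?_ ?_ m
  · refine (le_of_eq ?_).trans (key.trans (le_of_eq ?_))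
    · refine Finset.sum_congr rfl fun c _ => ?_
      rw [hstk, ← hnm, ← hn, ← Real.rpow_mul (by norm_num), mul_comm (f _ _)]
    · congr 2
      rw [conjTranspose_mul, pw_conjTranspose_ofReal, hn, hnm, rtr_rowMove]
      simp only [Matrix.mul_assoc]
  · intro m h ch
    have h1 := (hQ.lext_posSemidef h).submatrix (fun x : E' × A => (x.2, (x.1, ch)))
    have h2 := ((hτQ ch).kronecker (PosSemidef.one (n := A) (R := ℂ))).add h1
    have h3 : ∑ k : (Cb × Ch) × S with k.1.2 = ch, Γ k m * (Γ k m)ᴴ =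
      qblk N (rowMove m * (rowMove m)ᴴ) ch := (qblk_eq_sum hM _ ch).symm
    rw [h3]
    refine Eq.mpr (congrArg Matrix.PosSemidef ?_) h2
    rw [qblk_eq_of_nonsignalling hNS, rtr_rowMove, map_sub]
    ext ⟨e, a⟩ ⟨e', a'⟩
    simp only [Matrix.sub_apply, Matrix.add_apply, submatrix_apply, kroneckerMap_apply,
      lext_one_kronecker_apply]
    ring
  · intro m hm1
    have hst : IsState (rowMove m * (rowMove m)ᴴ) := by
      refine ⟨posSemidef_self_mul_conjTranspose _, ?_⟩
      rw [← rtr_trace, rtr_rowMove, trace_mul_comm, trace_self_mul_eq_hs, hm1, Complex.ofReal_one]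
    set ν := qblk N (rowMove m * (rowMove m)ᴴ) with hν
    have hνp : ∀ ch, (ν ch).PosSemidef := fun ch => qblk_posSemidef hN hst.1 ch
    refine ⟨ν, fun k => pw (ν k.1.2) ((-(α - 1) / 2 : ℝ) : ℂ) * Γ k m, hνp, ?_, ?_, ?_⟩
    · have h := congrArg Complex.re (sum_trace_qblk hN (rowMove m * (rowMove m)ᴴ))
      rw [hst.2, Complex.one_re, Complex.re_sum] at h
      exact h.le
    · intro k
      have h : pw (ν k.1.2) 0 * Γ k m = Γ k m := by
        refine pw_zero_mul_of_le (Finset.univ.filter fun k' : (Cb × Ch) × S => k'.1.2 = k.1.2) (hνp _)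
          (F := fun k => outFactor M k.1 k.2 (rowMove m)) ?_ (k := k) (by simp)
        rw [hν, qblk_eq_sum hM, sub_self]
        exact PosSemidef.zero
      rw [← Matrix.mul_assoc, pw_mul, ← Complex.ofReal_add, neg_div, add_neg_cancel, Complex.ofReal_zero, h]
    · have h := qesSum_blk_le hN hα' hr' f hst
      rw [← hK] at h
      refine (le_of_eq ?_).trans (h.trans (le_of_eq ?_))
      · refine Finset.sum_congr rfl fun c _ => ?_
        refine congrArg₂ (· * ·) ?_ (congrArg (trp _) (hstk (ν c.2) _ c m))
        rw [← Real.rpow_mul (by norm_num), mul_comm (f _ _)]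
      · rw [← Real.rpow_mul (by norm_num)]
        congr 1
        field_simp
        ring

end RoundChain

section MarginalReference

variable {Q Q' Cb Ch : Type*} [Fintype Q] [DecidableEq Q] [Fintype Q'] [DecidableEq Q']
  [Fintype Cb] [DecidableEq Cb] [Fintype Ch] [DecidableEq Ch]

lemma stk_slice {a b : Type*} (m : Matrix (Q × a) b ℂ) :
    (stk fun s => of fun e j => m (s, e) j) = m := rfl

lemma one_kronecker_pw_sandwich_eq {b : Type*} [Fintype b] (P : Matrix Q' Q' ℂ) (s : ℝ)
    (m : Matrix (Q × Q') b ℂ) :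
    ((1 : Matrix Q Q ℂ) ⊗ₖ pw P (s : ℂ)) * (m * mᴴ) * ((1 : Matrix Q Q ℂ) ⊗ₖ pw P (s : ℂ)) =
      (stk fun s' : Q => pw P (s : ℂ) * of fun e j => m (s', e) j) *
        (stk fun s' : Q => pw P (s : ℂ) * of fun e j => m (s', e) j)ᴴ := by
  rw [← one_kronecker_mul_stk, stk_slice, conjTranspose_mul, one_kronecker_pw_conjTranspose]
  simp only [Matrix.mul_assoc]

/-- Restriction of a matrix to a row block `ch` and a column block `(c, s)`. -/
def sliceMap {a b : Type*} (k : (Cb × Ch) × Q) :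
    Matrix (Ch × a) ((Cb × Ch) × (Q × b)) ℂ →ₗ[ℂ] Matrix a b ℂ where
  toFun m := of fun e j => m (k.1.2, e) (k.1, (k.2, j))
  map_add' _ _ := rfl
  map_smul' _ _ := rfl

lemma one_sub_slices_posSemidef {a b : Type*} [Fintype a] [DecidableEq a] [Fintype b]
    {m : Matrix (Ch × a) ((Cb × Ch) × (Q × b)) ℂ} (hm : (1 - m * mᴴ).PosSemidef) (ch : Ch) :
    ((1 : Matrix a a ℂ) - ∑ k : (Cb × Ch) × Q with k.1.2 = ch,
      sliceMap k m * (sliceMap k m)ᴴ).PosSemidef := by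
  set F : (Cb × Ch) × Q → Matrix a b ℂ := fun k => of fun e j => m (ch, e) (k.1, (k.2, j)) with hF
  have e1 : ∑ k : (Cb × Ch) × Q with k.1.2 = ch, sliceMap k m * (sliceMap k m)ᴴ =
      ∑ k : (Cb × Ch) × Q with k.1.2 = ch, F k * (F k)ᴴ := by
    refine Finset.sum_congr rfl fun k hk => ?_
    have : sliceMap k m = F k := by
      ext e j
      have : k.1.2 = ch := (Finset.mem_filter.1 hk).2
      subst this
      rfl
    rw [this]
  have e2 : (1 : Matrix a a ℂ) - ∑ k : (Cb × Ch) × Q with k.1.2 = ch, F k * (F k)ᴴ =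
      (1 - m * mᴴ).submatrix (fun e => (ch, e)) (fun e => (ch, e)) +
        ∑ k : (Cb × Ch) × Q with ¬ k.1.2 = ch, F k * (F k)ᴴ := by
    have e3 : (1 - m * mᴴ).submatrix (fun e => (ch, e)) (fun e => (ch, e)) =
        (1 : Matrix a a ℂ) - ∑ k, F k * (F k)ᴴ := by
      ext e e'
      rw [submatrix_apply, Matrix.sub_apply, Matrix.sub_apply, Matrix.sum_apply]
      congr 1
      · simp [Matrix.one_apply]
      · simp only [Matrix.mul_apply, Fintype.sum_prod_type, hF, of_apply, conjTranspose_apply]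
    rw [e3, ← Finset.sum_filter_add_sum_filter_not Finset.univ (fun k : (Cb × Ch) × Q => k.1.2 = ch)]
    abel
  rw [e1, e2]
  exact (hm.submatrix _).add (posSemidef_sum _ fun k _ => posSemidef_self_mul_conjTranspose _)

/-- The family of factors `n` arranged as one block matrix. -/
def blockFactor {a b : Type*} (n : Cb × Ch → Matrix (Q × a) b ℂ) :
    Matrix (Ch × a) ((Cb × Ch) × (Q × b)) ℂ :=
  of fun i j => if i.1 = j.1.2 then n j.1 (j.2.1, i.2) j.2.2 else 0

/-- The injection of the row block `ch`. -/
def rowInj (a : Type*) [DecidableEq a] (ch : Ch) : Matrix (Ch × a) a ℂ :=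
  of fun i e => if i = (ch, e) then 1 else 0

lemma rowInj_mul {a b : Type*} [Fintype a] [DecidableEq a] (ch : Ch) (X : Matrix a b ℂ) :
    rowInj a ch * X = of fun i j => if i.1 = ch then X i.2 j else 0 := by
  ext ⟨i, e⟩ j
  by_cases h : i = ch <;> simp [rowInj, Matrix.mul_apply, h]

lemma rowInj_conjTranspose_mul {a b : Type*} [Fintype a] [DecidableEq a] (ch : Ch)
    (X : Matrix (Ch × a) b ℂ) : (rowInj a ch)ᴴ * X = of fun e j => X (ch, e) j := by
  ext e j
  simp [rowInj, Matrix.mul_apply, apply_ite (star : ℂ → ℂ)]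

lemma sliceMap_pw_blockFactor {a b : Type*} [Fintype a] [DecidableEq a] [Fintype b]
    (n : Cb × Ch → Matrix (Q × a) b ℂ) {ν : Ch → Matrix a a ℂ}
    (hν : ∀ ch, ν ch = ∑ cb, ptA (n (cb, ch) * (n (cb, ch))ᴴ)) (hνp : ∀ ch, (ν ch).IsHermitian)
    (z : ℂ) (k : (Cb × Ch) × Q) :
    sliceMap k (pw (blockFactor n * (blockFactor n)ᴴ) z * blockFactor n) =
      pw (ν k.1.2) z * of fun e j => n k.1 (k.2, e) j := by
  set ch := k.1.2
  set J : Matrix (Ch × a) a ℂ := rowInj a ch with hJ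
  have hint : blockFactor n * (blockFactor n)ᴴ * J = J * ν ch := by
    rw [rowInj_mul]
    ext ⟨i, e⟩ e'
    have : (blockFactor n * (blockFactor n)ᴴ * J) (i, e) e' =
        (blockFactor n * (blockFactor n)ᴴ) (i, e) (ch, e') := by
      rw [Matrix.mul_apply]
      simp [hJ, rowInj]
    rw [this]
    by_cases h : i = ch
    · rw [h]
      simp only [if_true, of_apply, hν, ptA, Matrix.sum_apply, Matrix.mul_apply, blockFactor,
        Fintype.sum_prod_type, conjTranspose_apply, apply_ite (star : ℂ → ℂ), star_zero, mul_ite,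
        mul_zero, ite_mul, zero_mul]
      refine Finset.sum_congr rfl fun cb _ => ?_
      rw [Finset.sum_eq_single ch]
      · simp
      · intro b _ hb
        simp [hb.symm]
      · simp
    · simp only [h, if_false, of_apply, Matrix.mul_apply, blockFactor, conjTranspose_apply]
      refine Finset.sum_eq_zero fun x _ => ?_
      by_cases h1 : i = x.1.2
      · rw [if_neg (c := ch = x.1.2) (fun h2 => h (h1.trans h2.symm)), star_zero, mul_zero]
      · rw [if_neg h1, zero_mul]
  have hpw := pw_intertwine (posSemidef_self_mul_conjTranspose (blockFactor n)).1 (hνp ch) hint z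
  set nk : Matrix a b ℂ := of fun e j => n k.1 (k.2, e) j
  set V := pw (blockFactor n * (blockFactor n)ᴴ) z
  have e1 : sliceMap k (V * blockFactor n) = (rowInj a ch)ᴴ * (V * (J * nk)) := by
    rw [rowInj_conjTranspose_mul, rowInj_mul]
    rfl
  rw [e1, ← Matrix.mul_assoc V, hpw, Matrix.mul_assoc, rowInj_conjTranspose_mul]
  ext e j
  rw [rowInj_mul]; simp

/-- Replacing an arbitrary reference operator by the marginal, at the price of a lower order. -/
theorem qesSum_marginal_le {α p r : ℝ} (hα : 1 < α) (hp : p = (α - 1) / α) (hr : r = p / (1 + p))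
    (f : Cb → Ch → ℝ) {Y : Cb × Ch → Matrix (Q × Q') (Q × Q') ℂ} (hY : ∀ c, (Y c).PosSemidef)
    {τ : Ch → Matrix Q' Q' ℂ} (hτ : ∀ ch, (τ ch).PosDef) {bb : ℝ} (hbb : 0 ≤ bb)
    (hτb : ∑ ch, (τ ch).trace.re ≤ bb) {ν : Ch → Matrix Q' Q' ℂ}
    (hν : ∀ ch, ν ch = ∑ cb, ptA (Y (cb, ch))) :
    qesSum (1 + p) r f Y ν ≤ bb ^ p * qesSum α p f Y τ ^ (1 / α) := by
  have hα0 : 0 < α := by linarith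
  have hp0 : 0 < p := by rw [hp]; exact div_pos (by linarith) hα0
  have hp1 : p < 1 := by rw [hp, div_lt_one hα0]; linarith
  have hpα : 1 - p = 1 / α := by rw [hp]; field_simp; ring
  choose n hn using fun c => exists_sqrt_factor (hY c)
  have hνp : ∀ ch, (ν ch).PosSemidef := fun ch =>
    hν ch ▸ posSemidef_sum _ fun cb _ => ptA_posSemidef (hY _)
  set nk : (Cb × Ch) × Q → Matrix Q' (Q × Q') ℂ := fun k => of fun e j => n k.1 (k.2, e) j
  set w : Cb × Ch → ℝ := fun c => 2 ^ f c.1 c.2 with hw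
  have hw0 : ∀ c, 0 < w c := fun c => by positivity
  have hwp : ∀ c (s : ℝ), w c ^ s = 2 ^ (s * f c.1 c.2) := fun c s => by
    rw [hw, ← Real.rpow_mul (by norm_num), mul_comm]
  set B : Cb × Ch → Matrix (Q × Q') (Q × Q') ℂ := fun c => stk fun s =>
    pw (ν c.2) ((-r / 2 : ℝ) : ℂ) * nk (c, s) with hB
  set y := qesSum (1 + p) r f Y ν
  set x := qesSum α p f Y τ
  have hy0 : 0 ≤ y := qesSum_nonneg _ _ _ _ _
  have hx0 : 0 ≤ x := qesSum_nonneg _ _ _ _ _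
  have hyB : y = ∑ c, w c ^ ((1 + p) - 1) * trp (1 + p) (B c * (B c)ᴴ) := by
    refine Finset.sum_congr rfl fun c _ => ?_
    rw [hwp, hn c, one_kronecker_pw_sandwich_eq]
  have hxG : x = ∑ c, w c ^ (α - 1) * trp α
      ((stk fun s => pw (τ c.2) ((-p / 2 : ℝ) : ℂ) * nk (c, s)) *
        (stk fun s => pw (τ c.2) ((-p / 2 : ℝ) : ℂ) * nk (c, s))ᴴ) := by
    refine Finset.sum_congr rfl fun c _ => ?_
    rw [hwp, hn c, one_kronecker_pw_sandwich_eq]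
  set θ := 1 / (1 + p) with hθ
  have hθr : 1 - θ = r := by rw [hθ, hr]; field_simp; ring
  have hpθ : p * θ = r := by rw [hθ, hr]; ring
  have hr' : r = ((1 + p) - 1) / (1 + p) := by rw [hr]; ring
  set H : Cb × Ch → Matrix (Q × Q') (Q × Q') ℂ := fun c =>
    ((w c ^ ((1 + p) - 1) : ℝ) : ℂ) • pw ((B c)ᴴ * B c) ((1 + p : ℝ) : ℂ)
  have hHp : ∀ c, (H c).PosSemidef := fun c =>
    (pw_posSemidef _ _).smul (by exact_mod_cast Real.rpow_nonneg (hw0 c).le _)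
  have hHs : ∑ c, (H c).trace.re = y := by
    rw [hyB]
    exact Finset.sum_congr rfl fun c _ => trp_weight (B c)
  have hslice : ∀ (z : ℂ) (k : (Cb × Ch) × Q),
      sliceMap k (pw (blockFactor n * (blockFactor n)ᴴ) z * blockFactor n) = pw (ν k.1.2) z * nk k :=
    sliceMap_pw_blockFactor n (fun ch => by rw [hν]; simp only [← hn]) fun ch => (hνp ch).1
  have key := interpolation_bound (fun k : (Cb × Ch) × Q => k.1.2) (fun k => sliceMap k)
    (t := 1) (T := fun _ => 1) (m0 := blockFactor n) (q := p) (bb := bb)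
    (Λ := x ^ (1 / α) * y ^ p) (θ := θ) (w := fun k => w k.1) (H := fun k => H k.1) hp0 hp1
    (by rw [hθ]; field_simp) PosSemidef.one rfl (fun _ => PosSemidef.one) (fun k => hHp k.1)
    (fun k => hw0 k.1) (fun m hm ch => one_sub_slices_posSemidef hm ch) (fun z hz => by
      refine ⟨fun ch => pw (ν ch) (-(1 - z) / 2), τ,
        fun k => pw (τ k.1.2) ((-p / 2 : ℝ) : ℂ) * nk k,
        fun ch => contr_pw_imaginary (hνp ch).1 (by simp [hz]), fun ch => (hτ ch).posSemidef,
        hτb, fun k => ?_, ?_⟩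
      · have e : ((-p / 2 : ℝ) : ℂ) = -((p / 2 : ℝ) : ℂ) := by push_cast; ring
        rw [pw_one_left, Matrix.one_mul, hslice, e, Matrix.mul_assoc, ← Matrix.mul_assoc _ _ (nk k),
          pw_mul_pw_neg (hτ _), Matrix.one_mul]
      · rw [Fintype.sum_prod_type]
        have e11 : ∀ c, w c ^ p * hs ((stk fun s => pw (τ c.2) ((-p / 2 : ℝ) : ℂ) * nk (c, s)) *
            pw (H c) ((p / 2 : ℝ) : ℂ)) = ∑ s, w c ^ p * hs (pw (τ c.2) ((-p / 2 : ℝ) : ℂ) *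
              nk (c, s) * pw (H c) ((p / 2 : ℝ) : ℂ)) := by
          intro c; rw [stk_mul, hs_stk, Finset.mul_sum]
        simp only [← e11]
        refine (sum_weight_hs_mul_pw_le hp0 hp1 hHp hw0).trans (le_of_eq ?_)
        have e5 : p / (1 / α) = α - 1 := by rw [hp]; field_simp
        rw [hHs, hpα, e5, one_div_one_div, ← hxG])
  have e9 : ∑ k : (Cb × Ch) × Q, w k.1 ^ (p * θ) * hs (pw (1 : Matrix Q' Q' ℂ)
      ((-(1 - θ) / 2 : ℝ) : ℂ) * sliceMap k (pw (1 : Matrix (Ch × Q') (Ch × Q') ℂ)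
        (((1 - θ) / 2 : ℝ) : ℂ) * pw (blockFactor n * (blockFactor n)ᴴ) ((-(1 - θ) / 2 : ℝ) : ℂ) *
          blockFactor n) * pw (H k.1) ((p * θ / 2 : ℝ) : ℂ)) = y := by
    rw [hyB, ← sum_weight_hs_optimal (by linarith) hr' hw0, Fintype.sum_prod_type]
    refine Finset.sum_congr rfl fun c _ => ?_
    rw [hB, stk_mul, hs_stk, Finset.mul_sum]
    refine Finset.sum_congr rfl fun s' _ => ?_
    rw [pw_one_left, pw_one_left, Matrix.one_mul, Matrix.one_mul, hslice, hθr, hpθ]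
  rw [e9] at key
  rcases hy0.eq_or_lt with hy1 | hy1
  · rw [← hy1]; exact mul_nonneg (Real.rpow_nonneg hbb _) (Real.rpow_nonneg hx0 _)
  have hθ0 : 0 < θ := by positivity
  have hb0 : 0 ≤ bb ^ p * x ^ (1 / α) := mul_nonneg (Real.rpow_nonneg hbb _) (Real.rpow_nonneg hx0 _)
  rw [← mul_assoc, Real.mul_rpow hb0 (Real.rpow_nonneg hy0 _), ← Real.rpow_mul hy0] at key
  have e10 : y = y ^ θ * y ^ (p * θ) := by
    rw [← Real.rpow_add hy1]
    have : θ + p * θ = 1 := by rw [hθ]; field_simp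
    rw [this, Real.rpow_one]
  nth_rewrite 1 [e10] at key
  exact (Real.rpow_le_rpow_iff hy0 hb0 hθ0).1
    (le_of_mul_le_mul_right key (Real.rpow_pos_of_pos hy1 _))

end MarginalReference

section RoundStep

variable {A Pc Ph R E Rh L S Cb Ch R' E' : Type} [Fintype A] [DecidableEq A]
  [Fintype Pc] [DecidableEq Pc] [Fintype Ph] [DecidableEq Ph] [Fintype R] [DecidableEq R]
  [Fintype E] [DecidableEq E] [Fintype Rh] [DecidableEq Rh] [Fintype L] [DecidableEq L]
  [Fintype S] [DecidableEq S] [Fintype Cb] [DecidableEq Cb] [Fintype Ch] [DecidableEq Ch]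
  [Fintype R'] [DecidableEq R'] [Fintype E'] [DecidableEq E']

/-- Partial trace over the middle register `R` of `A R E`. -/
def redR (X : Matrix (A × (R × E)) (A × (R × E)) ℂ) : Matrix (A × E) (A × E) ℂ :=
  of fun x y => ∑ r, X (x.1, (r, x.2)) (y.1, (r, y.2))

/-- Moving the register `R` to the right. -/
def moveR (X : Matrix (A × (R × E)) (A × (R × E)) ℂ) : Matrix ((A × E) × R) ((A × E) × R) ℂ :=
  X.submatrix (fun x => (x.1.1, (x.2, x.1.2))) (fun x => (x.1.1, (x.2, x.1.2)))

lemma lext_rext_posSemidef {Φ : Matrix R R ℂ →ₗ[ℂ] Matrix (Rh × L) (Rh × L) ℂ} (hΦ : IsCPTP Φ)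
    {X : Matrix (A × (R × E)) (A × (R × E)) ℂ} (hX : X.PosSemidef) :
    (lext (rext (R := E) Φ) X).PosSemidef := by
  have h : (moveR X).PosSemidef := hX.submatrix _
  have h2 := (hΦ.lext_posSemidef h).submatrix
    (fun x : A × ((Rh × L) × E) => ((x.1, x.2.2), x.2.1))
  exact h2

/-- `A (L E) ≃ (A E) L`. -/
def eSwapLE (A L E : Type) : A × (L × E) ≃ (A × E) × L where
  toFun x := ((x.1, x.2.2), x.2.1)
  invFun y := (y.1.1, (y.2, y.1.2))
  left_inv _ := rfl
  right_inv _ := rfl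

lemma rtr_lext_rext (Φ : Matrix R R ℂ →ₗ[ℂ] Matrix (Rh × L) (Rh × L) ℂ)
    (X : Matrix (A × (R × E)) (A × (R × E)) ℂ) :
    rtr (lext (rext (R := E) Φ) X) =
      (lext (ptALin Rh L ∘ₗ Φ) (moveR X)).submatrix (eSwapLE A L E) (eSwapLE A L E) := rfl

lemma trp_rtr_lext_rext {Φ : Matrix R R ℂ →ₗ[ℂ] Matrix (Rh × L) (Rh × L) ℂ} (hΦ : IsCPTP Φ)
    {X : Matrix (A × (R × E)) (A × (R × E)) ℂ} (hX : X.PosSemidef)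
    {τ : Matrix E E ℂ} (hτ : τ.PosDef) {σ : Matrix L L ℂ} (hσ : σ.PosDef) (α s : ℝ) :
    trp α (pw ((1 : Matrix A A ℂ) ⊗ₖ (σ ⊗ₖ τ)) (s : ℂ) * rtr (lext (rext (R := E) Φ) X) *
      pw ((1 : Matrix A A ℂ) ⊗ₖ (σ ⊗ₖ τ)) (s : ℂ)) =
    trp α (pw (((1 : Matrix A A ℂ) ⊗ₖ τ) ⊗ₖ σ) (s : ℂ) * lext (ptALin Rh L ∘ₗ Φ) (moveR X) *
      pw (((1 : Matrix A A ℂ) ⊗ₖ τ) ⊗ₖ σ) (s : ℂ)) := by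
  have h1 : (1 : Matrix A A ℂ) ⊗ₖ (σ ⊗ₖ τ) =
      (((1 : Matrix A A ℂ) ⊗ₖ τ) ⊗ₖ σ).submatrix (eSwapLE A L E) (eSwapLE A L E) := by
    ext ⟨a, l, e⟩ ⟨a', l', e'⟩
    simp only [kroneckerMap_apply, submatrix_apply, eSwapLE, Equiv.coe_fn_mk]
    ring
  have h2 : (((1 : Matrix A A ℂ) ⊗ₖ τ) ⊗ₖ σ).IsHermitian :=
    ((PosDef.one.kronecker hτ).kronecker hσ).1
  have h3 : (lext (ptALin Rh L ∘ₗ Φ) (moveR X)).PosSemidef :=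
    hΦ.ptALin_comp.lext_posSemidef (hX.submatrix _)
  rw [h1, pw_submatrix _ h2, rtr_lext_rext, submatrix_mul_equiv, submatrix_mul_equiv,
    trp_submatrix]
  have h4 := h3.mul_mul_conjTranspose_same (pw (((1 : Matrix A A ℂ) ⊗ₖ τ) ⊗ₖ σ) (s : ℂ))
  rw [pw_conjTranspose_ofReal] at h4
  exact h4.1

theorem round_step [Nonempty L]
    {Φ : Matrix R R ℂ →ₗ[ℂ] Matrix (Rh × L) (Rh × L) ℂ} (hΦ : IsCPTP Φ)
    {N : Matrix ((Rh × L) × E) ((Rh × L) × E) ℂ →ₗ[ℂ]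
      Matrix ((S × (Cb × Ch)) × (R' × E')) ((S × (Cb × Ch)) × (R' × E')) ℂ} (hN : IsCPTP N)
    {Q : Matrix (L × E) (L × E) ℂ →ₗ[ℂ] Matrix (E' × Ch) (E' × Ch) ℂ} (hQ : IsCPTP Q)
    (hNS : ∀ τ, traceOut (eNSout S Cb Ch R' E') (N τ) = Q (traceOut (eNSin Rh L E) τ))
    {α p ξ : ℝ} (hα : 1 < α) (hα2 : α < 2) (hp : p = (α - 1) / α)
    (hξ : ξ = sSup {x : ℝ | ∃ ω : Matrix (R × R) (R × R) ℂ, IsState ω ∧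
      x = (Idown α (traceOut (eXi R Rh L) (lext Φ ω))).toReal})
    (f : Pc → Ph → Cb → Ch → ℝ) {K : Pc → Ph → ℝ}
    (hK : ∀ pc ph, K pc ph = sInf {x : ℝ | ∃ ω : Matrix (((Rh × L) × E) × ((Rh × L) × E))
        (((Rh × L) × E) × ((Rh × L) × E)) ℂ, IsState ω ∧
      x = QESent (1 / (2 - α)) (f pc ph)
        (traceOut (eKappa ((Rh × L) × E) S Cb Ch R' E') (lext N ω))})
    {X : Pc × Ph → Matrix (A × (R × E)) (A × (R × E)) ℂ} (hX : ∀ c, (X c).PosSemidef)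
    (hX0 : ∃ c, X c ≠ 0) (F : Pc → Ph → ℝ) {τ : Ph → Matrix E E ℂ} (hτ : ∀ ph, (τ ph).PosDef)
    {b₀ b₁ : ℝ} (hb₀ : 0 < b₀) (hb₁ : b₀ < b₁) (hτb : ∑ ph, (τ ph).trace.re ≤ b₀)
    (hXb : qesSum α p F (fun c => redR (X c)) τ ≤ b₀) :
    ∃ τ' : Ph → Ch → Matrix E' E' ℂ, (∀ ph ch, (τ' ph ch).PosDef) ∧
      ∑ ph, ∑ ch, (τ' ph ch).trace.re ≤ b₁ ∧
      ∑ c : Pc × Ph, 2 ^ ((α - 1) * (F c.1 c.2 + K c.1 c.2 - ξ)) *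
        qesSum α p (f c.1 c.2) (blk N (lext (rext (R := E) Φ) (X c)))
          (fun ch => τ' c.2 ch ⊗ₖ (1 : Matrix A A ℂ)) ≤ b₁ := by
  have hα1 : 0 < α - 1 := by linarith
  set ε := Real.logb 2 (b₁ / b₀) / (α - 1) with hε
  have hε0 : 0 < ε := div_pos (Real.logb_pos (by norm_num) ((one_lt_div hb₀).2 hb₁)) hα1
  have hε2 : (2 : ℝ) ^ ((α - 1) * ε) = b₁ / b₀ := by
    rw [hε, mul_div_cancel₀ _ hα1.ne', Real.rpow_logb (by norm_num) (by norm_num)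
      (div_pos (hb₀.trans hb₁) hb₀)]
  set w : Pc × Ph → ℝ := fun c => 2 ^ F c.1 c.2 with hw
  have hw0 : ∀ c, 0 < w c := fun c => by positivity
  have hwp : ∀ c (s : ℝ), w c ^ s = 2 ^ (s * F c.1 c.2) := fun c s => by
    rw [hw, ← Real.rpow_mul (by norm_num), mul_comm]
  obtain ⟨σ, hσ, hleak⟩ := leak_bound (ρ := fun c => moveR (X c))
    (T := fun c : Pc × Ph => (1 : Matrix A A ℂ) ⊗ₖ τ c.2) (w := w) hΦ hα hp hξ hε0
    (fun c => (hX c).submatrix _) (by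
      obtain ⟨c, hc⟩ := hX0
      refine ⟨c, fun h => hc ?_⟩
      ext ⟨a, r, e⟩ ⟨a', r', e'⟩
      exact congrFun (congrFun h ((a, e), r)) ((a', e'), r')) (fun c => PosDef.one.kronecker (hτ _)) hw0
  set l : ℝ := (Fintype.card L : ℝ)
  set M : ℝ := (Fintype.card Ph : ℝ) * ((Fintype.card Ch : ℝ) * (Fintype.card E' : ℝ)) with hM
  set δ := (b₁ - b₀) / (l * b₀ + M + 1)
  have hd0 : 0 < l * b₀ + M + 1 := by positivity
  have hδ0 : 0 < δ := div_pos (by linarith) hd0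
  have hδb : b₀ + δ * l * b₀ + δ * M ≤ b₁ := by
    have : δ * (l * b₀ + M + 1) = b₁ - b₀ := div_mul_cancel₀ _ hd0.ne'
    nlinarith
  have hδ1 : ∀ {G : Type} [Fintype G] [DecidableEq G], ((δ : ℂ) • (1 : Matrix G G ℂ)).PosDef :=
    fun {G} _ _ => PosDef.one.smul (by exact_mod_cast hδ0)
  have hδt : ∀ {G : Type} [Fintype G] [DecidableEq G], ((δ : ℂ) • (1 : Matrix G G ℂ)).trace.re =
      δ * Fintype.card G := by
    intro G _ _
    simp [Matrix.trace_smul]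
  set σ' : Matrix L L ℂ := (δ : ℂ) • 1 + σ with hσ'
  have hσ'p : σ'.PosDef := hδ1.add_posSemidef hσ.1
  have hleak' := hleak σ' (by rw [hσ', add_sub_cancel_right]; exact hδ1.posSemidef)
  have hQp : ∀ ph, (Q (σ' ⊗ₖ τ ph)).PosSemidef := fun ph =>
    hQ.posSemidef (hσ'p.kronecker (hτ ph)).posSemidef
  refine ⟨fun ph ch => (δ : ℂ) • 1 +
    (Q (σ' ⊗ₖ τ ph)).submatrix (fun e => (e, ch)) (fun e => (e, ch)),
    fun ph ch => hδ1.add_posSemidef ((hQp ph).submatrix _), ?_, ?_⟩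
  · have h1 : ∀ ph, ∑ ch, ((δ : ℂ) • (1 : Matrix E' E' ℂ) + (Q (σ' ⊗ₖ τ ph)).submatrix
        (fun e => (e, ch)) (fun e => (e, ch))).trace.re =
        δ * (Fintype.card Ch * Fintype.card E') + (1 + δ * l) * (τ ph).trace.re := by
      intro ph
      simp only [Matrix.trace_add, Complex.add_re, hδt, Finset.sum_add_distrib]
      congr 1
      · simp; ring
      · have h2 : ∑ ch, ((Q (σ' ⊗ₖ τ ph)).submatrix
            (fun e => (e, ch)) (fun e => (e, ch))).trace = (Q (σ' ⊗ₖ τ ph)).trace := by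
          simp only [Matrix.trace, diag_apply, submatrix_apply, Fintype.sum_prod_type]
          exact Finset.sum_comm
        rw [← Complex.re_sum, h2, hQ.tp, trace_kronecker, trace_eq_re hσ'p.posSemidef,
          Complex.re_ofReal_mul, hσ', Matrix.trace_add, Complex.add_re, hδt, hσ.2, Complex.one_re,
          add_comm]
    simp only [h1, Finset.sum_add_distrib, ← Finset.mul_sum]
    simp only [Finset.sum_const, Finset.card_univ, nsmul_eq_mul]
    have h3 : (1 + δ * l) * ∑ ph, (τ ph).trace.re ≤ (1 + δ * l) * b₀ :=
      mul_le_mul_of_nonneg_left hτb (by positivity)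
    have h4 : δ * (Fintype.card Ch * (Fintype.card Ph * Fintype.card E')) = δ * M := by
      rw [hM]; ring
    rw [h4]
    nlinarith
  · have h1 : ∀ c : Pc × Ph, 2 ^ ((α - 1) * (F c.1 c.2 + K c.1 c.2 - ξ)) *
        qesSum α p (f c.1 c.2) (blk N (lext (rext (R := E) Φ) (X c)))
          (fun ch => ((δ : ℂ) • 1 + (Q (σ' ⊗ₖ τ c.2)).submatrix (fun e => (e, ch))
            (fun e => (e, ch))) ⊗ₖ (1 : Matrix A A ℂ)) ≤
        2 ^ (-(α - 1) * ξ) * (w c ^ (α - 1) * trp α (pw (((1 : Matrix A A ℂ) ⊗ₖ τ c.2) ⊗ₖ σ')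
          ((-p / 2 : ℝ) : ℂ) * lext (ptALin Rh L ∘ₗ Φ) (moveR (X c)) *
            pw (((1 : Matrix A A ℂ) ⊗ₖ τ c.2) ⊗ₖ σ') ((-p / 2 : ℝ) : ℂ))) := by
      intro c
      have h2 := round_chain hN hQ hNS hα hα2 hp (hσ'p.kronecker (hτ c.2))
        (τ' := fun ch => (δ : ℂ) • 1 + (Q (σ' ⊗ₖ τ c.2)).submatrix (fun e => (e, ch))
            (fun e => (e, ch))) (fun ch => (hδ1.add_posSemidef ((hQp _).submatrix _)).posSemidef)
        (fun ch => by rw [add_sub_cancel_right]; exact hδ1.posSemidef) (f c.1 c.2) (hK c.1 c.2)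
        (lext_rext_posSemidef (E := E) hΦ (hX c))
      refine (mul_le_mul_of_nonneg_left h2 (by positivity)).trans (le_of_eq ?_)
      rw [trp_rtr_lext_rext hΦ (hX c) (hτ _) hσ'p, hwp, ← mul_assoc, ← mul_assoc,
        ← Real.rpow_add (by norm_num), ← Real.rpow_add (by norm_num)]
      congr 2
      ring
    refine (Finset.sum_le_sum fun c _ => h1 c).trans ?_
    rw [← Finset.mul_sum]
    refine (mul_le_mul_of_nonneg_left hleak' (by positivity)).trans ?_
    rw [← mul_assoc, ← Real.rpow_add (by norm_num)]
    have h5 : -(α - 1) * ξ + (α - 1) * (ξ + ε) = (α - 1) * ε := by ring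
    rw [h5, hε2]
    have h6 : ∑ c : Pc × Ph, w c ^ (α - 1) * trp α (pw ((1 : Matrix A A ℂ) ⊗ₖ τ c.2)
        ((-p / 2 : ℝ) : ℂ) * ptB (moveR (X c)) * pw ((1 : Matrix A A ℂ) ⊗ₖ τ c.2)
          ((-p / 2 : ℝ) : ℂ)) = qesSum α p F (fun c => redR (X c)) τ := by
      refine Finset.sum_congr rfl fun c _ => ?_
      rw [hwp, pw_one_kronecker (hτ _).1]
      rfl
    rw [h6]
    refine (mul_le_mul_of_nonneg_left hXb (div_nonneg (hb₀.trans hb₁).le hb₀.le)).trans (le_of_eq ?_)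
    exact div_mul_cancel₀ _ hb₀.ne'

end RoundStep

section Accumulation

section Regroup

variable {A A' S E' : Type} [Fintype A] [DecidableEq A] [Fintype A'] [DecidableEq A']
  [Fintype S] [DecidableEq S] [Fintype E'] [DecidableEq E']

/-- `A' E' ≃ S (E' A)` for a register `A' ≃ A S`. -/
def eRegroup (E' : Type) (e : A × S ≃ A') : A' × E' ≃ S × (E' × A) where
  toFun x := ((e.symm x.1).2, (x.2, (e.symm x.1).1))
  invFun y := (e (y.2.2, y.1), y.2.1)
  left_inv x := by simp
  right_inv y := by simp

lemma trp_regroup (e : A × S ≃ A') {Y : Matrix (S × (E' × A)) (S × (E' × A)) ℂ}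
    (hY : Y.PosSemidef) {τ : Matrix E' E' ℂ} (hτ : τ.PosDef) (α s : ℝ) :
    trp α (((1 : Matrix A' A' ℂ) ⊗ₖ pw τ (s : ℂ)) * Y.submatrix (eRegroup E' e) (eRegroup E' e) *
      ((1 : Matrix A' A' ℂ) ⊗ₖ pw τ (s : ℂ))) =
    trp α (((1 : Matrix S S ℂ) ⊗ₖ pw (τ ⊗ₖ (1 : Matrix A A ℂ)) (s : ℂ)) * Y *
      ((1 : Matrix S S ℂ) ⊗ₖ pw (τ ⊗ₖ (1 : Matrix A A ℂ)) (s : ℂ))) := by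
  have h1 : (1 : Matrix A' A' ℂ) ⊗ₖ pw τ (s : ℂ) = ((1 : Matrix S S ℂ) ⊗ₖ
      pw (τ ⊗ₖ (1 : Matrix A A ℂ)) (s : ℂ)).submatrix (eRegroup E' e) (eRegroup E' e) := by
    rw [pw_kronecker hτ.1 isHermitian_one, pw_one_left]
    ext ⟨a, x⟩ ⟨a', x'⟩
    simp only [kroneckerMap_apply, submatrix_apply, eRegroup, Equiv.coe_fn_mk, Matrix.one_apply]
    by_cases h : a = a'
    · simp [h]
    · have h2 : ¬ ((e.symm a).1 = (e.symm a').1 ∧ (e.symm a).2 = (e.symm a').2) :=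
        fun h3 => h (e.symm.injective (Prod.ext h3.1 h3.2))
      rw [if_neg h]
      by_cases h3 : (e.symm a).2 = (e.symm a').2
      · rw [if_neg (c := (e.symm a).1 = _) fun h4 => h2 ⟨h4, h3⟩]; simp
      · rw [if_neg h3]; simp
  rw [h1, submatrix_mul_equiv, submatrix_mul_equiv, trp_submatrix]
  exact (sandwich_one_kronecker_posSemidef hY _ s).1

lemma trp_sandwich_le_trace {P τ : Matrix E' E' ℂ} (hP : P.PosSemidef) (hτ : τ.PosSemidef)
    (hle : (τ - P).PosSemidef) {α p : ℝ} (hα : 1 < α) (hp : p = (α - 1) / α) :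
    trp α (pw τ ((-p / 2 : ℝ) : ℂ) * P * pw τ ((-p / 2 : ℝ) : ℂ)) ≤ P.trace.re := by
  have h := sum_trp_data_processing (fun _ : Unit => ()) (K := fun _ => (1 : Matrix E' E' ℂ))
    (σ := P) (σ' := fun _ => τ) (X := pw P ((1 - p : ℝ) : ℂ)) hα hp (by simpa using PosSemidef.zero) hP (fun _ => hτ)
    (fun c => by simpa using hle) (pw_posSemidef _ _)
  have e1 : pw P ((p / 2 : ℝ) : ℂ) * (pw P ((1 - p : ℝ) : ℂ) * pw P ((p / 2 : ℝ) : ℂ)) = P := by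
    rw [pw_mul, pw_mul, ← Complex.ofReal_add, ← Complex.ofReal_add]
    have : p / 2 + (1 - p + p / 2) = 1 := by ring
    rw [this, Complex.ofReal_one, pw_one hP]
  have e2 : trp α (pw P ((1 - p : ℝ) : ℂ)) = P.trace.re := by
    rw [trp, pw_pw hP.1, ← Complex.ofReal_mul]
    have : (1 - p) * α = 1 := by rw [hp]; field_simp; ring
    rw [this, Complex.ofReal_one, pw_one hP]
  simp only [Finset.univ_unique, Finset.sum_singleton, Finset.filter_true, Matrix.mul_one,
    conjTranspose_one, e2] at h
  have e3 : pw τ ((-p / 2 : ℝ) : ℂ) * pw P ((p / 2 : ℝ) : ℂ) * pw P ((1 - p : ℝ) : ℂ) *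
      pw P ((p / 2 : ℝ) : ℂ) = pw τ ((-p / 2 : ℝ) : ℂ) * P := by
    simp only [Matrix.mul_assoc, e1]
  rwa [e3] at h

end Regroup

section Families

variable {R E S Rh Lk Cb Ch : ℕ → Type}

/-- The block of the accumulated state for the classical values `c`. -/
def accBlk {j : ℕ} {Y : Type} (ρ : Matrix (Acc S Cb Ch j × Y) (Acc S Cb Ch j × Y) ℂ)
    (c : (∀ i : Fin j, Cb i) × (∀ i : Fin j, Ch i)) :
    Matrix ((∀ i : Fin j, S i) × Y) ((∀ i : Fin j, S i) × Y) ℂ :=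
  ρ.submatrix (fun x => ((x.1, c), x.2)) (fun x => ((x.1, c), x.2))

/-- The score accumulated along a tuple of classical values. -/
def accScore (g : (j : ℕ) → (∀ i : Fin j, Cb i) → (∀ i : Fin j, Ch i) → Cb j → Ch j → ℝ) (j : ℕ)
    (cb : ∀ i : Fin j, Cb i) (ch : ∀ i : Fin j, Ch i) : ℝ :=
  ∑ i : Fin j, g i (fun k => cb ⟨k.1, k.2.trans i.2⟩) (fun k => ch ⟨k.1, k.2.trans i.2⟩)
    (cb i) (ch i)

lemma accScore_succ (g : (j : ℕ) → (∀ i : Fin j, Cb i) → (∀ i : Fin j, Ch i) → Cb j → Ch j → ℝ)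
    (j : ℕ) (cb : ∀ i : Fin (j + 1), Cb i) (ch : ∀ i : Fin (j + 1), Ch i) :
    accScore g (j + 1) cb ch =
      accScore g j (fun i => cb i.castSucc) (fun i => ch i.castSucc) +
        g j (fun i => cb i.castSucc) (fun i => ch i.castSucc) (cb (Fin.last j)) (ch (Fin.last j)) := by
  rw [accScore, Fin.sum_univ_castSucc]
  rfl

variable [∀ i, Fintype (R i)] [∀ i, DecidableEq (R i)]
  [∀ i, Fintype (E i)] [∀ i, DecidableEq (E i)]
  [∀ i, Fintype (S i)] [∀ i, DecidableEq (S i)]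
  [∀ i, Fintype (Cb i)] [∀ i, DecidableEq (Cb i)]
  [∀ i, Fintype (Ch i)] [∀ i, DecidableEq (Ch i)]
  [∀ i, Fintype (Rh i)] [∀ i, DecidableEq (Rh i)]
  [∀ i, Fintype (Lk i)] [∀ i, DecidableEq (Lk i)]
  (𝓛 : (j : ℕ) → Matrix (R j) (R j) ℂ →ₗ[ℂ] Matrix (Rh j × Lk j) (Rh j × Lk j) ℂ)
  (𝒩 : (j : ℕ) → Matrix ((Rh j × Lk j) × E j) ((Rh j × Lk j) × E j) ℂ →ₗ[ℂ]
    Matrix ((S j × (Cb j × Ch j)) × (R (j + 1) × E (j + 1)))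
      ((S j × (Cb j × Ch j)) × (R (j + 1) × E (j + 1))) ℂ)
  (ω0 : Matrix (R 0 × E 0) (R 0 × E 0) ℂ)

/-- The state after `j` rounds with leakage. -/
abbrev leakState (j : ℕ) : Matrix (Acc S Cb Ch j × (R j × E j)) (Acc S Cb Ch j × (R j × E j)) ℂ :=
  geattlState R E S Cb Ch (fun j => (𝒩 j).comp (rext (𝓛 j))) ω0 j

lemma accBlk_leakState_succ (j : ℕ) (c : (∀ i : Fin (j + 1), Cb i) × (∀ i : Fin (j + 1), Ch i)) :
    accBlk (leakState 𝓛 𝒩 ω0 (j + 1)) c =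
      (lext (𝒩 j) (lext (rext (𝓛 j)) (accBlk (leakState 𝓛 𝒩 ω0 j)
        (fun i => c.1 i.castSucc, fun i => c.2 i.castSucc)))).submatrix
      (fun x => (fun i => x.1 i.castSucc, ((x.1 (Fin.last j), (c.1 (Fin.last j), c.2 (Fin.last j))), x.2)))
      (fun x => (fun i => x.1 i.castSucc, ((x.1 (Fin.last j), (c.1 (Fin.last j), c.2 (Fin.last j))), x.2))) :=
  rfl

lemma redR_accBlk_leakState_succ (j : ℕ)
    (c : (∀ i : Fin (j + 1), Cb i) × (∀ i : Fin (j + 1), Ch i)) :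
    redR (accBlk (leakState 𝓛 𝒩 ω0 (j + 1)) c) =
      (blk (𝒩 j) (lext (rext (𝓛 j)) (accBlk (leakState 𝓛 𝒩 ω0 j)
        (fun i => c.1 i.castSucc, fun i => c.2 i.castSucc)))
        (c.1 (Fin.last j), c.2 (Fin.last j))).submatrix
      (eRegroup (E (j + 1)) (snocEquiv S j)) (eRegroup (E (j + 1)) (snocEquiv S j)) :=
  rfl

variable {𝓛 𝒩 ω0}

lemma accBlk_leakState_posSemidef (h𝓛 : ∀ j, IsCPTP (𝓛 j)) (h𝒩 : ∀ j, IsCPTP (𝒩 j))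
    (hω0 : IsState ω0) (j : ℕ) (c : (∀ i : Fin j, Cb i) × (∀ i : Fin j, Ch i)) :
    (accBlk (leakState 𝓛 𝒩 ω0 j) c).PosSemidef := by
  induction j with
  | zero => exact hω0.1.submatrix Prod.snd
  | succ j ih =>
    rw [accBlk_leakState_succ]
    exact ((h𝒩 j).lext_posSemidef (lext_rext_posSemidef (h𝓛 j) (ih _))).submatrix _

lemma leakState_trace (h𝓛 : ∀ j, IsCPTP (𝓛 j)) (h𝒩 : ∀ j, IsCPTP (𝒩 j))
    (hω0 : IsState ω0) (j : ℕ) : (leakState 𝓛 𝒩 ω0 j).trace = 1 := by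
  induction j with
  | zero =>
    rw [← hω0.2]
    exact Equiv.sum_comp (eInit R E S Cb Ch).symm (fun x => ω0 x x)
  | succ j ih =>
    have hM : ∀ ρ, ((𝒩 j).comp (rext (𝓛 j)) ρ).trace = ρ.trace := by
      intro ρ
      rw [LinearMap.comp_apply, (h𝒩 j).tp]
      refine (Fintype.sum_prod_type_right _).trans (Eq.trans ?_ (Fintype.sum_prod_type_right _).symm)
      refine Finset.sum_congr rfl fun e _ => ?_
      exact (h𝓛 j).tp (of fun a a' => ρ (a, e) (a', e))
    rw [← ih]
    have h1 : (leakState 𝓛 𝒩 ω0 (j + 1)).trace =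
        (lext ((𝒩 j).comp (rext (𝓛 j))) (leakState 𝓛 𝒩 ω0 j)).trace :=
      Equiv.sum_comp (eAccStep S Cb Ch j (R (j + 1) × E (j + 1))).symm
        (fun x => lext ((𝒩 j).comp (rext (𝓛 j))) (leakState 𝓛 𝒩 ω0 j) x x)
    rw [h1]
    refine (Fintype.sum_prod_type _).trans (Eq.trans ?_ (Fintype.sum_prod_type _).symm)
    refine Finset.sum_congr rfl fun a _ => ?_
    exact hM (of fun x x' => leakState 𝓛 𝒩 ω0 j (a, x) (a, x'))

lemma exists_accBlk_leakState_ne_zero (h𝓛 : ∀ j, IsCPTP (𝓛 j)) (h𝒩 : ∀ j, IsCPTP (𝒩 j))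
    (hω0 : IsState ω0) (j : ℕ) : ∃ c, accBlk (leakState 𝓛 𝒩 ω0 j) c ≠ 0 := by
  by_contra! h
  have h1 : (leakState 𝓛 𝒩 ω0 j).trace = 0 := Finset.sum_eq_zero fun x _ =>
    congrFun (congrFun (h x.1.2) (x.1.1, x.2)) (x.1.1, x.2)
  rw [leakState_trace h𝓛 h𝒩 hω0] at h1
  exact one_ne_zero h1

end Families

end Accumulation

section AccumulationBound

variable {R E S Rh Lk Cb Ch : ℕ → Type}
  [∀ i, Fintype (R i)] [∀ i, DecidableEq (R i)]
  [∀ i, Fintype (E i)] [∀ i, DecidableEq (E i)]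
  [∀ i, Fintype (S i)] [∀ i, DecidableEq (S i)]
  [∀ i, Fintype (Cb i)] [∀ i, DecidableEq (Cb i)]
  [∀ i, Fintype (Ch i)] [∀ i, DecidableEq (Ch i)]
  [∀ i, Fintype (Rh i)] [∀ i, DecidableEq (Rh i)]
  [∀ i, Fintype (Lk i)] [∀ i, DecidableEq (Lk i)]
  {𝓛 : (j : ℕ) → Matrix (R j) (R j) ℂ →ₗ[ℂ] Matrix (Rh j × Lk j) (Rh j × Lk j) ℂ}
  {𝒩 : (j : ℕ) → Matrix ((Rh j × Lk j) × E j) ((Rh j × Lk j) × E j) ℂ →ₗ[ℂ]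
    Matrix ((S j × (Cb j × Ch j)) × (R (j + 1) × E (j + 1)))
      ((S j × (Cb j × Ch j)) × (R (j + 1) × E (j + 1))) ℂ}
  {ω0 : Matrix (R 0 × E 0) (R 0 × E 0) ℂ}

lemma redR_posSemidef {A R E : Type} [Fintype A] [DecidableEq A] [Fintype R] [DecidableEq R]
    [Fintype E] [DecidableEq E] {X : Matrix (A × (R × E)) (A × (R × E)) ℂ} (hX : X.PosSemidef) :
    (redR X).PosSemidef := by
  have : redR X = ∑ r : R, X.submatrix (fun x : A × E => (x.1, (r, x.2)))
      (fun x : A × E => (x.1, (r, x.2))) := by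
    ext x y
    simp [redR, Matrix.sum_apply]
  rw [this]
  exact posSemidef_sum _ fun r _ => hX.submatrix _

lemma accumulation_base (h𝓛 : ∀ j, IsCPTP (𝓛 j)) (h𝒩 : ∀ j, IsCPTP (𝒩 j)) (hω0 : IsState ω0)
    {α p : ℝ} (hα : 1 < α) (hp : p = (α - 1) / α)
    (g : (j : ℕ) → (∀ i : Fin j, Cb i) → (∀ i : Fin j, Ch i) → Cb j → Ch j → ℝ)
    {b : ℝ} (hb : 1 < b) :
    ∃ τ : (∀ i : Fin 0, Ch i) → Matrix (E 0) (E 0) ℂ, (∀ ch, (τ ch).PosDef) ∧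
      ∑ ch, (τ ch).trace.re ≤ b ∧
      qesSum α p (accScore g 0) (fun c => redR (accBlk (leakState 𝓛 𝒩 ω0 0) c)) τ ≤ b := by
  set δ : ℝ := (b - 1) / (Fintype.card (E 0) + 1) with hδ
  have hδ0 : 0 < δ := div_pos (by linarith) (by positivity)
  have hδb : δ * Fintype.card (E 0) ≤ b - 1 := by
    rw [hδ, div_mul_eq_mul_div, div_le_iff₀ (by positivity)]
    nlinarith
  set P : Matrix ((∀ i : Fin 0, S i) × E 0) ((∀ i : Fin 0, S i) × E 0) ℂ :=
    redR (accBlk (leakState 𝓛 𝒩 ω0 0) (default, default))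
  have hP0 : P.PosSemidef := redR_posSemidef (accBlk_leakState_posSemidef h𝓛 h𝒩 hω0 0 _)
  have hPtr : P.trace = 1 := by
    rw [← hω0.2]
    refine (Fintype.sum_prod_type _).trans ?_
    rw [Fintype.sum_unique]
    refine Eq.trans ?_ (Fintype.sum_prod_type_right _).symm
    rfl
  have hρP : ptA P = P.submatrix (fun x => (default, x)) (fun x => (default, x)) := by
    ext x y
    simp [ptA]
  have hρ : (ptA P).PosSemidef := hρP ▸ hP0.submatrix _
  have hδE : ((δ : ℂ) • (1 : Matrix (E 0) (E 0) ℂ)).PosDef :=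
    PosDef.one.smul (by exact_mod_cast hδ0)
  have hτ : ((δ : ℂ) • (1 : Matrix (E 0) (E 0) ℂ) + ptA P).PosDef := hδE.add_posSemidef hρ
  have hP1 : (1 : Matrix (∀ i : Fin 0, S i) (∀ i : Fin 0, S i) ℂ) ⊗ₖ
      ((δ : ℂ) • (1 : Matrix (E 0) (E 0) ℂ) + ptA P) - P = (δ : ℂ) • 1 := by
    have : P = (1 : Matrix (∀ i : Fin 0, S i) (∀ i : Fin 0, S i) ℂ) ⊗ₖ ptA P := by
      ext ⟨s, x⟩ ⟨s', y⟩
      have h1 : s = default := Subsingleton.elim _ _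
      have h2 : s' = default := Subsingleton.elim _ _
      rw [hρP, h1, h2]
      simp
    conv_lhs => rw [kronecker_add, ← this, add_sub_cancel_right, kronecker_smul, one_kronecker_one]
  have hPt : (ptA P).trace = P.trace :=
    (Fintype.sum_prod_type_right fun x => P x x).symm
  refine ⟨fun _ => (δ : ℂ) • 1 + ptA P, fun _ => hτ, ?_, ?_⟩
  · rw [Fintype.sum_unique, trace_add, Matrix.trace_smul, trace_one, hPt, hPtr]
    simp
    linarith
  · rw [qesSum, Fintype.sum_prod_type, Fintype.sum_unique, Fintype.sum_unique]
    have h0 : accScore g 0 default default = 0 := Finset.sum_empty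
    dsimp only
    rw [h0, mul_zero, Real.rpow_zero, one_mul, ← pw_one_kronecker hτ.1]
    have h := trp_sandwich_le_trace hP0 (PosSemidef.one.kronecker hτ.posSemidef)
      (by rw [hP1]; exact PosSemidef.one.smul (by exact_mod_cast hδ0.le)) hα hp
    rw [hPtr, Complex.one_re] at h
    exact h.trans hb.le

theorem accumulation_step (h𝓛 : ∀ j, IsCPTP (𝓛 j)) (h𝒩 : ∀ j, IsCPTP (𝒩 j)) (hω0 : IsState ω0)
    (j : ℕ) [Nonempty (Lk j)]
    (hNS : ∃ Rch : Matrix (Lk j × E j) (Lk j × E j) ℂ →ₗ[ℂ]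
        Matrix (E (j + 1) × Ch j) (E (j + 1) × Ch j) ℂ, IsCPTP Rch ∧
      ∀ τ : Matrix ((Rh j × Lk j) × E j) ((Rh j × Lk j) × E j) ℂ,
        traceOut (eNSout (S j) (Cb j) (Ch j) (R (j + 1)) (E (j + 1))) ((𝒩 j) τ)
          = Rch (traceOut (eNSin (Rh j) (Lk j) (E j)) τ))
    {α p ξ : ℝ} (hα : 1 < α) (hα2 : α < 2) (hp : p = (α - 1) / α)
    (hξ : ξ = sSup {x : ℝ | ∃ ω : Matrix (R j × R j) (R j × R j) ℂ, IsState ω ∧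
      x = (Idown α (traceOut (eXi (R j) (Rh j) (Lk j)) (lext (𝓛 j) ω))).toReal})
    (f : (∀ i : Fin j, Cb i) → (∀ i : Fin j, Ch i) → Cb j → Ch j → ℝ)
    {K : (∀ i : Fin j, Cb i) → (∀ i : Fin j, Ch i) → ℝ}
    (hK : ∀ pc ph, K pc ph = sInf {x : ℝ | ∃ ω : Matrix (((Rh j × Lk j) × E j) × ((Rh j × Lk j) × E j))
        (((Rh j × Lk j) × E j) × ((Rh j × Lk j) × E j)) ℂ, IsState ω ∧
      x = QESent (1 / (2 - α)) (f pc ph)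
        (traceOut (eKappa ((Rh j × Lk j) × E j) (S j) (Cb j) (Ch j) (R (j + 1)) (E (j + 1)))
          (lext (𝒩 j) ω))})
    {g : (j : ℕ) → (∀ i : Fin j, Cb i) → (∀ i : Fin j, Ch i) → Cb j → Ch j → ℝ}
    (hg : ∀ pc ph cb ch, g j pc ph cb ch = f pc ph cb ch + K pc ph - ξ)
    (ih : ∀ b : ℝ, 1 < b → ∃ τ : (∀ i : Fin j, Ch i) → Matrix (E j) (E j) ℂ,
      (∀ ch, (τ ch).PosDef) ∧ ∑ ch, (τ ch).trace.re ≤ b ∧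
      qesSum α p (accScore g j) (fun c => redR (accBlk (leakState 𝓛 𝒩 ω0 j) c)) τ ≤ b)
    {b : ℝ} (hb : 1 < b) :
    ∃ τ : (∀ i : Fin (j + 1), Ch i) → Matrix (E (j + 1)) (E (j + 1)) ℂ,
      (∀ ch, (τ ch).PosDef) ∧ ∑ ch, (τ ch).trace.re ≤ b ∧
      qesSum α p (accScore g (j + 1))
        (fun c => redR (accBlk (leakState 𝓛 𝒩 ω0 (j + 1)) c)) τ ≤ b := by
  obtain ⟨τ₀, hτ₀, hτ₀b, hX⟩ := ih ((1 + b) / 2) (by linarith)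
  obtain ⟨Q, hQ, hNS⟩ := hNS
  have hblk := accBlk_leakState_posSemidef h𝓛 h𝒩 hω0 j
  obtain ⟨τ, hτ, hτb, hsum⟩ := round_step (h𝓛 j) (h𝒩 j) hQ hNS hα hα2 hp hξ f hK hblk
    (exists_accBlk_leakState_ne_zero h𝓛 h𝒩 hω0 j) (accScore g j) hτ₀
    (by linarith) (by linarith : (1 + b) / 2 < b) hτ₀b hX
  refine ⟨fun ch => τ (fun i => ch i.castSucc) (ch (Fin.last j)), fun ch => hτ _ _, ?_, ?_⟩
  · refine le_trans (le_of_eq ?_) hτb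
    rw [← Fintype.sum_prod_type']
    exact Fintype.sum_equiv (snocEquiv Ch j).symm _ _ fun _ => rfl
  · refine le_trans (le_of_eq ?_) hsum
    simp only [qesSum, Finset.mul_sum]
    rw [← Fintype.sum_prod_type']
    refine Fintype.sum_equiv (((Equiv.prodProdProdComm _ _ _ _).trans
      ((snocEquiv Cb j).prodCongr (snocEquiv Ch j))).symm) _ _ fun c => ?_
    rw [redR_accBlk_leakState_succ, trp_regroup _
      (blk_posSemidef (h𝒩 j) (lext_rext_posSemidef (h𝓛 j) (hblk _)) _) (hτ _ _), ← mul_assoc,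
      ← Real.rpow_add (by norm_num), accScore_succ, hg]
    congr 2
    change _ = (α - 1) * (accScore g j (fun i => c.1 i.castSucc) (fun i => c.2 i.castSucc) +
        K (fun i => c.1 i.castSucc) (fun i => c.2 i.castSucc) - ξ) +
      (α - 1) * f (fun i => c.1 i.castSucc) (fun i => c.2 i.castSucc) (c.1 (Fin.last j))
        (c.2 (Fin.last j))
    ring

end AccumulationBound

section Conclusion

section QESPos

variable {Q Q' Cb Ch : Type*} [Fintype Q] [DecidableEq Q] [Fintype Q'] [DecidableEq Q'] [Fintype Cb]
  [DecidableEq Cb] [Fintype Ch] [DecidableEq Ch]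

lemma marginal_posSemidef {Y : Cb × Ch → Matrix (Q × Q') (Q × Q') ℂ} (hY : ∀ c, (Y c).PosSemidef)
    (ch : Ch) : (∑ cb, ptA (Y (cb, ch))).PosSemidef :=
  posSemidef_sum _ fun _ _ => ptA_posSemidef (hY _)

lemma qesSum_pos {α r : ℝ} (hα : 0 < α) (hr : r < 1) (f : Cb → Ch → ℝ)
    {Y : Cb × Ch → Matrix (Q × Q') (Q × Q') ℂ} (hY : ∀ c, (Y c).PosSemidef) (hY0 : ∃ c, Y c ≠ 0)
    {ν : Ch → Matrix Q' Q' ℂ} (hν : ∀ ch, ν ch = ∑ cb, ptA (Y (cb, ch))) :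
    0 < qesSum α r f Y ν := by
  refine (qesSum_nonneg α r f Y ν).lt_of_ne' fun h => ?_
  obtain ⟨⟨cb, ch⟩, hc⟩ := hY0
  have hνp : (ν ch).PosSemidef := hν ch ▸ marginal_posSemidef hY ch
  have h1 : ∀ c, ((1 : Matrix Q Q ℂ) ⊗ₖ pw (ν c.2) ((-r / 2 : ℝ) : ℂ)) * Y c *
      ((1 : Matrix Q Q ℂ) ⊗ₖ pw (ν c.2) ((-r / 2 : ℝ) : ℂ)) = 0 := fun c => by
    have h2 := (Finset.sum_eq_zero_iff_of_nonneg fun c _ =>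
      mul_nonneg (by positivity) (trp_nonneg _ _)).1 h c (Finset.mem_univ _)
    exact trp_eq_zero (sandwich_one_kronecker_posSemidef (hY c) _ _) hα.ne'
      ((mul_eq_zero.1 h2).resolve_left (by positivity))
  have h2 : pw (ν ch) ((-r / 2 : ℝ) : ℂ) * ν ch * pw (ν ch) ((-r / 2 : ℝ) : ℂ) = 0 := by
    conv_lhs => enter [1, 2]; rw [hν]
    rw [Finset.mul_sum, Finset.sum_mul]
    refine Finset.sum_eq_zero fun cb _ => ?_
    rw [← ptA_conj, h1 (cb, ch)]
    ext; simp [ptA]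
  have h3 : pw (ν ch) ((1 - r : ℝ) : ℂ) = 0 := by
    rw [← h2]
    conv_rhs => enter [1, 2]; rw [← pw_one hνp, ← Complex.ofReal_one]
    rw [pw_mul, pw_mul, ← Complex.ofReal_add, ← Complex.ofReal_add]
    congr 2; ring
  have h4 : ν ch = 0 := trp_eq_zero hνp (by linarith : 1 - r ≠ 0) (by rw [trp, h3]; simp)
  have h5 : ∑ cb, (ptA (Y (cb, ch))).trace = 0 := by
    rw [← trace_sum, ← hν, h4, trace_zero]
  have h6 := (Finset.sum_eq_zero_iff_of_nonneg fun cb _ =>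
    (ptA_posSemidef (hY (cb, ch))).trace_nonneg).1 h5 cb (Finset.mem_univ _)
  refine hc ((hY _).trace_eq_zero_iff.1 ?_)
  rw [← h6]
  exact Fintype.sum_prod_type_right fun x => Y (cb, ch) x x

/-- A normalized quantum estimation score-system has nonnegative entropy. -/
lemma qesSum_le_one {α p r : ℝ} (hα : 1 < α) (hp : p = (α - 1) / α) (hr : r = p / (1 + p))
    (f : Cb → Ch → ℝ) {Y : Cb × Ch → Matrix (Q × Q') (Q × Q') ℂ} (hY : ∀ c, (Y c).PosSemidef)
    {ν : Ch → Matrix Q' Q' ℂ} (hν : ∀ ch, ν ch = ∑ cb, ptA (Y (cb, ch)))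
    (h : ∀ b : ℝ, 1 < b → ∃ τ : Ch → Matrix Q' Q' ℂ, (∀ ch, (τ ch).PosDef) ∧
      ∑ ch, (τ ch).trace.re ≤ b ∧ qesSum α p f Y τ ≤ b) :
    qesSum (1 + p) r f Y ν ≤ 1 := by
  refine le_of_forall_gt_imp_ge_of_dense fun b hb => ?_
  obtain ⟨τ, hτ, hτb, hb'⟩ := h b hb
  have hb0 : 0 < b := by linarith
  refine (qesSum_marginal_le hα hp hr f hY hτ hb0.le hτb hν).trans ?_
  calc b ^ p * qesSum α p f Y τ ^ (1 / α) ≤ b ^ p * b ^ (1 / α) := by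
        gcongr
        exact qesSum_nonneg _ _ _ _ _
    _ = b := by
        rw [← Real.rpow_add hb0, hp]
        have : (α - 1) / α + 1 / α = 1 := by field_simp; ring
        rw [this, Real.rpow_one]

end QESPos

lemma redR_ne_zero {A R E : Type} [Fintype A] [DecidableEq A] [Fintype R] [DecidableEq R]
    [Fintype E] [DecidableEq E] {X : Matrix (A × (R × E)) (A × (R × E)) ℂ} (hX : X.PosSemidef)
    (hX0 : X ≠ 0) : redR X ≠ 0 := by
  intro h
  refine hX0 (hX.trace_eq_zero_iff.1 ?_)
  have : X.trace = (redR X).trace := by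
    refine (Fintype.sum_prod_type _).trans (Eq.trans ?_ (Fintype.sum_prod_type _).symm)
    exact Finset.sum_congr rfl fun a _ => Fintype.sum_prod_type_right fun x => X (a, x) (a, x)
  rw [this, h, trace_zero]

end Conclusion

theorem qes_entropy_accumulation_with_leakage
    (n : ℕ) (R E S Rh Lk Cb Ch : ℕ → Type)
    [∀ i, Fintype (R i)] [∀ i, DecidableEq (R i)] [∀ i, Nonempty (R i)]
    [∀ i, Fintype (E i)] [∀ i, DecidableEq (E i)] [∀ i, Nonempty (E i)]
    [∀ i, Fintype (S i)] [∀ i, DecidableEq (S i)] [∀ i, Nonempty (S i)]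
    [∀ i, Fintype (Rh i)] [∀ i, DecidableEq (Rh i)] [∀ i, Nonempty (Rh i)]
    [∀ i, Fintype (Lk i)] [∀ i, DecidableEq (Lk i)] [∀ i, Nonempty (Lk i)]
    [∀ i, Fintype (Cb i)] [∀ i, DecidableEq (Cb i)] [∀ i, Nonempty (Cb i)]
    [∀ i, Fintype (Ch i)] [∀ i, DecidableEq (Ch i)] [∀ i, Nonempty (Ch i)]
    -- the leakage channels `𝓛_j : R_j → R̂_j L_j`
    (𝓛 : (j : ℕ) → Matrix (R j) (R j) ℂ →ₗ[ℂ] Matrix (Rh j × Lk j) (Rh j × Lk j) ℂ)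
    (h𝓛 : ∀ j, IsCPTP (𝓛 j))
    -- the main channels `𝒩_j : R̂_j L_j E_j → S_j R_{j+1} E_{j+1} C̄_j Ĉ_j`
    (𝒩 : (j : ℕ) → Matrix ((Rh j × Lk j) × E j) ((Rh j × Lk j) × E j) ℂ →ₗ[ℂ]
      Matrix ((S j × (Cb j × Ch j)) × (R (j + 1) × E (j + 1)))
        ((S j × (Cb j × Ch j)) × (R (j + 1) × E (j + 1))) ℂ)
    (h𝒩 : ∀ j, IsCPTP (𝒩 j))
    -- the registers `C̄_j Ĉ_j` are always classical
    (hclass : ∀ j (τ : Matrix ((Rh j × Lk j) × E j) ((Rh j × Lk j) × E j) ℂ),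
      pinchC ((𝒩 j) τ) = (𝒩 j) τ)
    -- the non-signalling condition on `𝒩_j`
    (hNS : ∀ j, ∃ Rch : Matrix (Lk j × E j) (Lk j × E j) ℂ →ₗ[ℂ]
        Matrix (E (j + 1) × Ch j) (E (j + 1) × Ch j) ℂ, IsCPTP Rch ∧
      ∀ τ : Matrix ((Rh j × Lk j) × E j) ((Rh j × Lk j) × E j) ℂ,
        traceOut (eNSout (S j) (Cb j) (Ch j) (R (j + 1)) (E (j + 1))) ((𝒩 j) τ)
          = Rch (traceOut (eNSin (Rh j) (Lk j) (E j)) τ))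
    -- the initial state
    (ω0 : Matrix (R 0 × E 0) (R 0 × E 0) ℂ) (hω0 : IsState ω0)
    -- the QES `f_{|c̄_1^{j−1}ĉ_1^{j−1}}` for each round and prefix
    (f : (j : Fin n) → (∀ i : Fin j.1, Cb i.1) → (∀ i : Fin j.1, Ch i.1) →
      Cb j.1 → Ch j.1 → ℝ)
    (α : ℝ) (hα1 : 1 < α) (hα2 : α < 2)
    -- `κ_{c̄_1^{j−1}ĉ_1^{j−1}} = inf_{ν ∈ Σ_j^𝒩} H^{f_{|prefix}}_{α̂}(S_j C̄_j | Ĉ_j E_j Ẽ)_ν`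
    (κ : (j : Fin n) → (∀ i : Fin j.1, Cb i.1) → (∀ i : Fin j.1, Ch i.1) → ℝ)
    (hκ : ∀ (j : Fin n) cb ch, κ j cb ch =
      sInf {x : ℝ | ∃ ω : Matrix ((((Rh j.1 × Lk j.1) × E j.1) × ((Rh j.1 × Lk j.1) × E j.1)))
          ((((Rh j.1 × Lk j.1) × E j.1) × ((Rh j.1 × Lk j.1) × E j.1))) ℂ,
        IsState ω ∧
        x = QESent (1 / (2 - α)) (f j cb ch)
          (traceOut (eKappa ((Rh j.1 × Lk j.1) × E j.1) (S j.1) (Cb j.1) (Ch j.1)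
              (R (j.1 + 1)) (E (j.1 + 1)))
            ((lext (𝒩 j.1)) ω))})
    -- `ξ_j = sup_{ν ∈ Σ_j^𝓛} I_α↓(Z̃; L_j)_ν`
    (ξ : Fin n → ℝ)
    (hξ : ∀ j : Fin n, ξ j =
      sSup {x : ℝ | ∃ ω : Matrix (R j.1 × R j.1) (R j.1 × R j.1) ℂ, IsState ω ∧
        x = (Idown α (traceOut (eXi (R j.1) (Rh j.1) (Lk j.1)) ((lext (𝓛 j.1)) ω))).toReal}) :
    -- conclusion 1: `H^{f_full}_{2−1/α}(S_1^n C̄_1^n | Ĉ_1^n E_n)_ρ ≥ Σ_j (min_prefix κ − ξ_j)`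
    (QESent (2 - 1 / α)
        (fun cb ch => ∑ j : Fin n,
          f j (fun i => cb ⟨i.1, i.2.trans j.2⟩) (fun i => ch ⟨i.1, i.2.trans j.2⟩)
            (cb j) (ch j))
        (traceOut (eFinal R E S Cb Ch n)
          (geattlState R E S Cb Ch (fun j => (𝒩 j).comp (rext (𝓛 j))) ω0 n))
      ≥ ∑ j : Fin n,
          (sInf (Set.range fun pc : ((∀ i : Fin j.1, Cb i.1) × (∀ i : Fin j.1, Ch i.1)) =>
              κ j pc.1 pc.2)
            - ξ j))
    ∧
    -- conclusion 2: with the normalized QES `f̂_full`, the entropy is nonnegative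
    (QESent (2 - 1 / α)
        (fun cb ch => ∑ j : Fin n,
          (f j (fun i => cb ⟨i.1, i.2.trans j.2⟩) (fun i => ch ⟨i.1, i.2.trans j.2⟩)
              (cb j) (ch j)
            + κ j (fun i => cb ⟨i.1, i.2.trans j.2⟩) (fun i => ch ⟨i.1, i.2.trans j.2⟩)
            - ξ j))
        (traceOut (eFinal R E S Cb Ch n)
          (geattlState R E S Cb Ch (fun j => (𝒩 j).comp (rext (𝓛 j))) ω0 n))
      ≥ 0) := by
  classical
  have hα0 : 0 < α := by linarith
  obtain ⟨p, hp⟩ : ∃ p, p = (α - 1) / α := ⟨_, rfl⟩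
  have hp0 : 0 < p := by rw [hp]; exact div_pos (by linarith) hα0
  obtain ⟨r, hr⟩ : ∃ r, r = p / (1 + p) := ⟨_, rfl⟩
  have hβ : 2 - 1 / α = 1 + p := by rw [hp]; field_simp; ring
  have hr1 : r < 1 := by rw [hr, div_lt_one (by linarith)]; linarith
  let g : (j : ℕ) → (∀ i : Fin j, Cb i) → (∀ i : Fin j, Ch i) → Cb j → Ch j → ℝ :=
    fun j pc ph x y => if h : j < n then f ⟨j, h⟩ pc ph x y + κ ⟨j, h⟩ pc ph - ξ ⟨j, h⟩ else 0
  have hinv : ∀ j ≤ n, ∀ b : ℝ, 1 < b → ∃ τ : (∀ i : Fin j, Ch i) → Matrix (E j) (E j) ℂ,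
      (∀ ch, (τ ch).PosDef) ∧ ∑ ch, (τ ch).trace.re ≤ b ∧
      qesSum α p (accScore g j) (fun c => redR (accBlk (leakState 𝓛 𝒩 ω0 j) c)) τ ≤ b := by
    intro j
    induction j with
    | zero => exact fun _ b hb => accumulation_base h𝓛 h𝒩 hω0 hα1 hp g hb
    | succ j ih =>
      intro hj b hb
      exact accumulation_step h𝓛 h𝒩 hω0 j (hNS j) hα1 hα2 hp (hξ ⟨j, hj⟩) (f ⟨j, hj⟩)
        (hκ ⟨j, hj⟩) (fun pc ph cb ch => dif_pos hj) (ih (Nat.le_of_succ_le hj)) hb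
  set Y : (∀ i : Fin n, Cb i) × (∀ i : Fin n, Ch i) →
    Matrix ((∀ i : Fin n, S i) × E n) ((∀ i : Fin n, S i) × E n) ℂ :=
    fun c => redR (accBlk (leakState 𝓛 𝒩 ω0 n) c)
  have hYp : ∀ c, (Y c).PosSemidef := fun c =>
    redR_posSemidef (accBlk_leakState_posSemidef h𝓛 h𝒩 hω0 n c)
  have hY0 : ∃ c, Y c ≠ 0 := by
    obtain ⟨c, hc⟩ := exists_accBlk_leakState_ne_zero h𝓛 h𝒩 hω0 n
    exact ⟨c, redR_ne_zero (accBlk_leakState_posSemidef h𝓛 h𝒩 hω0 n c) hc⟩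
  have hle := qesSum_le_one hα1 hp hr (accScore g n) hYp (fun _ => rfl) (hinv n le_rfl)
  have hent : ∀ F, QESent (2 - 1 / α) F (traceOut (eFinal R E S Cb Ch n)
      (geattlState R E S Cb Ch (fun j => (𝒩 j).comp (rext (𝓛 j))) ω0 n)) =
      (-p)⁻¹ * Real.logb 2 (qesSum (1 + p) r F Y fun ch => ∑ cb, ptA (Y (cb, ch))) := by
    intro F
    rw [hβ, QESent_eq (r := r) (by linarith) (by rw [hr]; ring) F hYp
      (marginal_posSemidef hYp) (fun _ => rfl)]
    · congr 2; ring
    · intro ch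
      ext x y
      simp only [QprimeBlock, of_apply, Matrix.sum_apply, ptA, Y, redR]
      rfl
  have hacc : ∀ cb ch, accScore g n cb ch = ∑ j : Fin n,
      (f j (fun i => cb ⟨i.1, i.2.trans j.2⟩) (fun i => ch ⟨i.1, i.2.trans j.2⟩) (cb j) (ch j)
        + κ j (fun i => cb ⟨i.1, i.2.trans j.2⟩) (fun i => ch ⟨i.1, i.2.trans j.2⟩)
        - ξ j) := fun cb ch => Finset.sum_congr rfl fun j _ => dif_pos j.2
  constructor
  · rw [hent]
    set F : (∀ i : Fin n, Cb i) → (∀ i : Fin n, Ch i) → ℝ := fun cb ch => ∑ j : Fin n,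
      f j (fun i => cb ⟨i.1, i.2.trans j.2⟩) (fun i => ch ⟨i.1, i.2.trans j.2⟩) (cb j) (ch j)
    set K : ℝ := ∑ j : Fin n, (sInf (Set.range fun pc : ((∀ i : Fin j.1, Cb i.1) ×
      (∀ i : Fin j.1, Ch i.1)) => κ j pc.1 pc.2) - ξ j)
    have hF : ∀ cb ch, F cb ch + K ≤ accScore g n cb ch := by
      intro cb ch
      rw [hacc, ← Finset.sum_add_distrib]
      refine Finset.sum_le_sum fun j _ => ?_
      have := csInf_le (Set.finite_range fun pc : ((∀ i : Fin j.1, Cb i.1) ×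
        (∀ i : Fin j.1, Ch i.1)) => κ j pc.1 pc.2).bddBelow
        ⟨((fun i => cb ⟨i.1, i.2.trans j.2⟩), (fun i => ch ⟨i.1, i.2.trans j.2⟩)), rfl⟩
      dsimp only at this
      linarith
    have hpos := qesSum_pos (by linarith : 0 < 1 + p) hr1 F hYp hY0 (fun _ => rfl)
    have hK : (2 : ℝ) ^ (p * K) * qesSum (1 + p) r F Y (fun ch => ∑ cb, ptA (Y (cb, ch))) ≤ 1 := by
      refine le_trans ?_ hle
      rw [qesSum, Finset.mul_sum]
      refine Finset.sum_le_sum fun c _ => ?_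
      rw [← mul_assoc, ← Real.rpow_add (by norm_num)]
      refine mul_le_mul_of_nonneg_right ?_ (trp_nonneg _ _)
      refine Real.rpow_le_rpow_of_exponent_le (by norm_num) ?_
      have := mul_le_mul_of_nonneg_left (hF c.1 c.2) hp0.le
      linarith
    have hlog : Real.logb 2 (qesSum (1 + p) r F Y fun ch => ∑ cb, ptA (Y (cb, ch))) ≤ -(p * K) := by
      rw [Real.logb_le_iff_le_rpow (by norm_num) hpos, Real.rpow_neg (by norm_num), ← one_div,
        le_div_iff₀ (by positivity), mul_comm]
      exact hK
    rw [ge_iff_le, inv_neg, neg_mul, ← div_eq_inv_mul, ← neg_div, le_div_iff₀ hp0]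
    linarith
  · rw [hent]
    simp only [← hacc]
    exact mul_nonneg_of_nonpos_of_nonpos (inv_nonpos.2 (by linarith))
      (Real.logb_nonpos (by norm_num) (qesSum_nonneg _ _ _ _ _) hle)

end QITLeak
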